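/- Let ᾱ ∈ (0,1) be the universal Hölder exponent from the interior C^{2,ᾱ} regularity theorem for F(D²u) = 0 in the plane, and let 0 < α < ᾱ. Let u be continuous on B̄₁ ⊂ ℝ² and a viscosity solution of F(D²u, Du, u, x) = f in B₁, where F(M,p,s,x) is continuous, uniformly elliptic with constants λ, Λ, b, c, f ∈ C^α(B̄₁), and F satisfies |F(M,p,s,x) − F(M,p,s,y)| ≤ K₁|x−y|^α(|M| + |p| + |s|) + K₂|x−y|^α for all symmetric 2×2 matrices M, all p ∈ ℝ², s ∈ ℝ and x, y ∈ B₁. Then u ∈ C^{2,α}(B̄_{1/2}) and ‖u‖_{C^{2,α}(B̄_{1/2})} ≤ C(‖u‖_{L^∞(B₁)} + ‖f‖_{C^α(B̄₁)} + |F(0,0,0,0)| + K₂), where C depends only on λ, Λ, b, c, K₁ and α. -/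

import Mathlib

open Metric Set Real
open scoped Classical

noncomputable section

abbrev E2 : Type := EuclideanSpace ℝ (Fin 2)
abbrev Mat2 : Type := Matrix (Fin 2) (Fin 2) ℝ

/-- `‖A⁺‖`: the sum of the positive parts of the eigenvalues of a symmetric matrix `A`. -/
noncomputable def posNorm (A : Mat2) : ℝ :=
  if h : A.IsHermitian then ∑ i, max (h.eigenvalues i) 0 else 0

/-- `‖A⁻‖`: the sum of the negative parts of the eigenvalues of a symmetric matrix `A`. -/
noncomputable def negNorm (A : Mat2) : ℝ :=
  if h : A.IsHermitian then ∑ i, max (-(h.eigenvalues i)) 0 else 0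

/-- A norm on 2×2 matrices: sum of absolute values of entries. -/
noncomputable def matNorm (A : Mat2) : ℝ := ∑ i, ∑ j, |A i j|

/-- `F` is uniformly elliptic with constants `0 < lam ≤ Lam`:
`F M - F N ≤ Lam ‖(M-N)⁺‖ - lam ‖(M-N)⁻‖` for all symmetric `M, N`. -/
def UniformlyElliptic (lam Lam : ℝ) (F : Mat2 → ℝ) : Prop :=
  ∀ M N : Mat2, M.IsHermitian → N.IsHermitian →
    F M - F N ≤ Lam * posNorm (M - N) - lam * negNorm (M - N)

/-- The Hessian matrix `D²u(x)` of `u : ℝ² → ℝ` at `x`. -/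
noncomputable def hess (u : E2 → ℝ) (x : E2) : Mat2 :=
  Matrix.of fun i j =>
    fderiv ℝ (fun y => fderiv ℝ u y (EuclideanSpace.single j 1)) x (EuclideanSpace.single i 1)

/-- `sup_s |u|`, the `L^∞` norm of `u` on `s`. -/
noncomputable def supAbs (u : E2 → ℝ) (s : Set E2) : ℝ := ⨆ x ∈ s, |u x|

/-- `F(M,p,s,x)` is uniformly elliptic with constants `lam, Lam, b, c`:
`F(M,p,s,x) − F(N,q,t,x) ≤ Lam‖(M−N)⁺‖ − lam‖(M−N)⁻‖ + b|p−q| + c|s−t|`. -/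
def UniformlyEllipticGen (lam Lam b c : ℝ) (F : Mat2 → E2 → ℝ → E2 → ℝ) : Prop :=
  ∀ (M N : Mat2) (p q : E2) (s t : ℝ) (x : E2),
    M.IsHermitian → N.IsHermitian → x ∈ ball (0 : E2) 1 →
      F M p s x - F N q t x ≤
        Lam * posNorm (M - N) - lam * negNorm (M - N) + b * ‖p - q‖ + c * |s - t|

/-- `u` is a viscosity solution of `F(D²u, Du, u, x) = f(x)` on `Ω`. -/
def IsViscositySolGen (F : Mat2 → E2 → ℝ → E2 → ℝ) (f u : E2 → ℝ) (Ω : Set E2) : Prop :=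
  ∀ φ : E2 → ℝ, ContDiff ℝ 2 φ → ∀ x₀ ∈ Ω,
    (IsLocalMax (fun x => u x - φ x) x₀ →
      f x₀ ≤ F (hess φ x₀) (gradient φ x₀) (u x₀) x₀) ∧
    (IsLocalMin (fun x => u x - φ x) x₀ →
      F (hess φ x₀) (gradient φ x₀) (u x₀) x₀ ≤ f x₀)

/-- `‖f‖_{C^α(B̄₁)} = sup_{B̄₁} |f| + [f]_{α, B̄₁}`. -/
noncomputable def holderNormBall (α : ℝ) (f : E2 → ℝ) : ℝ :=
  supAbs f (closedBall 0 1) +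
    ⨆ p : E2 × E2,
      if p.1 ∈ closedBall (0 : E2) 1 ∧ p.2 ∈ closedBall (0 : E2) 1 ∧ p.1 ≠ p.2 then
        |f p.1 - f p.2| / ‖p.1 - p.2‖ ^ α
      else 0

open MeasureTheory
open scoped ContDiff

open MeasureTheory
open scoped ContDiff

/-- Smooth real functions on the plane. -/
def Sm (f : ℂ → ℝ) : Prop := ContDiff ℝ ∞ f

/-- Directional derivative. -/
def dd (v : ℂ) (f : ℂ → ℝ) : ℂ → ℝ := fun z => fderiv ℝ f z v

def dx (f : ℂ → ℝ) : ℂ → ℝ := dd 1 f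
def dy (f : ℂ → ℝ) : ℂ → ℝ := dd Complex.I f

lemma Sm.diff {f : ℂ → ℝ} (hf : Sm f) : Differentiable ℝ f :=
  ContDiff.differentiable hf (by simp)

lemma Sm.dd {f : ℂ → ℝ} (hf : Sm f) (v : ℂ) : Sm (dd v f) := by
  unfold Sm _root_.dd at *
  exact (ContDiff.fderiv_right (m := ∞) hf (by simp)).clm_apply contDiff_const

lemma Sm.dx {f : ℂ → ℝ} (hf : Sm f) : Sm (dx f) := hf.dd 1
lemma Sm.dy {f : ℂ → ℝ} (hf : Sm f) : Sm (dy f) := hf.dd _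

lemma Sm.cont {f : ℂ → ℝ} (hf : Sm f) : Continuous f := ContDiff.continuous hf
lemma Sm.add {f g : ℂ → ℝ} (hf : Sm f) (hg : Sm g) : Sm (fun z => f z + g z) := ContDiff.add hf hg
lemma Sm.sub {f g : ℂ → ℝ} (hf : Sm f) (hg : Sm g) : Sm (fun z => f z - g z) := ContDiff.sub hf hg
lemma Sm.mul {f g : ℂ → ℝ} (hf : Sm f) (hg : Sm g) : Sm (fun z => f z * g z) := ContDiff.mul hf hg
lemma Sm.neg {f : ℂ → ℝ} (hf : Sm f) : Sm (fun z => - f z) := ContDiff.neg hf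
lemma Sm.pow {f : ℂ → ℝ} (hf : Sm f) (n : ℕ) : Sm (fun z => f z ^ n) := ContDiff.pow hf n
lemma Sm.const (c : ℝ) : Sm (fun _ => c) := contDiff_const
lemma Sm.re : Sm (fun z => z.re) := Complex.reCLM.contDiff
lemma Sm.im : Sm (fun z => z.im) := Complex.imCLM.contDiff
lemma Sm.comp_aff {f : ℂ → ℝ} (hf : Sm f) (a : ℂ) (r : ℝ) : Sm (fun z => f (a + r * z)) :=
  ContDiff.comp hf (contDiff_const.add (contDiff_const.mul contDiff_id))

lemma dd_add {f g : ℂ → ℝ} (hf : Sm f) (hg : Sm g) (v : ℂ) :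
    dd v (fun z => f z + g z) = fun z => dd v f z + dd v g z := by
  funext z; simp only [dd]; rw [fderiv_fun_add (hf.diff z) (hg.diff z)]; rfl
lemma dd_sub {f g : ℂ → ℝ} (hf : Sm f) (hg : Sm g) (v : ℂ) :
    dd v (fun z => f z - g z) = fun z => dd v f z - dd v g z := by
  funext z; simp only [dd]; rw [fderiv_fun_sub (hf.diff z) (hg.diff z)]; rfl
lemma dd_mul {f g : ℂ → ℝ} (hf : Sm f) (hg : Sm g) (v : ℂ) :
    dd v (fun z => f z * g z) = fun z => dd v f z * g z + f z * dd v g z := by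
  funext z; simp only [dd]; rw [fderiv_fun_mul (hf.diff z) (hg.diff z)]
  simp; ring
lemma dd_neg (f : ℂ → ℝ) (v : ℂ) :
    dd v (fun z => - f z) = fun z => - dd v f z := by
  funext z; simp only [dd]; rw [fderiv_fun_neg]; rfl
lemma dd_const (c : ℝ) (v : ℂ) : dd v (fun _ => c) = fun _ => 0 := by
  funext z; simp [dd]
lemma dd_const_mul {f : ℂ → ℝ} (hf : Sm f) (c : ℝ) (v : ℂ) :
    dd v (fun z => c * f z) = fun z => c * dd v f z := by
  rw [dd_mul (Sm.const c) hf, dd_const]; simp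
lemma dd_re (v : ℂ) : dd v (fun z => z.re) = fun _ => v.re := by
  funext z; simp only [dd]
  have : (fun z : ℂ => z.re) = Complex.reCLM := rfl
  rw [this, ContinuousLinearMap.fderiv]; rfl
lemma dd_im (v : ℂ) : dd v (fun z => z.im) = fun _ => v.im := by
  funext z; simp only [dd]
  have : (fun z : ℂ => z.im) = Complex.imCLM := rfl
  rw [this, ContinuousLinearMap.fderiv]; rfl
lemma dd_comm {f : ℂ → ℝ} (hf : Sm f) (v u : ℂ) : dd v (dd u f) = dd u (dd v f) := by
  funext z
  have h1 : ∀ a : ℂ, DifferentiableAt ℝ (fun y => fderiv ℝ f y) a := fun a =>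
    ((ContDiff.fderiv_right (m := 1) hf (by norm_cast)).differentiable (by simp)) a
  have key : ∀ a b : ℂ, dd a (dd b f) z = fderiv ℝ (fderiv ℝ f) z a b := by
    intro a b
    have e : dd b f = fun y => (fderiv ℝ f y) b := rfl
    have h2 := (h1 z).hasFDerivAt.clm_apply (hasFDerivAt_const b z)
    rw [e]
    simp only [dd]
    rw [h2.fderiv]
    simp
  rw [key, key]
  have hs : IsSymmSndFDerivAt ℝ f z := by
    apply ContDiffAt.isSymmSndFDerivAt (n := ∞) (ContDiff.contDiffAt hf) (by simp; norm_cast)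
  exact hs v u
lemma dd_eq {f : ℂ → ℝ} (v z : ℂ) : dd v f z = v.re * dx f z + v.im * dy f z := by
  have : v = v.re • (1:ℂ) + v.im • Complex.I := by
    apply Complex.ext <;> simp
  conv_lhs => rw [this]
  simp only [dd, dx, dy, map_add, map_smul, smul_eq_mul]

lemma dx_dy_comm {f : ℂ → ℝ} (hf : Sm f) : dy (dx f) = dx (dy f) := dd_comm hf _ _

/-- Chain rule along a curve. -/
lemma Sm.curve {f : ℂ → ℝ} (hf : Sm f) {γ : ℝ → ℂ} {γ' : ℂ} {t : ℝ} (hγ : HasDerivAt γ γ' t) :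
    HasDerivAt (fun s => f (γ s)) (γ'.re * _root_.dx f (γ t) + γ'.im * _root_.dy f (γ t)) t := by
  have := (hf.diff (γ t)).hasFDerivAt.comp_hasDerivAt t hγ
  rw [← dd_eq]; exact this

lemma dd_comp_aff {f : ℂ → ℝ} (hf : Sm f) (a : ℂ) (r : ℝ) (v : ℂ) :
    dd v (fun z => f (a + r * z)) = fun z => r * dd v f (a + r * z) := by
  funext z
  simp only [dd]
  have h1 : HasFDerivAt (fun z : ℂ => a + (r:ℂ) * z) (r • ContinuousLinearMap.id ℝ ℂ) z := by
    have := ((hasFDerivAt_id (𝕜 := ℝ) z).const_mul (r:ℂ)).const_add a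
    simpa using this
  have h2 := (hf.diff (a + r * z)).hasFDerivAt.comp z h1
  have h3 : (fun z => f (a + r * z)) = f ∘ (fun z : ℂ => a + (r:ℂ) * z) := rfl
  rw [h3, h2.fderiv]
  simp only [ContinuousLinearMap.comp_apply, smul_apply,
    ContinuousLinearMap.id_apply]
  rw [map_smul]; rfl

/-- Laplacian. -/
def La (f : ℂ → ℝ) : ℂ → ℝ := fun z => dx (dx f) z + dy (dy f) z
def mr (f : ℂ → ℝ) : ℂ → ℝ := fun z => dx (dx f) z - dy (dy f) z
def mi (f : ℂ → ℝ) : ℂ → ℝ := fun z => 2 * dx (dy f) z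
/-- traceless part of the Hessian as a complex number. -/
def mm (f : ℂ → ℝ) : ℂ → ℂ := fun z => ⟨mr f z, mi f z⟩
/-- gradient as a complex number. -/
def gr (f : ℂ → ℝ) : ℂ → ℂ := fun z => ⟨dx f z, dy f z⟩
/-- squared size of the Hessian. -/
def hn (f : ℂ → ℝ) : ℂ → ℝ := fun z => La f z ^ 2 + mr f z ^ 2 + mi f z ^ 2

lemma Sm.La {f : ℂ → ℝ} (hf : Sm f) : Sm (La f) := hf.dx.dx.add hf.dy.dy
lemma Sm.mr {f : ℂ → ℝ} (hf : Sm f) : Sm (mr f) := hf.dx.dx.sub hf.dy.dy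
lemma Sm.mi {f : ℂ → ℝ} (hf : Sm f) : Sm (mi f) := (Sm.const 2).mul hf.dy.dx
lemma Sm.hn {f : ℂ → ℝ} (hf : Sm f) : Sm (hn f) := ((hf.La.pow 2).add (hf.mr.pow 2)).add (hf.mi.pow 2)
lemma mk_cont {a b : ℂ → ℝ} (ha : Continuous a) (hb : Continuous b) :
    Continuous (fun z => (⟨a z, b z⟩ : ℂ)) := by
  have : (fun z => (⟨a z, b z⟩ : ℂ)) = fun z => (a z : ℂ) + (b z : ℂ) * Complex.I := by
    funext z; apply Complex.ext <;> simp
  rw [this]; fun_prop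
lemma Sm.mm {f : ℂ → ℝ} (hf : Sm f) : Continuous (mm f) := mk_cont hf.mr.cont hf.mi.cont
lemma Sm.gr {f : ℂ → ℝ} (hf : Sm f) : Continuous (gr f) := mk_cont hf.dx.cont hf.dy.cont

lemma mm_sq (f : ℂ → ℝ) (z : ℂ) : ‖mm f z‖ ^ 2 = mr f z ^ 2 + mi f z ^ 2 := by
  rw [← Complex.normSq_eq_norm_sq, Complex.normSq_apply]; simp [mm]; ring
lemma gr_sq (f : ℂ → ℝ) (z : ℂ) : ‖gr f z‖ ^ 2 = dx f z ^ 2 + dy f z ^ 2 := by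
  rw [← Complex.normSq_eq_norm_sq, Complex.normSq_apply]; simp [gr]; ring
lemma hn_eq (f : ℂ → ℝ) (z : ℂ) : hn f z = La f z ^ 2 + ‖mm f z‖ ^ 2 := by
  rw [mm_sq, hn]; ring
lemma hn_nonneg (f : ℂ → ℝ) (z : ℂ) : 0 ≤ hn f z := by unfold hn; positivity

section lin
variable {f g : ℂ → ℝ} (hf : Sm f) (hg : Sm g)
include hf hg
lemma La_add : La (fun z => f z + g z) = fun z => La f z + La g z := by
  funext z; simp only [La, dx, dy, dd_add hf hg, dd_add (hf.dd _) (hg.dd _)]; ring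
lemma mr_add : mr (fun z => f z + g z) = fun z => mr f z + mr g z := by
  funext z; simp only [mr, dx, dy, dd_add hf hg, dd_add (hf.dd _) (hg.dd _)]; ring
lemma mi_add : mi (fun z => f z + g z) = fun z => mi f z + mi g z := by
  funext z; simp only [mi, dx, dy, dd_add hf hg, dd_add (hf.dd _) (hg.dd _)]; ring
lemma mm_add : mm (fun z => f z + g z) = fun z => mm f z + mm g z := by
  funext z; apply Complex.ext <;> simp [mm, mr_add hf hg, mi_add hf hg]
lemma gr_add : gr (fun z => f z + g z) = fun z => gr f z + gr g z := by
  funext z; apply Complex.ext <;> simp [gr, dx, dy, dd_add hf hg]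
lemma La_sub : La (fun z => f z - g z) = fun z => La f z - La g z := by
  funext z; simp only [La, dx, dy, dd_sub hf hg, dd_sub (hf.dd _) (hg.dd _)]; ring
lemma mr_sub : mr (fun z => f z - g z) = fun z => mr f z - mr g z := by
  funext z; simp only [mr, dx, dy, dd_sub hf hg, dd_sub (hf.dd _) (hg.dd _)]; ring
lemma mi_sub : mi (fun z => f z - g z) = fun z => mi f z - mi g z := by
  funext z; simp only [mi, dx, dy, dd_sub hf hg, dd_sub (hf.dd _) (hg.dd _)]; ring
lemma mm_sub : mm (fun z => f z - g z) = fun z => mm f z - mm g z := by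
  funext z; apply Complex.ext <;> simp [mm, mr_sub hf hg, mi_sub hf hg]
lemma gr_sub : gr (fun z => f z - g z) = fun z => gr f z - gr g z := by
  funext z; apply Complex.ext <;> simp [gr, dx, dy, dd_sub hf hg]
end lin

section scal
variable {f : ℂ → ℝ} (hf : Sm f) (c : ℝ) (a : ℂ) (r : ℝ)
include hf
lemma gr_scal : gr (fun z => c * f (a + r * z)) = fun z => (c * r : ℝ) * gr f (a + r * z) := by
  funext z
  have h := hf.comp_aff a r
  apply Complex.ext <;> simp only [gr, dx, dy, dd_const_mul h, dd_comp_aff hf, Complex.re_ofReal_mul,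
    Complex.im_ofReal_mul] <;> ring
lemma dd2_scal (u v : ℂ) : dd u (dd v (fun z => c * f (a + r * z))) =
    fun z => c * r ^ 2 * dd u (dd v f) (a + r * z) := by
  have h := hf.comp_aff a r
  rw [dd_const_mul h, dd_comp_aff hf, dd_const_mul (((Sm.const r).mul ((hf.dd v).comp_aff a r))),
    dd_const_mul ((hf.dd v).comp_aff a r), dd_comp_aff (hf.dd v)]
  funext z; ring
lemma La_scal : La (fun z => c * f (a + r * z)) = fun z => c * r ^ 2 * La f (a + r * z) := by
  funext z; simp only [La, dx, dy, dd2_scal hf]; ring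
lemma mr_scal : mr (fun z => c * f (a + r * z)) = fun z => c * r ^ 2 * mr f (a + r * z) := by
  funext z; simp only [mr, dx, dy, dd2_scal hf]; ring
lemma mi_scal : mi (fun z => c * f (a + r * z)) = fun z => c * r ^ 2 * mi f (a + r * z) := by
  funext z; simp only [mi, dx, dy, dd2_scal hf]; ring
lemma mm_scal : mm (fun z => c * f (a + r * z)) = fun z => (c * r ^ 2 : ℝ) * mm f (a + r * z) := by
  funext z
  apply Complex.ext <;> simp only [mm, mr_scal hf, mi_scal hf, Complex.re_ofReal_mul,
    Complex.im_ofReal_mul]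
lemma hn_scal : hn (fun z => c * f (a + r * z)) = fun z => (c * r ^ 2) ^ 2 * hn f (a + r * z) := by
  funext z; simp only [hn, La_scal hf, mr_scal hf, mi_scal hf]; ring
end scal

/-- Integral over the disc of radius `r`. -/
def Ib (r : ℝ) (f : ℂ → ℝ) : ℝ := ∫ z in closedBall (0:ℂ) r, f z

lemma cont_io {f : ℂ → ℝ} (hf : Continuous f) (r : ℝ) : IntegrableOn f (closedBall (0:ℂ) r) :=
  hf.continuousOn.integrableOn_compact (isCompact_closedBall _ _)
lemma Ib_mono {r : ℝ} {f g : ℂ → ℝ} (hf : Continuous f) (hg : Continuous g)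
    (h : ∀ z : ℂ, ‖z‖ ≤ r → f z ≤ g z) : Ib r f ≤ Ib r g :=
  setIntegral_mono_on (cont_io hf r) (cont_io hg r) measurableSet_closedBall
    (fun z hz => h z (by simpa using hz))
lemma Ib_nonneg {r : ℝ} {f : ℂ → ℝ} (h : ∀ z : ℂ, ‖z‖ ≤ r → 0 ≤ f z) : 0 ≤ Ib r f :=
  setIntegral_nonneg measurableSet_closedBall (fun z hz => h z (by simpa using hz))
lemma Ib_congr {r : ℝ} {f g : ℂ → ℝ} (h : ∀ z : ℂ, ‖z‖ ≤ r → f z = g z) : Ib r f = Ib r g :=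
  setIntegral_congr_fun measurableSet_closedBall (fun z hz => h z (by simpa using hz))
lemma Ib_add {r : ℝ} {f g : ℂ → ℝ} (hf : Continuous f) (hg : Continuous g) :
    Ib r (fun z => f z + g z) = Ib r f + Ib r g := integral_add (cont_io hf r) (cont_io hg r)
lemma Ib_sub {r : ℝ} {f g : ℂ → ℝ} (hf : Continuous f) (hg : Continuous g) :
    Ib r (fun z => f z - g z) = Ib r f - Ib r g := integral_sub (cont_io hf r) (cont_io hg r)
lemma Ib_mul (r c : ℝ) (f : ℂ → ℝ) : Ib r (fun z => c * f z) = c * Ib r f := integral_const_mul _ _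
lemma Ib_const {r : ℝ} (hr : 0 ≤ r) (c : ℝ) : Ib r (fun _ => c) = π * r ^ 2 * c := by
  unfold Ib
  rw [setIntegral_const, Measure.real, Complex.volume_closedBall]
  simp [hr, max_eq_left]
  left; ring
lemma Ib_mono_set {r s : ℝ} (hrs : r ≤ s) {f : ℂ → ℝ} (hf : Continuous f)
    (h : ∀ z : ℂ, ‖z‖ ≤ s → 0 ≤ f z) : Ib r f ≤ Ib s f := by
  apply setIntegral_mono_set (cont_io hf s)
  · filter_upwards [ae_restrict_mem measurableSet_closedBall] with z hz
    exact h z (by simpa using hz)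
  · exact (closedBall_subset_closedBall hrs).eventuallyLE
/-- scaling: translation by `a`, dilation by `s`. -/
lemma Ib_scale {r s : ℝ} (hs : 0 < s) (f : ℂ → ℝ) :
    Ib r (fun z => f ((s:ℂ) * z)) = (s ^ 2)⁻¹ * Ib (s * r) f := by
  have h := Measure.setIntegral_comp_smul_of_pos (volume : Measure ℂ) f (closedBall (0:ℂ) r) hs
  simp only [Complex.finrank_real_complex, smul_eq_mul] at h
  unfold Ib
  simp only [Complex.real_smul] at h
  rw [h, smul_closedBall' hs.ne']
  simp [abs_of_pos hs]
lemma Ib_trans {r s : ℝ} (a : ℂ) (h : ‖a‖ + r ≤ s) {f : ℂ → ℝ} (hf : Continuous f)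
    (h0 : ∀ z : ℂ, ‖z‖ ≤ s → 0 ≤ f z) : Ib r (fun z => f (a + z)) ≤ Ib s f := by
  unfold Ib
  have : ∫ z in closedBall (0:ℂ) r, f (a + z) = ∫ z in closedBall a r, f z := by
    have hp := (measurePreserving_add_left (volume : Measure ℂ) a)
    have := hp.setIntegral_preimage_emb (measurableEmbedding_addLeft a) f (closedBall a r)
    rw [← this]; congr 2; ext z; simp
  rw [this]
  apply setIntegral_mono_set (cont_io hf s)
  · filter_upwards [ae_restrict_mem measurableSet_closedBall] with z hz
    exact h0 z (by simpa using hz)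
  · apply Filter.Eventually.of_forall
    intro z hz
    have hz' : ‖z - a‖ ≤ r := by simpa [dist_eq_norm] using (mem_closedBall.1 hz)
    apply mem_closedBall_zero_iff.2
    calc ‖z‖ = ‖a + (z - a)‖ := by ring_nf
      _ ≤ ‖a‖ + ‖z - a‖ := norm_add_le _ _
      _ ≤ s := by linarith

/-- polar parametrisation -/
def pc (r θ : ℝ) : ℂ := ⟨r * cos θ, r * sin θ⟩

lemma pc_cont : Continuous (fun p : ℝ × ℝ => pc p.1 p.2) := by
  have : (fun p : ℝ × ℝ => pc p.1 p.2) =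
      fun p => ((p.1 * cos p.2 : ℝ) : ℂ) + ((p.1 * sin p.2 : ℝ) : ℂ) * Complex.I := by
    funext z; apply Complex.ext <;> simp [pc, -Complex.ofReal_cos, -Complex.ofReal_sin]
  rw [this]; fun_prop

@[fun_prop]
lemma pc_cont2 {α : Type*} [TopologicalSpace α] {f g : α → ℝ} (hf : Continuous f) (hg : Continuous g) :
    Continuous (fun a => pc (f a) (g a)) := pc_cont.comp (hf.prodMk hg)

lemma pc_norm {r : ℝ} (hr : 0 ≤ r) (θ : ℝ) : ‖pc r θ‖ = r := by
  rw [← Real.sqrt_sq hr, Complex.norm_def, Complex.normSq_apply]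
  congr 1; simp only [pc]
  rw [Real.sqrt_sq hr]
  nlinarith [sin_sq_add_cos_sq θ]

lemma comp_pc_cont {F : ℂ → ℝ} (hF : Continuous F) : Continuous (fun p : ℝ × ℝ => F (pc p.1 p.2)) :=
  hF.comp pc_cont

/-- circle integral -/
def Ci (r : ℝ) (F : ℂ → ℝ) : ℝ := ∫ θ in (-π)..π, F (pc r θ)

lemma pi_le : -π ≤ π := by linarith [pi_pos]

lemma io_rect {G : ℝ × ℝ → ℝ} (hG : Continuous G) (a b c d : ℝ) :
    IntegrableOn G (uIoc a b ×ˢ uIoc c d) := by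
  have h1 : IntegrableOn G (uIcc a b ×ˢ uIcc c d) :=
    hG.continuousOn.integrableOn_compact (isCompact_uIcc.prod isCompact_uIcc)
  exact h1.mono_set (prod_mono uIoc_subset_uIcc uIoc_subset_uIcc)

lemma polar {R : ℝ} (hR : 0 ≤ R) {F : ℂ → ℝ} (hF : Continuous F) :
    Ib R F = ∫ ρ in (0:ℝ)..R, ρ * Ci ρ F := by
  have h1 := Complex.integral_comp_polarCoord_symm (indicator (closedBall (0:ℂ) R) F)
  rw [integral_indicator measurableSet_closedBall] at h1
  unfold Ib
  rw [← h1, show polarCoord.target = Ioi (0:ℝ) ×ˢ Ioo (-π) π from rfl]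
  have h2 : ∀ p ∈ Ioi (0:ℝ) ×ˢ Ioo (-π) π,
      p.1 • (closedBall (0:ℂ) R).indicator F (Complex.polarCoord.symm p) =
      (Iic R ×ˢ univ).indicator (fun p : ℝ × ℝ => p.1 * F (pc p.1 p.2)) p := by
    intro p hp
    have e : Complex.polarCoord.symm p = pc p.1 p.2 := by
      rw [Complex.polarCoord_symm_apply]
      apply Complex.ext <;> simp [pc, -Complex.ofReal_cos, -Complex.ofReal_sin]
    have hp1 : 0 < p.1 := hp.1
    rw [e]
    by_cases h : p.1 ≤ R
    · rw [indicator_of_mem, indicator_of_mem]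
      · rfl
      · exact ⟨h, trivial⟩
      · simpa [pc_norm hp1.le] using h
    · rw [indicator_of_notMem, indicator_of_notMem]
      · simp
      · intro h'; exact h h'.1
      · simpa [pc_norm hp1.le] using h
  rw [setIntegral_congr_fun (measurableSet_Ioi.prod measurableSet_Ioo) h2]
  rw [setIntegral_indicator (measurableSet_Iic.prod MeasurableSet.univ)]
  have h3 : (Ioi (0:ℝ) ×ˢ Ioo (-π) π) ∩ (Iic R ×ˢ univ) = Ioc 0 R ×ˢ Ioo (-π) π := by
    ext p; simp only [mem_inter_iff, mem_prod, mem_Ioi, mem_Iic, mem_univ, mem_Ioc, and_true]; tauto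
  rw [h3]
  have hG : Continuous (fun p : ℝ × ℝ => p.1 * F (pc p.1 p.2)) :=
    continuous_fst.mul (comp_pc_cont hF)
  rw [Measure.volume_eq_prod, setIntegral_prod]
  · rw [intervalIntegral.integral_of_le hR]
    apply setIntegral_congr_fun measurableSet_Ioc
    intro ρ hρ
    simp only [Ci]
    rw [intervalIntegral.integral_of_le pi_le, integral_Ioc_eq_integral_Ioo, integral_const_mul]
  · have := io_rect hG 0 R (-π) π
    rw [uIoc_of_le hR, uIoc_of_le pi_le] at this
    exact this.mono_set (prod_mono le_rfl Ioo_subset_Ioc_self)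

lemma ci_cont {F : ℂ → ℝ} (hF : Continuous F) : Continuous (fun ρ => Ci ρ F) := by
  unfold Ci
  exact intervalIntegral.continuous_parametric_intervalIntegral_of_continuous' 
    (f := fun ρ θ => F (pc ρ θ)) (comp_pc_cont hF) _ _

lemma Ib_deriv {F : ℂ → ℝ} (hF : Continuous F) {R : ℝ} (hR : 0 < R) :
    HasDerivAt (fun r => Ib r F) (R * Ci R F) R := by
  have hc : Continuous (fun ρ => ρ * Ci ρ F) := continuous_id.mul (ci_cont hF)
  have h := intervalIntegral.integral_hasDerivAt_right (hc.intervalIntegrable 0 R)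
    hc.stronglyMeasurable.stronglyMeasurableAtFilter hc.continuousAt
  apply h.congr_of_eventuallyEq
  filter_upwards [lt_mem_nhds hR] with r hr
  exact polar hr.le hF

lemma pc_deriv_r (r θ : ℝ) : HasDerivAt (fun r => pc r θ) ⟨cos θ, sin θ⟩ r := by
  have e : (fun r => pc r θ) = fun r : ℝ => (r : ℂ) * ⟨cos θ, sin θ⟩ := by
    funext r; apply Complex.ext <;> simp [pc]
  rw [e]
  simpa using (Complex.ofRealCLM.hasDerivAt (x := r)).mul_const (⟨cos θ, sin θ⟩ : ℂ)
lemma pc_deriv_t (r θ : ℝ) : HasDerivAt (fun θ => pc r θ) ⟨- r * sin θ, r * cos θ⟩ θ := by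
  have e : (fun θ => pc r θ) = fun θ : ℝ => ((r * cos θ : ℝ) : ℂ) + ((r * sin θ : ℝ) : ℂ) * Complex.I := by
    funext r; apply Complex.ext <;> simp [pc, -Complex.ofReal_cos, -Complex.ofReal_sin]
  have h1 := ((hasDerivAt_cos θ).const_mul r).ofReal_comp
  have h2 := ((hasDerivAt_sin θ).const_mul r).ofReal_comp
  rw [e]
  have e2 : (⟨- r * sin θ, r * cos θ⟩ : ℂ) = ((r * -sin θ : ℝ) : ℂ) + ((r * cos θ : ℝ) : ℂ) * Complex.I := by
    apply Complex.ext <;> simp [-Complex.ofReal_cos, -Complex.ofReal_sin]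
  rw [e2]
  exact h1.add (h2.mul_const Complex.I)

/-- derivative along the circle -/
def dth (r : ℝ) (f : ℂ → ℝ) (θ : ℝ) : ℝ := r * (cos θ * dy f (pc r θ) - sin θ * dx f (pc r θ))

lemma dth_deriv {f : ℂ → ℝ} (hf : Sm f) (r θ : ℝ) :
    HasDerivAt (fun θ => f (pc r θ)) (dth r f θ) θ := by
  convert hf.curve (pc_deriv_t r θ) using 1
  simp only [dth]; ring
lemma dr_deriv {f : ℂ → ℝ} (hf : Sm f) (r θ : ℝ) :
    HasDerivAt (fun r => f (pc r θ)) (cos θ * dx f (pc r θ) + sin θ * dy f (pc r θ)) r := by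
  convert hf.curve (pc_deriv_r r θ) using 1
lemma dth_cont {f : ℂ → ℝ} (hf : Sm f) (r : ℝ) : Continuous (dth r f) := by
  unfold dth
  have h1 : Continuous (fun θ => dy f (pc r θ)) := (comp_pc_cont hf.dy.cont).comp (Continuous.prodMk_right r)
  have h2 : Continuous (fun θ => dx f (pc r θ)) := (comp_pc_cont hf.dx.cont).comp (Continuous.prodMk_right r)
  fun_prop
lemma cpc {f : ℂ → ℝ} (hf : Continuous f) (r : ℝ) : Continuous (fun θ => f (pc r θ)) :=
  (comp_pc_cont hf).comp (Continuous.prodMk_right r)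

lemma pc_per (r : ℝ) : pc r (-π) = pc r π := by
  apply Complex.ext <;> simp [pc]

/-- divergence theorem on discs -/
lemma divthm {P Q : ℂ → ℝ} (hP : Sm P) (hQ : Sm Q) {R : ℝ} (hR : 0 ≤ R) :
    Ib R (fun z => dx P z + dy Q z) =
      R * ∫ θ in (-π)..π, (P (pc R θ) * cos θ + Q (pc R θ) * sin θ) := by
  have hc : Continuous (fun z => dx P z + dy Q z) := hP.dx.cont.add hQ.dy.cont
  rw [polar hR hc]
  -- pointwise: rho * div = d_rho (rho P.nu) + d_theta (P.T)
  have e1 : ∀ ρ : ℝ, ρ * Ci ρ (fun z => dx P z + dy Q z) =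
      ∫ θ in (-π)..π, ((P (pc ρ θ) * cos θ + Q (pc ρ θ) * sin θ) +
        ρ * ((cos θ * dx P (pc ρ θ) + sin θ * dy P (pc ρ θ)) * cos θ +
          (cos θ * dx Q (pc ρ θ) + sin θ * dy Q (pc ρ θ)) * sin θ)) := by
    intro ρ
    have hFT : ∫ θ in (-π)..π, ((dth ρ Q θ * cos θ + Q (pc ρ θ) * (- sin θ)) -
        (dth ρ P θ * sin θ + P (pc ρ θ) * cos θ)) = 0 := by
      have hd : ∀ θ, HasDerivAt (fun θ => Q (pc ρ θ) * cos θ - P (pc ρ θ) * sin θ)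
        ((dth ρ Q θ * cos θ + Q (pc ρ θ) * (- sin θ)) -
        (dth ρ P θ * sin θ + P (pc ρ θ) * cos θ)) θ := fun θ =>
        ((dth_deriv hQ ρ θ).mul (hasDerivAt_cos θ)).sub ((dth_deriv hP ρ θ).mul (hasDerivAt_sin θ))
      rw [intervalIntegral.integral_eq_sub_of_hasDerivAt (fun θ _ => hd θ)]
      · rw [pc_per]; simp
      · apply Continuous.intervalIntegrable
        have := dth_cont hQ ρ
        have := dth_cont hP ρ
        have := hQ.cont
        have := hP.cont
        fun_prop
    unfold Ci
    rw [← intervalIntegral.integral_const_mul, ← sub_eq_zero, ← intervalIntegral.integral_sub, ← hFT]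
    · apply intervalIntegral.integral_congr
      intro θ _
      simp only [dth]
      have := sin_sq_add_cos_sq θ
      linear_combination -ρ * (dx P (pc ρ θ) + dy Q (pc ρ θ)) * this
    · apply Continuous.intervalIntegrable
      have := cpc hc ρ
      fun_prop
    · apply Continuous.intervalIntegrable
      have := hP.cont
      have := hQ.cont
      have := hP.dx.cont
      have := hQ.dx.cont
      have := hP.dy.cont
      have := hQ.dy.cont
      fun_prop
  simp_rw [e1]
  have a1 := hP.cont
  have a2 := hQ.cont
  have a3 := hP.dx.cont
  have a4 := hQ.dx.cont
  have a5 := hP.dy.cont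
  have a6 := hQ.dy.cont
  have hcont : Continuous (fun p : ℝ × ℝ => ((P (pc p.1 p.2) * cos p.2 + Q (pc p.1 p.2) * sin p.2) +
        p.1 * ((cos p.2 * dx P (pc p.1 p.2) + sin p.2 * dy P (pc p.1 p.2)) * cos p.2 +
          (cos p.2 * dx Q (pc p.1 p.2) + sin p.2 * dy Q (pc p.1 p.2)) * sin p.2))) := by
    fun_prop
  have hsw := intervalIntegral_intervalIntegral_swap (a := 0) (b := R) (c := -π) (d := π)
    (F := fun ρ θ => ((P (pc ρ θ) * cos θ + Q (pc ρ θ) * sin θ) +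
        ρ * ((cos θ * dx P (pc ρ θ) + sin θ * dy P (pc ρ θ)) * cos θ +
          (cos θ * dx Q (pc ρ θ) + sin θ * dy Q (pc ρ θ)) * sin θ))) (io_rect hcont 0 R (-π) π)
  rw [hsw, ← intervalIntegral.integral_const_mul]
  apply intervalIntegral.integral_congr
  intro θ _
  simp only
  have hd : ∀ ρ, HasDerivAt (fun ρ => ρ * (P (pc ρ θ) * cos θ + Q (pc ρ θ) * sin θ))
      ((P (pc ρ θ) * cos θ + Q (pc ρ θ) * sin θ) +
        ρ * ((cos θ * dx P (pc ρ θ) + sin θ * dy P (pc ρ θ)) * cos θ +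
          (cos θ * dx Q (pc ρ θ) + sin θ * dy Q (pc ρ θ)) * sin θ)) ρ := by
    intro ρ
    have := (hasDerivAt_id ρ).mul (((dr_deriv hP ρ θ).mul_const (cos θ)).add ((dr_deriv hQ ρ θ).mul_const (sin θ)))
    simp only [id, one_mul] at this
    exact this
  rw [intervalIntegral.integral_eq_sub_of_hasDerivAt (fun ρ _ => hd ρ)]
  · simp
  · exact (hcont.comp (Continuous.prodMk_left θ)).intervalIntegrable _ _

/-- Fubini between a segment parameter and the disc. -/
lemma Ib_swap {r : ℝ} {Φ : ℝ → ℂ → ℝ} (hΦ : Continuous (fun p : ℝ × ℂ => Φ p.1 p.2)) (a b : ℝ) :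
    Ib r (fun z => ∫ s in a..b, Φ s z) = ∫ s in a..b, Ib r (Φ s) := by
  unfold Ib
  symm
  apply intervalIntegral_integral_swap
  rw [Measure.prod_restrict, ← Measure.volume_eq_prod]
  have h1 : IntegrableOn (fun p : ℝ × ℂ => Φ p.1 p.2) (uIcc a b ×ˢ closedBall (0:ℂ) r) :=
    hΦ.continuousOn.integrableOn_compact (isCompact_uIcc.prod (isCompact_closedBall _ _))
  exact h1.mono_set (prod_mono uIoc_subset_uIcc le_rfl)

/-- Hessian determinant -/
def dt (f : ℂ → ℝ) : ℂ → ℝ := fun z => dx (dx f) z * dy (dy f) z - dx (dy f) z * dx (dy f) z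
lemma dt_eq (f : ℂ → ℝ) (z : ℂ) : 4 * dt f z = La f z ^ 2 - ‖mm f z‖ ^ 2 := by
  rw [mm_sq]; simp only [dt, La, mr, mi]; ring
lemma Sm.dt {f : ℂ → ℝ} (hf : Sm f) : Sm (dt f) := (hf.dx.dx.mul hf.dy.dy).sub (hf.dy.dx.mul hf.dy.dx)

lemma dd_pow {f : ℂ → ℝ} (hf : Sm f) (n : ℕ) (v : ℂ) :
    dd v (fun z => f z ^ n) = fun z => n * f z ^ (n - 1) * dd v f z := by
  funext z; simp only [dd]; rw [fderiv_fun_pow n (hf.diff z)]; simp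

section dxdy
variable {f g : ℂ → ℝ} (hf : Sm f) (hg : Sm g) (z : ℂ)
include hf hg
lemma dx_add : dx (fun z => f z + g z) z = dx f z + dx g z := congrFun (dd_add hf hg 1) z
lemma dy_add : dy (fun z => f z + g z) z = dy f z + dy g z := congrFun (dd_add hf hg Complex.I) z
lemma dx_sub : dx (fun z => f z - g z) z = dx f z - dx g z := congrFun (dd_sub hf hg 1) z
lemma dy_sub : dy (fun z => f z - g z) z = dy f z - dy g z := congrFun (dd_sub hf hg Complex.I) z
lemma dx_mul : dx (fun z => f z * g z) z = dx f z * g z + f z * dx g z := congrFun (dd_mul hf hg 1) z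
lemma dy_mul : dy (fun z => f z * g z) z = dy f z * g z + f z * dy g z := congrFun (dd_mul hf hg Complex.I) z
end dxdy
lemma dx_neg (f : ℂ → ℝ) (z : ℂ) : dx (fun z => - f z) z = - dx f z := congrFun (dd_neg f 1) z
lemma dy_neg (f : ℂ → ℝ) (z : ℂ) : dy (fun z => - f z) z = - dy f z := congrFun (dd_neg f Complex.I) z
lemma dx_pow {f : ℂ → ℝ} (hf : Sm f) (n : ℕ) (z : ℂ) :
    dx (fun z => f z ^ n) z = n * f z ^ (n - 1) * dx f z := congrFun (dd_pow hf n 1) z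
lemma dy_pow {f : ℂ → ℝ} (hf : Sm f) (n : ℕ) (z : ℂ) :
    dy (fun z => f z ^ n) z = n * f z ^ (n - 1) * dy f z := congrFun (dd_pow hf n Complex.I) z
lemma dx_const (c : ℝ) (z : ℂ) : dx (fun _ => c) z = 0 := congrFun (dd_const c 1) z
lemma dy_const (c : ℝ) (z : ℂ) : dy (fun _ => c) z = 0 := congrFun (dd_const c Complex.I) z

lemma det_div {f ζ : ℂ → ℝ} (hf : Sm f) (hζ : Sm ζ) (c : ℝ) {R : ℝ} (hR : 0 ≤ R) :
    Ib R (fun z => ζ z * dt f z + (dx f z - c) * (dx ζ z * dy (dy f) z - dy ζ z * dx (dy f) z)) =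
      R * ∫ θ in (-π)..π, ζ (pc R θ) * (dx f (pc R θ) - c) *
        (dy (dy f) (pc R θ) * cos θ - dx (dy f) (pc R θ) * sin θ) := by
  have hA : Sm (fun z => dx f z - c) := hf.dx.sub (Sm.const c)
  have hB := hζ.mul hA
  have h := divthm (hB.mul hf.dy.dy) (hB.mul hf.dy.dx).neg hR
  have e1 : ∀ z, dx (fun z => (ζ z * (dx f z - c)) * dy (dy f) z) z +
      dy (fun z => - ((ζ z * (dx f z - c)) * dx (dy f) z)) z =
      ζ z * dt f z + (dx f z - c) * (dx ζ z * dy (dy f) z - dy ζ z * dx (dy f) z) := by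
    intro z
    have e2 : dy (dx (dy f)) z = dx (dy (dy f)) z := congrFun (dx_dy_comm hf.dy) z
    have e3 : dy (dx f) z = dx (dy f) z := congrFun (dx_dy_comm hf) z
    rw [dx_mul hB hf.dy.dy, dy_neg, dy_mul hB hf.dy.dx, dx_mul hζ hA, dy_mul hζ hA,
      dx_sub hf.dx (Sm.const c), dy_sub hf.dx (Sm.const c), dx_const, dy_const, e2, e3]
    simp only [dt]; ring
  rw [Ib_congr (fun z _ => (e1 z).symm), h]
  congr 1
  apply intervalIntegral.integral_congr
  intro θ _
  simp only; ring

lemma dx_one : dx (fun _ => (1:ℝ)) = fun _ => 0 := dd_const _ _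
lemma dy_one : dy (fun _ => (1:ℝ)) = fun _ => 0 := dd_const _ _

lemma det_circle {f : ℂ → ℝ} (hf : Sm f) (c : ℝ) {R : ℝ} (hR : 0 ≤ R) :
    Ib R (dt f) = ∫ θ in (-π)..π, (dx f (pc R θ) - c) * dth R (dy f) θ := by
  have h := det_div hf (Sm.const 1) c hR
  rw [dx_one, dy_one] at h
  have e : Ib R (dt f) = Ib R (fun z => 1 * dt f z + (dx f z - c) * (0 * dy (dy f) z - 0 * dx (dy f) z)) := by
    congr 1; funext z; ring
  rw [e, h, ← intervalIntegral.integral_const_mul]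
  apply intervalIntegral.integral_congr
  intro θ _
  simp only [dth]; ring

/-- Miranda–Talenti -/
lemma MT {ψ : ℂ → ℝ} (hψ : Sm ψ) (h0 : ∀ z : ℂ, ‖z‖ = 1 → ψ z = 0) : 0 ≤ Ib 1 (dt ψ) := by
  have hJ := det_circle hψ 0 (zero_le_one)
  simp only [sub_zero] at hJ
  have c1 := cpc hψ.dx.cont 1
  have c2 := cpc hψ.dy.cont 1
  have c3 := dth_cont hψ.dx 1
  have c4 := dth_cont hψ.dy 1
  have hz : ∫ θ in (-π)..π, (dth 1 (dx ψ) θ * dy ψ (pc 1 θ) + dx ψ (pc 1 θ) * dth 1 (dy ψ) θ) = 0 := by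
    rw [intervalIntegral.integral_eq_sub_of_hasDerivAt
      (fun θ _ => (dth_deriv hψ.dx 1 θ).mul (dth_deriv hψ.dy 1 θ))]
    · simp [pc_per]
    · exact ((c3.mul c2).add (c1.mul c4)).intervalIntegrable _ _
  have hb : ∀ θ, cos θ * dy ψ (pc 1 θ) - sin θ * dx ψ (pc 1 θ) = 0 := by
    intro θ
    have h1 := dth_deriv hψ 1 θ
    have h2 : (fun θ => ψ (pc 1 θ)) = fun _ => 0 := by
      funext θ; exact h0 _ (pc_norm zero_le_one θ)
    rw [h2] at h1
    have := h1.unique (hasDerivAt_const θ (0:ℝ))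
    simpa [dth] using this
  have hb' : ∀ θ, (- sin θ * dy ψ (pc 1 θ) + cos θ * dth 1 (dy ψ) θ) -
      (cos θ * dx ψ (pc 1 θ) + sin θ * dth 1 (dx ψ) θ) = 0 := by
    intro θ
    have h1 := ((hasDerivAt_cos θ).mul (dth_deriv hψ.dy 1 θ)).sub
      ((hasDerivAt_sin θ).mul (dth_deriv hψ.dx 1 θ))
    have h2 : ((fun θ => cos θ) * (fun θ => dy ψ (pc 1 θ)) - (fun θ => sin θ) * (fun θ => dx ψ (pc 1 θ))) = fun _ => (0:ℝ) := by
      funext θ; exact hb θ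
    have h3 := h1.unique (by
      have := hasDerivAt_const θ (0:ℝ)
      rw [← h2] at this; exact this)
    exact h3
  have h2J : 2 * Ib 1 (dt ψ) = ∫ θ in (-π)..π, (cos θ * dx ψ (pc 1 θ) + sin θ * dy ψ (pc 1 θ)) ^ 2 := by
    have e : 2 * Ib 1 (dt ψ) = 2 * Ib 1 (dt ψ) - ∫ θ in (-π)..π, (dth 1 (dx ψ) θ * dy ψ (pc 1 θ) + dx ψ (pc 1 θ) * dth 1 (dy ψ) θ) := by
      rw [hz]; ring
    rw [e, hJ, ← intervalIntegral.integral_const_mul, ← intervalIntegral.integral_sub]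
    · apply intervalIntegral.integral_congr
      intro θ _
      simp only
      have a1 := hb θ
      have a2 := hb' θ
      have a3 := sin_sq_add_cos_sq θ
      generalize cos θ = C at *
      generalize sin θ = S at *
      generalize dx ψ (pc 1 θ) = p at *
      generalize dy ψ (pc 1 θ) = q at *
      generalize dth 1 (dx ψ) θ = p' at *
      generalize dth 1 (dy ψ) θ = q' at *
      have hp : p = (C * p + S * q) * C := by linear_combination -p * a3 - S * a1
      have hq : q = (C * p + S * q) * S := by linear_combination -q * a3 + C * a1
      have hx : 2 * (p * q') - (p' * q + p * q') = p * q' - q * p' := by ring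
      rw [hx]
      have : p * q' - q * p' = (C * p + S * q) * (C * q' - S * p') := by
        linear_combination q' * hp - p' * hq
      rw [this]
      linear_combination (C * p + S * q) * a2
    · exact (continuous_const.mul (c1.mul c4)).intervalIntegrable _ _
    · exact ((c3.mul c2).add (c1.mul c4)).intervalIntegrable _ _
  have : 0 ≤ 2 * Ib 1 (dt ψ) := by
    rw [h2J]
    apply intervalIntegral.integral_nonneg pi_le
    intro θ _; positivity
  linarith

lemma MT2 {ψ : ℂ → ℝ} (hψ : Sm ψ) (h0 : ∀ z : ℂ, ‖z‖ = 1 → ψ z = 0) :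
    Ib 1 (fun z => ‖mm ψ z‖ ^ 2) ≤ Ib 1 (fun z => La ψ z ^ 2) := by
  have h := MT hψ h0
  have h1 : 4 * Ib 1 (dt ψ) = Ib 1 (fun z => La ψ z ^ 2) - Ib 1 (fun z => ‖mm ψ z‖ ^ 2) := by
    have c1 : Continuous (fun z => La ψ z ^ 2) := hψ.La.cont.pow 2
    have c2 : Continuous (fun z => ‖mm ψ z‖ ^ 2) := hψ.mm.norm.pow 2
    rw [← Ib_mul, ← Ib_sub c1 c2]
    congr 1; funext z; exact dt_eq ψ z
  linarith

lemma cs_int {f : ℝ → ℝ} (hf : Continuous f) {a b : ℝ} (hab : a ≤ b) :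
    (∫ x in a..b, f x) ^ 2 ≤ (b - a) * ∫ x in a..b, f x ^ 2 := by
  rcases hab.eq_or_lt with rfl | hab'
  · simp
  set I := ∫ x in a..b, f x
  have h : 0 ≤ ∫ x in a..b, (f x - I / (b - a)) ^ 2 :=
    intervalIntegral.integral_nonneg hab (fun x _ => sq_nonneg _)
  have e : ∫ x in a..b, (f x - I / (b - a)) ^ 2 =
      (∫ x in a..b, f x ^ 2) - 2 * (I / (b - a)) * I + (b - a) * (I / (b - a)) ^ 2 := by
    have e1 : ∀ x, (f x - I / (b - a)) ^ 2 = f x ^ 2 - 2 * (I / (b - a)) * f x + (I / (b - a)) ^ 2 := by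
      intro x; ring
    simp_rw [e1]
    rw [intervalIntegral.integral_add, intervalIntegral.integral_sub, intervalIntegral.integral_const_mul,
      intervalIntegral.integral_const, smul_eq_mul]
    all_goals exact Continuous.intervalIntegrable (by fun_prop) _ _
  rw [e] at h
  have hba : 0 < b - a := by linarith
  have e2 : (∫ x in a..b, f x ^ 2) - 2 * (I / (b - a)) * I + (b - a) * (I / (b - a)) ^ 2 =
    ((b - a) * (∫ x in a..b, f x ^ 2) - I ^ 2) / (b - a) := by field_simp; ring
  rw [e2] at h
  have := (div_nonneg_iff.1 h)
  rcases this with h | h <;> linarith [h.1, h.2]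

lemma cs_Ib {f : ℂ → ℝ} (hf : Continuous f) {r : ℝ} (hr : 0 < r) :
    (Ib r f) ^ 2 ≤ π * r ^ 2 * Ib r (fun z => f z ^ 2) := by
  set I := Ib r f with hI
  set c := I / (π * r ^ 2) with hc
  have hp : 0 < π * r ^ 2 := by positivity
  have h : 0 ≤ Ib r (fun z => (f z - c) ^ 2) := Ib_nonneg (fun z _ => sq_nonneg _)
  have e : Ib r (fun z => (f z - c) ^ 2) = Ib r (fun z => f z ^ 2) - 2 * c * I + π * r ^ 2 * c ^ 2 := by
    have : (fun z => (f z - c) ^ 2) = fun z => (f z ^ 2 - (2 * c) * f z) + c ^ 2 := by funext z; ring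
    rw [this, Ib_add (by fun_prop) (by fun_prop), Ib_sub (by fun_prop) (by fun_prop), Ib_mul, Ib_const hr.le]
  rw [e] at h
  have e2 : Ib r (fun z => f z ^ 2) - 2 * c * I + π * r ^ 2 * c ^ 2 =
    (π * r ^ 2 * Ib r (fun z => f z ^ 2) - I ^ 2) / (π * r ^ 2) := by rw [hc]; field_simp; ring
  rw [e2] at h
  have := (div_nonneg_iff.1 h)
  rcases this with h | h <;> linarith [h.1, h.2]

/-- bundle of continuity facts -/
lemma sm_all {f : ℂ → ℝ} (hf : Sm f) : Continuous f ∧ Continuous (dx f) ∧ Continuous (dy f) ∧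
    Continuous (dx (dx f)) ∧ Continuous (dx (dy f)) ∧ Continuous (dy (dy f)) ∧ Continuous (La f) ∧
    Continuous (mm f) ∧ Continuous (gr f) ∧ Continuous (hn f) ∧ Continuous (dt f) :=
  ⟨hf.cont, hf.dx.cont, hf.dy.cont, hf.dx.dx.cont, hf.dy.dx.cont, hf.dy.dy.cont, hf.La.cont,
    hf.mm, hf.gr, hf.hn.cont, hf.dt.cont⟩

lemma key_alg {k t n h : ℝ} (hk0 : 0 ≤ k) (hk : k < 1) (hh : |t| ≤ k * n + h) :
    (1 - k) / 2 * (t ^ 2 + n ^ 2) ≤ n ^ 2 - t ^ 2 + 2 / (1 - k) * h ^ 2 := by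
  have h1 : t ^ 2 ≤ (k * n + h) ^ 2 := by
    rw [← sq_abs]; exact pow_le_pow_left₀ (abs_nonneg _) hh 2
  have hd : 0 < 1 - k := by linarith
  have h2 : (k * n + h) ^ 2 ≤ k * n ^ 2 + h ^ 2 / (1 - k) := by
    have : k * n ^ 2 + h ^ 2 / (1 - k) - (k * n + h) ^ 2 = k * ((1 - k) * n - h) ^ 2 / (1 - k) := by
      field_simp; ring
    have h3 : 0 ≤ k * ((1 - k) * n - h) ^ 2 / (1 - k) := by positivity
    linarith
  have h4 : 0 ≤ h ^ 2 / (1 - k) := by positivity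
  have h5 : 2 / (1 - k) * h ^ 2 = 2 * (h ^ 2 / (1 - k)) := by ring
  rw [h5]
  nlinarith [sq_nonneg n, mul_nonneg hk0 (sq_nonneg n), mul_nonneg hd.le (sq_nonneg n)]

lemma hess_sq (f : ℂ → ℝ) (z : ℂ) :
    dx (dx f) z ^ 2 + 2 * dx (dy f) z ^ 2 + dy (dy f) z ^ 2 = hn f z / 2 := by
  simp only [hn, La, mr, mi]; ring

lemma circle_est {q : ℂ → ℝ} (hq : Sm q) {R : ℝ} (hR : 0 ≤ R) :
    -4 * Ib R (dt q) ≤ 2 * π * (R ^ 2 * Ci R (hn q)) := by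
  obtain ⟨a1, a2, a3, a4, a5, a6, a7, a8, a9, a10, a11⟩ := sm_all hq
  set c := dx q (pc R (-π)) with hc
  rw [det_circle hq c hR]
  have c1 := dth_cont hq.dx R
  have c2 := dth_cont hq.dy R
  set A := ∫ θ in (-π)..π, |dth R (dx q) θ| with hA
  set B := ∫ θ in (-π)..π, |dth R (dy q) θ| with hB
  have h1 : ∀ θ ∈ Icc (-π) π, |dx q (pc R θ) - c| ≤ A := by
    intro θ hθ
    have e : dx q (pc R θ) - c = ∫ s in (-π)..θ, dth R (dx q) s := by
      rw [intervalIntegral.integral_eq_sub_of_hasDerivAt (fun s _ => dth_deriv hq.dx R s)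
        (c1.intervalIntegrable _ _)]
    rw [e]
    refine (intervalIntegral.abs_integral_le_integral_abs hθ.1).trans ?_
    apply intervalIntegral.integral_mono_interval le_rfl hθ.1 hθ.2
    · exact Filter.Eventually.of_forall (fun s => abs_nonneg _)
    · exact c1.abs.intervalIntegrable _ _
  have hA0 : 0 ≤ A := intervalIntegral.integral_nonneg pi_le (fun _ _ => abs_nonneg _)
  have h2 : |∫ θ in (-π)..π, (dx q (pc R θ) - c) * dth R (dy q) θ| ≤ A * B := by
    refine (intervalIntegral.abs_integral_le_integral_abs pi_le).trans ?_
    rw [hB, ← intervalIntegral.integral_const_mul]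
    apply intervalIntegral.integral_mono_on pi_le
    · apply Continuous.intervalIntegrable; fun_prop
    · apply Continuous.intervalIntegrable; fun_prop
    · intro θ hθ
      rw [abs_mul]
      exact mul_le_mul_of_nonneg_right (h1 θ hθ) (abs_nonneg _)
  have h3 : A ^ 2 ≤ 2 * π * ∫ θ in (-π)..π, dth R (dx q) θ ^ 2 := by
    have := cs_int c1.abs pi_le
    simp only [sq_abs] at this
    calc A ^ 2 ≤ _ := this
      _ = _ := by ring
  have h4 : B ^ 2 ≤ 2 * π * ∫ θ in (-π)..π, dth R (dy q) θ ^ 2 := by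
    have := cs_int c2.abs pi_le
    simp only [sq_abs] at this
    calc B ^ 2 ≤ _ := this
      _ = _ := by ring
  have h5 : (∫ θ in (-π)..π, dth R (dx q) θ ^ 2) + (∫ θ in (-π)..π, dth R (dy q) θ ^ 2) ≤
      R ^ 2 / 2 * Ci R (hn q) := by
    unfold Ci
    rw [← intervalIntegral.integral_add, ← intervalIntegral.integral_const_mul]
    · apply intervalIntegral.integral_mono_on pi_le
      · apply Continuous.intervalIntegrable; fun_prop
      · apply Continuous.intervalIntegrable; fun_prop
      · intro θ _
        simp only [dth]
        have e1 := hess_sq q (pc R θ)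
        have e2 : dy (dx q) (pc R θ) = dx (dy q) (pc R θ) := congrFun (dx_dy_comm hq) _
        have e3 := sin_sq_add_cos_sq θ
        rw [e2]
        have e4 : R ^ 2 / 2 * hn q (pc R θ) = R ^ 2 * (dx (dx q) (pc R θ) ^ 2 + 2 * dx (dy q) (pc R θ) ^ 2 + dy (dy q) (pc R θ) ^ 2) := by
          rw [e1]; ring
        rw [e4]
        generalize dx (dx q) (pc R θ) = a
        generalize dx (dy q) (pc R θ) = b
        generalize dy (dy q) (pc R θ) = d
        generalize cos θ = C at *
        generalize sin θ = S at *
        have : (C * b - S * a) ^ 2 + (C * d - S * b) ^ 2 ≤ a ^ 2 + 2 * b ^ 2 + d ^ 2 := by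
          have : a ^ 2 + 2 * b ^ 2 + d ^ 2 = (S ^ 2 + C ^ 2) * (a ^ 2 + 2 * b ^ 2 + d ^ 2) := by rw [e3]; ring
          rw [this]
          nlinarith [sq_nonneg (C * a + S * b), sq_nonneg (C * b + S * d)]
        calc (R * (C * b - S * a)) ^ 2 + (R * (C * d - S * b)) ^ 2 = R ^ 2 * ((C * b - S * a) ^ 2 + (C * d - S * b) ^ 2) := by ring
          _ ≤ _ := mul_le_mul_of_nonneg_left this (sq_nonneg R)
    · apply Continuous.intervalIntegrable; fun_prop
    · apply Continuous.intervalIntegrable; fun_prop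
  have h6 := (abs_le.1 h2).1
  have hpi := pi_pos
  nlinarith [sq_nonneg (A - B), mul_le_mul_of_nonneg_left h5 hpi.le]

/-- the Morrey exponent (twice) -/
def mor (k : ℝ) : ℝ := (1 - k) / (4 * π)

lemma mor_pos {k : ℝ} (hk : k < 1) : 0 < mor k := by
  have := pi_pos; unfold mor; apply div_pos <;> linarith

lemma morrey {k : ℝ} (hk0 : 0 ≤ k) (hk : k < 1) {q h : ℂ → ℝ} (hq : Sm q) (hh : Continuous h)
    (hqh : ∀ z : ℂ, ‖z‖ ≤ 1 → |La q z| ≤ k * ‖mm q z‖ + h z) {r : ℝ} (hr : 0 < r) (hr1 : r ≤ 1) :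
    Ib r (hn q) ≤ r ^ mor k * Ib 1 (hn q) + 4 / (1 - k) ^ 2 * Ib 1 (fun z => h z ^ 2) := by
  obtain ⟨a1, a2, a3, a4, a5, a6, a7, a8, a9, a10, a11⟩ := sm_all hq
  have hd : 0 < 1 - k := by linarith
  have hpi := pi_pos
  set H := Ib 1 (fun z => h z ^ 2) with hH
  set H' := 4 / (1 - k) ^ 2 * H with hH'
  have hH0 : 0 ≤ H' := mul_nonneg (by positivity) (Ib_nonneg (fun z _ => sq_nonneg _))
  have step : ∀ R, 0 < R → R ≤ 1 → mor k * (Ib R (hn q) - H') ≤ R * (R * Ci R (hn q)) := by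
    intro R hR hR1
    have h1 : (1 - k) / 2 * Ib R (hn q) ≤ -4 * Ib R (dt q) + 2 / (1 - k) * H := by
      have : Ib R (fun z => (1 - k) / 2 * hn q z) ≤ Ib R (fun z => -4 * dt q z + 2 / (1 - k) * h z ^ 2) := by
        apply Ib_mono (by fun_prop) (by fun_prop)
        intro z hz
        have := key_alg hk0 hk (hqh z (hz.trans hR1))
        rw [hn_eq]
        have e := dt_eq q z
        linarith
      rw [Ib_mul, Ib_add (by fun_prop) (by fun_prop), Ib_mul, Ib_mul] at this
      have h2 : Ib R (fun z => h z ^ 2) ≤ H := Ib_mono_set hR1 (by fun_prop) (fun z _ => sq_nonneg _)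
      have h3 := mul_le_mul_of_nonneg_left h2 (show 0 ≤ 2 / (1 - k) by positivity)
      linarith
    have h2 := circle_est hq hR.le
    have h3 : (1 - k) / 2 * (Ib R (hn q) - H') ≤ 2 * π * (R ^ 2 * Ci R (hn q)) := by
      have : (1 - k) / 2 * H' = 2 / (1 - k) * H := by rw [hH']; field_simp; ring
      rw [mul_sub, this]; linarith
    have e : mor k * (Ib R (hn q) - H') = ((1 - k) / 2 * (Ib R (hn q) - H')) / (2 * π) := by
      unfold mor; field_simp; ring
    rw [e, div_le_iff₀ (by positivity)]
    linarith
  -- monotonicity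
  have hder : ∀ R, 0 < R → HasDerivAt (fun R => (Ib R (hn q) - H') * R ^ (-mor k))
      ((R * Ci R (hn q)) * R ^ (-mor k) + (Ib R (hn q) - H') * ((-mor k) * R ^ (-mor k - 1))) R := by
    intro R hR
    exact ((Ib_deriv a10 hR).sub_const H').mul (Real.hasDerivAt_rpow_const (Or.inl hR.ne'))
  have hmono : MonotoneOn (fun R => (Ib R (hn q) - H') * R ^ (-mor k)) (Icc r 1) := by
    apply monotoneOn_of_deriv_nonneg (convex_Icc r 1)
    · intro R hR
      exact (hder R (hr.trans_le hR.1)).continuousAt.continuousWithinAt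
    · intro R hR
      rw [interior_Icc] at hR
      exact (hder R (hr.trans hR.1)).differentiableAt.differentiableWithinAt
    · intro R hR
      rw [interior_Icc] at hR
      have hR0 := hr.trans hR.1
      rw [(hder R hR0).deriv]
      have e : R ^ (-mor k) = R ^ (-mor k - 1) * R := by
        rw [Real.rpow_sub_one hR0.ne']; field_simp
      rw [e]
      have h1 := step R hR0 hR.2.le
      have h2 : 0 ≤ R ^ (-mor k - 1) := Real.rpow_nonneg hR0.le _
      nlinarith [mul_le_mul_of_nonneg_left h1 h2]
  have h1 := hmono ⟨le_rfl, hr1⟩ ⟨hr1, le_rfl⟩ hr1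
  simp only [Real.one_rpow, mul_one] at h1
  have h2 : 0 < r ^ mor k := Real.rpow_pos_of_pos hr _
  have h3 : r ^ (-mor k) = (r ^ mor k)⁻¹ := Real.rpow_neg hr.le _
  rw [h3, ← div_eq_mul_inv, div_le_iff₀ h2] at h1
  nlinarith [mul_nonneg hH0 h2.le]

/-- cutoff -/
def et (z : ℂ) : ℝ := 1 - (z.re ^ 2 + z.im ^ 2)
lemma et_sm : Sm et := (Sm.const 1).sub ((Sm.re.pow 2).add (Sm.im.pow 2))
lemma dx_re (z : ℂ) : dx (fun z => z.re) z = 1 := by simp [dx, dd_re]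
lemma dy_re (z : ℂ) : dy (fun z => z.re) z = 0 := by simp [dy, dd_re]
lemma dx_im (z : ℂ) : dx (fun z => z.im) z = 0 := by simp [dx, dd_im]
lemma dy_im (z : ℂ) : dy (fun z => z.im) z = 1 := by simp [dy, dd_im]
lemma dx_et (z : ℂ) : dx et z = -2 * z.re := by
  have : dx et z = dx (fun z => (1:ℝ) - (z.re ^ 2 + z.im ^ 2)) z := rfl
  rw [this, dx_sub (Sm.const 1) ((Sm.re.pow 2).add (Sm.im.pow 2)), dx_add (Sm.re.pow 2) (Sm.im.pow 2),
    dx_pow Sm.re, dx_pow Sm.im, dx_const, dx_re, dx_im]; simp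
lemma dy_et (z : ℂ) : dy et z = -2 * z.im := by
  have : dy et z = dy (fun z => (1:ℝ) - (z.re ^ 2 + z.im ^ 2)) z := rfl
  rw [this, dy_sub (Sm.const 1) ((Sm.re.pow 2).add (Sm.im.pow 2)), dy_add (Sm.re.pow 2) (Sm.im.pow 2),
    dy_pow Sm.re, dy_pow Sm.im, dy_const, dy_re, dy_im]; simp
lemma nsq (z : ℂ) : ‖z‖ ^ 2 = z.re ^ 2 + z.im ^ 2 := by
  rw [← Complex.normSq_eq_norm_sq, Complex.normSq_apply]; ring
lemma et_eq (z : ℂ) : et z = 1 - ‖z‖ ^ 2 := by rw [nsq]; rfl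
lemma et_nonneg {z : ℂ} (hz : ‖z‖ ≤ 1) : 0 ≤ et z := by
  rw [et_eq]; nlinarith [norm_nonneg z]
lemma et_le (z : ℂ) : et z ≤ 1 := by
  rw [et_eq]; nlinarith [norm_nonneg z]
lemma et_pc (θ : ℝ) : et (pc 1 θ) = 0 := by rw [et_eq, pc_norm zero_le_one]; ring

lemma det_cut {f : ℂ → ℝ} (hf : Sm f) (c : ℝ) (n : ℕ) (hn : n ≠ 0) :
    Ib 1 (fun z => et z ^ n * dt f z - 2 * n * et z ^ (n - 1) * ((dx f z - c) * (z.re * dy (dy f) z - z.im * dx (dy f) z))) = 0 := by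
  have h := det_div hf (et_sm.pow n) c zero_le_one
  simp only [et_pc, zero_pow hn, zero_mul, intervalIntegral.integral_zero, mul_zero, dx_pow et_sm,
    dy_pow et_sm, dx_et, dy_et] at h
  rw [← h]
  congr 1; funext z; ring

lemma B_sq (f : ℂ → ℝ) {z : ℂ} (hz : ‖z‖ ≤ 1) : (z.re * dy (dy f) z - z.im * dx (dy f) z) ^ 2 ≤ hn f z / 2 := by
  rw [← hess_sq]
  have h1 : z.re ^ 2 + z.im ^ 2 ≤ 1 := by rw [← nsq]; nlinarith [norm_nonneg z]
  generalize dx (dx f) z = a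
  generalize dx (dy f) z = b
  generalize dy (dy f) z = d
  nlinarith [sq_nonneg (z.re * b + z.im * d), sq_nonneg a, sq_nonneg b, sq_nonneg d,
    mul_le_mul_of_nonneg_right h1 (add_nonneg (sq_nonneg b) (sq_nonneg d))]

/-- Caccioppoli -/
lemma cacc {k : ℝ} (hk0 : 0 ≤ k) (hk : k < 1) {q h : ℂ → ℝ} (hq : Sm q) (hh : Continuous h)
    (hqh : ∀ z : ℂ, ‖z‖ ≤ 1 → |La q z| ≤ k * ‖mm q z‖ + h z) (c : ℝ) :
    (1 - k) / 4 * Ib 1 (fun z => et z ^ 2 * hn q z) ≤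
      128 / (1 - k) * Ib 1 (fun z => (dx q z - c) ^ 2) + 2 / (1 - k) * Ib 1 (fun z => h z ^ 2) := by
  obtain ⟨a1, a2, a3, a4, a5, a6, a7, a8, a9, a10, a11⟩ := sm_all hq
  have hd : 0 < 1 - k := by linarith
  have ce := et_sm.cont
  have h0 := det_cut hq c 2 two_ne_zero
  have h1 : Ib 1 (fun z => (1 - k) / 4 * (et z ^ 2 * hn q z)) ≤
    Ib 1 (fun z => 128 / (1 - k) * (dx q z - c) ^ 2 + 2 / (1 - k) * h z ^ 2 +
      (-4) * (et z ^ 2 * dt q z - 2 * (2 : ℕ) * et z ^ (2 - 1) * ((dx q z - c) * (z.re * dy (dy q) z - z.im * dx (dy q) z)))) := by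
    apply Ib_mono (by fun_prop) (by fun_prop)
    intro z hz
    have e1 := key_alg hk0 hk (hqh z hz)
    rw [← hn_eq] at e1
    have e2 := dt_eq q z
    have e3 := B_sq q hz
    have e4 := et_nonneg hz
    have e5 := et_le z
    generalize z.re * dy (dy q) z - z.im * dx (dy q) z = B at *
    generalize dx q z - c = A at *
    generalize hη : et z = η at *
    have e6 : -16 * η * (A * B) ≤ 128 / (1 - k) * A ^ 2 + (1 - k) / 2 * (η ^ 2 * B ^ 2) := by
      have : 128 / (1 - k) * A ^ 2 + (1 - k) / 2 * (η ^ 2 * B ^ 2) + 16 * η * (A * B) =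
        (16 * A + (1 - k) * (η * B)) ^ 2 / (2 * (1 - k)) := by field_simp; ring
      have h2 : 0 ≤ (16 * A + (1 - k) * (η * B)) ^ 2 / (2 * (1 - k)) := by positivity
      linarith
    have hη2 : η ^ 2 ≤ 1 := by nlinarith
    have e7 := mul_le_mul_of_nonneg_left e1 (sq_nonneg η)
    have e8 : η ^ 2 * (2 / (1 - k) * h z ^ 2) ≤ 2 / (1 - k) * h z ^ 2 := by
      have : 0 ≤ 2 / (1 - k) * h z ^ 2 := by positivity
      nlinarith
    have e9 : (1 - k) / 2 * (η ^ 2 * B ^ 2) ≤ (1 - k) / 4 * (η ^ 2 * hn q z) := by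
      have := mul_le_mul_of_nonneg_left e3 (mul_nonneg hd.le (sq_nonneg η))
      linarith
    push_cast
    have e10 : ‖mm q z‖ ^ 2 - La q z ^ 2 = - 4 * dt q z := by linarith
    rw [e10] at e7
    simp only [Nat.add_one_sub_one, pow_one]
    have e11 : -4 * (η ^ 2 * dt q z - 2 * 2 * η * (A * B)) = -4 * η ^ 2 * dt q z + 16 * η * (A * B) := by ring
    have e12 : -16 * η * (-A * B) ≤ 128 / (1 - k) * A ^ 2 + (1 - k) / 2 * (η ^ 2 * B ^ 2) := by
      have : 128 / (1 - k) * A ^ 2 + (1 - k) / 2 * (η ^ 2 * B ^ 2) - 16 * η * (A * B) =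
        (16 * A - (1 - k) * (η * B)) ^ 2 / (2 * (1 - k)) := by field_simp; ring
      have h2 : 0 ≤ (16 * A - (1 - k) * (η * B)) ^ 2 / (2 * (1 - k)) := by positivity
      linarith
    rw [e11]
    linarith
  rw [Ib_mul, Ib_add (by fun_prop) (by fun_prop), Ib_add (by fun_prop) (by fun_prop), Ib_mul, Ib_mul, Ib_mul, h0] at h1
  linarith

lemma grad_div {f ζ : ℂ → ℝ} (hf : Sm f) (hζ : Sm ζ) (h0 : ∀ z : ℂ, ‖z‖ = 1 → ζ z * f z = 0) :
    Ib 1 (fun z => ζ z * ‖gr f z‖ ^ 2 + ζ z * (f z * La f z) + f z * (dx ζ z * dx f z + dy ζ z * dy f z)) = 0 := by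
  have hB := hζ.mul hf
  have h := divthm (hB.mul hf.dx) (hB.mul hf.dy) zero_le_one
  have e : ∀ z, dx (fun z => ζ z * f z * dx f z) z + dy (fun z => ζ z * f z * dy f z) z =
      ζ z * ‖gr f z‖ ^ 2 + ζ z * (f z * La f z) + f z * (dx ζ z * dx f z + dy ζ z * dy f z) := by
    intro z
    rw [dx_mul hB hf.dx, dy_mul hB hf.dy, dx_mul hζ hf, dy_mul hζ hf, gr_sq]
    simp only [La]; ring
  rw [Ib_congr (fun z _ => (e z).symm), h]
  have : ∀ θ, ζ (pc 1 θ) * f (pc 1 θ) = 0 := fun θ => h0 _ (pc_norm zero_le_one θ)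
  simp [this]

lemma grad_zero {f : ℂ → ℝ} (hf : Sm f) (h0 : ∀ z : ℂ, ‖z‖ = 1 → f z = 0) :
    Ib 1 (fun z => ‖gr f z‖ ^ 2) ≤ 1 / 2 * Ib 1 (fun z => f z ^ 2) + 1 / 2 * Ib 1 (fun z => La f z ^ 2) := by
  obtain ⟨a1, a2, a3, a4, a5, a6, a7, a8, a9, a10, a11⟩ := sm_all hf
  have h := grad_div hf (Sm.const 1) (by intro z hz; simp [h0 z hz])
  simp only [dx_const, dy_const] at h
  have h1 : Ib 1 (fun z => ‖gr f z‖ ^ 2) ≤ Ib 1 (fun z => 1 / 2 * f z ^ 2 + 1 / 2 * La f z ^ 2 +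
      (1 * ‖gr f z‖ ^ 2 + 1 * (f z * La f z) + f z * (0 * dx f z + 0 * dy f z))) := by
    apply Ib_mono (by fun_prop) (by fun_prop)
    intro z _
    nlinarith [sq_nonneg (f z + La f z)]
  rw [Ib_add (by fun_prop) (by fun_prop), Ib_add (by fun_prop) (by fun_prop), Ib_mul, Ib_mul, h] at h1
  linarith

lemma grad_cut {f : ℂ → ℝ} (hf : Sm f) :
    Ib 1 (fun z => et z ^ 2 * ‖gr f z‖ ^ 2 + et z ^ 2 * (f z * La f z) - 4 * et z * (f z * (z.re * dx f z + z.im * dy f z))) = 0 := by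
  have h := grad_div hf (et_sm.pow 2) (by intro z hz; rw [et_eq, hz]; ring)
  simp only [dx_pow et_sm, dy_pow et_sm, dx_et, dy_et] at h
  rw [← h]
  congr 1; funext z; push_cast; ring

lemma cut_pt {η w t p q x y d : ℝ} (hd : 0 < d) (hxy : x ^ 2 + y ^ 2 ≤ 1) :
    1 / 2 * (η ^ 2 * (p ^ 2 + q ^ 2)) ≤ d * (η ^ 4 * t ^ 2) + (1 / (4 * d) + 8) * w ^ 2 +
      (η ^ 2 * (p ^ 2 + q ^ 2) + η ^ 2 * (w * t) - 4 * η * (w * (x * p + y * q))) := by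
  have h1 : 0 ≤ d * (η ^ 4 * t ^ 2) + 1 / (4 * d) * w ^ 2 + η ^ 2 * (w * t) := by
    have : d * (η ^ 4 * t ^ 2) + 1 / (4 * d) * w ^ 2 + η ^ 2 * (w * t) = (2 * d * (η ^ 2 * t) + w) ^ 2 / (4 * d) := by
      field_simp; ring
    rw [this]; positivity
  have h2 : (x * p + y * q) ^ 2 ≤ p ^ 2 + q ^ 2 := by
    nlinarith [sq_nonneg (x * q - y * p), mul_le_mul_of_nonneg_right hxy (add_nonneg (sq_nonneg p) (sq_nonneg q))]
  generalize x * p + y * q = s at *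
  have h3 : 4 * η * (w * s) ≤ 1 / 2 * (η ^ 2 * (p ^ 2 + q ^ 2)) + 8 * w ^ 2 := by
    nlinarith [sq_nonneg (η * s - 4 * w), mul_le_mul_of_nonneg_left h2 (sq_nonneg η)]
  nlinarith

lemma unit_xy {z : ℂ} (hz : ‖z‖ ≤ 1) : z.re ^ 2 + z.im ^ 2 ≤ 1 := by
  rw [← nsq]; nlinarith [norm_nonneg z]

lemma grad_int {d : ℝ} (hd : 0 < d) {f : ℂ → ℝ} (hf : Sm f) :
    1 / 2 * Ib 1 (fun z => et z ^ 2 * ‖gr f z‖ ^ 2) ≤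
      d * Ib 1 (fun z => et z ^ 4 * hn f z) + (1 / (4 * d) + 8) * Ib 1 (fun z => f z ^ 2) := by
  obtain ⟨a1, a2, a3, a4, a5, a6, a7, a8, a9, a10, a11⟩ := sm_all hf
  have ce := et_sm.cont
  have h1 : Ib 1 (fun z => 1 / 2 * (et z ^ 2 * ‖gr f z‖ ^ 2)) ≤ Ib 1 (fun z =>
      d * (et z ^ 4 * hn f z) + (1 / (4 * d) + 8) * f z ^ 2 + (et z ^ 2 * ‖gr f z‖ ^ 2 + et z ^ 2 * (f z * La f z) - 4 * et z * (f z * (z.re * dx f z + z.im * dy f z)))) := by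
    apply Ib_mono (by fun_prop) (by fun_prop)
    intro z hz
    have := cut_pt (η := et z) (w := f z) (t := La f z) (p := dx f z) (q := dy f z) hd (unit_xy hz)
    rw [gr_sq, hn_eq]
    have h3 : 0 ≤ d * (et z ^ 4 * ‖mm f z‖ ^ 2) := by positivity
    linarith
  rw [Ib_mul, Ib_add (by fun_prop) (by fun_prop), Ib_add (by fun_prop) (by fun_prop), Ib_mul, Ib_mul, grad_cut hf] at h1
  linarith

/-- interior energy estimate -/
lemma energy {k : ℝ} (hk0 : 0 ≤ k) (hk : k < 1) : ∃ C : ℝ, 0 < C ∧ ∀ w h : ℂ → ℝ, Sm w → Continuous h →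
    (∀ z : ℂ, ‖z‖ ≤ 1 → |La w z| ≤ k * ‖mm w z‖ + (‖gr w z‖ + h z)) →
    Ib 1 (fun z => et z ^ 4 * hn w z) ≤
      C * (Ib 1 (fun z => w z ^ 2) + Ib 1 (fun z => h z ^ 2)) := by
  have hd : 0 < 1 - k := by linarith
  set c0 := (1 - k) / 2 with hc0
  have hc0p : 0 < c0 := by positivity
  set C3 := 512 / c0 + 4 / (1 - k) with hC3
  have hC3p : 0 < C3 := by positivity
  set d := c0 / (8 * C3) with hdd
  have hdp : 0 < d := by positivity
  refine ⟨(2 * C3 * (1 / (4 * d) + 8) + 4 / (1 - k)) / (c0 / 2), by positivity, ?_⟩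
  intro w h hw hh hwh
  obtain ⟨a1, a2, a3, a4, a5, a6, a7, a8, a9, a10, a11⟩ := sm_all hw
  have ce := et_sm.cont
  have h0 := det_cut hw 0 4 four_ne_zero
  have h1 : Ib 1 (fun z => 3 * c0 / 4 * (et z ^ 4 * hn w z)) ≤
    Ib 1 (fun z => C3 * (et z ^ 2 * ‖gr w z‖ ^ 2) + 4 / (1 - k) * h z ^ 2 +
      (-4) * (et z ^ 4 * dt w z - 2 * (4 : ℕ) * et z ^ (4 - 1) * ((dx w z - 0) * (z.re * dy (dy w) z - z.im * dx (dy w) z)))) := by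
    apply Ib_mono (by fun_prop) (by fun_prop)
    intro z hz
    have e1 := key_alg hk0 hk (hwh z hz)
    rw [← hn_eq] at e1
    have e2 := dt_eq w z
    have e3 := B_sq w hz
    have e4 := et_nonneg hz
    have e5 := et_le z
    have e6 : dx w z ^ 2 ≤ ‖gr w z‖ ^ 2 := by rw [gr_sq]; nlinarith [sq_nonneg (dy w z)]
    generalize z.re * dy (dy w) z - z.im * dx (dy w) z = B at *
    rw [sub_zero]
    generalize dx w z = A at *
    generalize ‖gr w z‖ = G at *
    generalize hη : et z = η at *
    have hη2 : η ^ 2 ≤ 1 := by nlinarith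
    have hη4 : η ^ 4 ≤ η ^ 2 := by nlinarith [sq_nonneg η]
    have e10 : ‖mm w z‖ ^ 2 - La w z ^ 2 = - 4 * dt w z := by linarith
    rw [e10] at e1
    have e7 := mul_le_mul_of_nonneg_left e1 (show 0 ≤ η ^ 4 by positivity)
    have e8 : η ^ 4 * (2 / (1 - k) * (G + h z) ^ 2) ≤ 4 / (1 - k) * (η ^ 2 * G ^ 2) + 4 / (1 - k) * h z ^ 2 := by
      have f1 : η ^ 4 * (G + h z) ^ 2 ≤ 2 * (η ^ 2 * G ^ 2) + 2 * h z ^ 2 := by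
        have : (G + h z) ^ 2 ≤ 2 * G ^ 2 + 2 * h z ^ 2 := by nlinarith [sq_nonneg (G - h z)]
        have f2 := mul_le_mul_of_nonneg_left this (show 0 ≤ η ^ 4 by positivity)
        have f3 := mul_le_mul_of_nonneg_right hη4 (sq_nonneg G)
        have f4 := mul_le_mul_of_nonneg_right (hη4.trans hη2) (sq_nonneg (h z))
        linarith
      have := mul_le_mul_of_nonneg_left f1 (show 0 ≤ 2 / (1 - k) by positivity)
      have g1 : 4 / (1 - k) = 2 * (2 / (1 - k)) := by ring
      rw [g1]
      linarith
    have e9 : -(32 * η ^ 3 * (A * B)) ≤ 512 / c0 * (η ^ 2 * A ^ 2) + c0 / 2 * (η ^ 4 * B ^ 2) := by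
      have : 512 / c0 * (η ^ 2 * A ^ 2) + c0 / 2 * (η ^ 4 * B ^ 2) + 32 * η ^ 3 * (A * B) =
        (32 * (η * A) + c0 * (η ^ 2 * B)) ^ 2 / (2 * c0) := by field_simp; ring
      have h2 : 0 ≤ (32 * (η * A) + c0 * (η ^ 2 * B)) ^ 2 / (2 * c0) := by positivity
      linarith
    have e11 : c0 / 2 * (η ^ 4 * B ^ 2) ≤ c0 / 4 * (η ^ 4 * hn w z) := by
      have := mul_le_mul_of_nonneg_left e3 (show 0 ≤ c0 * η ^ 4 by positivity)
      linarith
    have e12 : 512 / c0 * (η ^ 2 * A ^ 2) ≤ 512 / c0 * (η ^ 2 * G ^ 2) := by gcongr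
    have e13 : -(-4 * (2 * 4 * η ^ 3 * (A * B))) = 32 * η ^ 3 * (A * B) := by ring
    have e14 : C3 * (η ^ 2 * G ^ 2) = 512 / c0 * (η ^ 2 * G ^ 2) + 4 / (1 - k) * (η ^ 2 * G ^ 2) := by rw [hC3]; ring
    rw [e14]
    push_cast
    have e15 : η ^ 4 * ((1 - k) / 2 * hn w z) = c0 * (η ^ 4 * hn w z) := by rw [hc0]; ring
    rw [e15, mul_add] at e7
    generalize η ^ 4 * (2 / (1 - k) * (G + h z) ^ 2) = X1 at *
    generalize 4 / (1 - k) * (η ^ 2 * G ^ 2) = X2 at *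
    generalize 4 / (1 - k) * h z ^ 2 = X3 at *
    generalize 512 / c0 * (η ^ 2 * G ^ 2) = X4 at *
    generalize 512 / c0 * (η ^ 2 * A ^ 2) = X5 at *
    have e16 : 3 * c0 / 4 * (η ^ 4 * hn w z) = 3 / 4 * (c0 * (η ^ 4 * hn w z)) := by ring
    have e17 : c0 / 4 * (η ^ 4 * hn w z) = 1 / 4 * (c0 * (η ^ 4 * hn w z)) := by ring
    have e18 : -4 * (η ^ 4 * dt w z - 2 * 4 * η ^ 3 * (A * B)) = η ^ 4 * (-4 * dt w z) + 32 * η ^ 3 * (A * B) := by ring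
    rw [e16, e18]
    rw [e17] at e11
    generalize c0 * (η ^ 4 * hn w z) = X6 at *
    linarith
  rw [Ib_mul, Ib_add (by fun_prop) (by fun_prop), Ib_add (by fun_prop) (by fun_prop), Ib_mul, Ib_mul, Ib_mul, h0] at h1
  have h2 := grad_int hdp hw
  have h3 := mul_le_mul_of_nonneg_left h2 (show 0 ≤ 2 * C3 by positivity)
  have h4 : 2 * C3 * (d * Ib 1 (fun z => et z ^ 4 * hn w z)) = c0 / 4 * Ib 1 (fun z => et z ^ 4 * hn w z) := by
    rw [hdd]; field_simp; ring
  have hH : 0 ≤ Ib 1 (fun z => h z ^ 2) := Ib_nonneg (fun z _ => sq_nonneg _)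
  have hW : 0 ≤ Ib 1 (fun z => w z ^ 2) := Ib_nonneg (fun z _ => sq_nonneg _)
  rw [div_mul_eq_mul_div, le_div_iff₀ (by positivity)]
  have h5 : 0 ≤ 2 * C3 * (1 / (4 * d) + 8) * Ib 1 (fun z => h z ^ 2) := by positivity
  have h6 : 0 ≤ 4 / (1 - k) * Ib 1 (fun z => w z ^ 2) := by positivity
  nlinarith

lemma Sm.curve2 {f : ℂ → ℝ} (hf : Sm f) {γ : ℝ → ℂ} {γ' : ℂ} {t : ℝ} (hγ : HasDerivAt γ γ' t) :
    HasDerivAt (fun s => f (γ s)) (_root_.dd γ' f (γ t)) t := by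
  rw [dd_eq]; exact hf.curve hγ

lemma int_bound {J : ℝ → ℝ} (hJ : Continuous J) {c : ℝ} (h : ∀ t ∈ Icc (0:ℝ) 1, J t ≤ c) :
    ∫ s in (0:ℝ)..1, J s ≤ c := by
  have h3 := intervalIntegral.integral_mono_on (a := (0:ℝ)) (b := 1) zero_le_one
    (μ := volume) (f := J) (g := fun _ => c) (hJ.intervalIntegrable _ _) (intervalIntegrable_const) h
  simpa using h3

lemma ftc_line {f : ℂ → ℝ} (hf : Sm f) (y z : ℂ) :
    f (y + z) - f z = ∫ s in (0:ℝ)..1, dd y f ((s:ℂ) * y + z) := by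
  have h := intervalIntegral.integral_eq_sub_of_hasDerivAt (a := (0:ℝ)) (b := 1)
    (f := fun s : ℝ => f ((s:ℂ) * y + z)) (f' := fun s : ℝ => dd y f ((s:ℂ) * y + z)) ?_ ?_
  · rw [h]; simp
  · intro s _
    have h1 : HasDerivAt (fun s : ℝ => (s:ℂ) * y + z) y s := by
      simpa using ((Complex.ofRealCLM.hasDerivAt (x := s)).mul_const y).add_const z
    exact hf.curve2 h1
  · have := (hf.dd y).cont
    exact Continuous.intervalIntegrable (by fun_prop) _ _

lemma dd_sq_le (f : ℂ → ℝ) (y z : ℂ) : dd y f z ^ 2 ≤ ‖y‖ ^ 2 * (dx f z ^ 2 + dy f z ^ 2) := by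
  rw [dd_eq, ← Complex.normSq_eq_norm_sq, Complex.normSq_apply]
  nlinarith [sq_nonneg (y.re * dy f z - y.im * dx f z)]

/-- difference quotients -/
lemma diffq {f : ℂ → ℝ} (hf : Sm f) {y : ℂ} {r R : ℝ} (h : ‖y‖ + r ≤ R) :
    Ib r (fun z => (f (y + z) - f z) ^ 2) ≤ ‖y‖ ^ 2 * Ib R (fun z => dx f z ^ 2 + dy f z ^ 2) := by
  have c0 := hf.cont
  have c1 := (hf.dd y).cont
  have c2 := hf.dx.cont
  have c3 := hf.dy.cont
  have cc : Continuous (fun p : ℝ × ℂ => dd y f ((p.1:ℂ) * y + p.2) ^ 2) := by fun_prop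
  have h1 : Ib r (fun z => (f (y + z) - f z) ^ 2) ≤
      Ib r (fun z => ∫ s in (0:ℝ)..1, dd y f ((s:ℂ) * y + z) ^ 2) := by
    apply Ib_mono (by fun_prop)
    · exact intervalIntegral.continuous_parametric_intervalIntegral_of_continuous' (by fun_prop) 0 1
    · intro z _
      rw [ftc_line hf]
      have := cs_int (f := fun s : ℝ => dd y f ((s:ℂ) * y + z)) (by fun_prop) zero_le_one
      simpa using this
  rw [Ib_swap (Φ := fun s z => dd y f ((s:ℂ) * y + z) ^ 2) cc] at h1
  refine h1.trans ?_
  have h2 : ∀ s ∈ Icc (0:ℝ) 1, Ib r (fun z => dd y f ((s:ℂ) * y + z) ^ 2) ≤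
      ‖y‖ ^ 2 * Ib R (fun z => dx f z ^ 2 + dy f z ^ 2) := by
    intro s hs
    rw [← Ib_mul]
    refine (Ib_trans (s := R) (f := fun z => dd y f z ^ 2) ((s:ℂ) * y) ?_ (by fun_prop) (fun z _ => sq_nonneg _)).trans ?_
    · rw [norm_mul, Complex.norm_real, norm_of_nonneg hs.1]
      nlinarith [hs.2, norm_nonneg y]
    · exact Ib_mono (by fun_prop) (by fun_prop) (fun z _ => dd_sq_le f y z)
  apply int_bound _ h2
  unfold Ib
  exact continuous_parametric_integral_of_continuous (by fun_prop) (isCompact_closedBall _ _)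

lemma dd2_sq_le {f : ℂ → ℝ} (hf : Sm f) (v z : ℂ) : dd v (dd v f) z ^ 2 ≤ ‖v‖ ^ 4 / 2 * hn f z := by
  have h1 : dd v f = fun z => v.re * dx f z + v.im * dy f z := by funext z; exact dd_eq v z
  have e : dd v (dd v f) z = v.re ^ 2 * dx (dx f) z + 2 * v.re * v.im * dx (dy f) z + v.im ^ 2 * dy (dy f) z := by
    rw [h1, dd_add ((Sm.const _).mul hf.dx) ((Sm.const _).mul hf.dy), dd_const_mul hf.dx, dd_const_mul hf.dy]
    simp only
    rw [dd_eq v z, dd_eq v z, dx_dy_comm hf]; ring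
  have e2 : ‖v‖ ^ 4 = (v.re ^ 2 + v.im ^ 2) ^ 2 := by
    rw [show ‖v‖ ^ 4 = (‖v‖ ^ 2) ^ 2 by ring, ← Complex.normSq_eq_norm_sq, Complex.normSq_apply]; ring
  rw [e, e2]
  unfold hn La mr mi
  generalize v.re = a
  generalize v.im = b
  generalize dx (dx f) z = p
  generalize dx (dy f) z = q
  generalize dy (dy f) z = r
  have : (a ^ 2 * p + 2 * a * b * q + b ^ 2 * r) =
    ((a^2+b^2)*(p+r) + ((a^2-b^2)*(p-r) + 2*a*b*(2*q)))/2 := by ring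
  rw [this]
  nlinarith [sq_nonneg ((a^2+b^2)*(p+r) - ((a^2-b^2)*(p-r) + 2*a*b*(2*q))), sq_nonneg ((a^2-b^2)*(2*q) - 2*a*b*(p-r))]

/-- Taylor with average -/
lemma taylor1 {f : ℂ → ℝ} (hf : Sm f) (x y : ℂ) :
    f x - (f y + dd (x - y) f y) = ∫ t in (0:ℝ)..1, (1 - t) * dd (x - y) (dd (x - y) f) (y + (t:ℂ) * (x - y)) := by
  have hd := hf.dd (x - y)
  have c2 := (hd.dd (x - y)).cont
  have h := intervalIntegral.integral_eq_sub_of_hasDerivAt (a := (0:ℝ)) (b := 1)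
    (f := fun t : ℝ => f (y + (t:ℂ) * (x - y)) + (1 - t) * dd (x - y) f (y + (t:ℂ) * (x - y)))
    (f' := fun t : ℝ => (1 - t) * dd (x - y) (dd (x - y) f) (y + (t:ℂ) * (x - y))) ?_ ?_
  · rw [h]; simp
  · intro t _
    have h1 : HasDerivAt (fun s : ℝ => y + (s:ℂ) * (x - y)) (x - y) t := by
      simpa using ((Complex.ofRealCLM.hasDerivAt (x := t)).mul_const (x - y)).const_add y
    have h2 : HasDerivAt (fun t : ℝ => f (y + (t:ℂ) * (x - y))) (dd (x - y) f (y + (t:ℂ) * (x - y))) t := hf.curve2 h1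
    have h3 : HasDerivAt (fun t : ℝ => dd (x - y) f (y + (t:ℂ) * (x - y))) (dd (x - y) (dd (x - y) f) (y + (t:ℂ) * (x - y))) t := hd.curve2 h1
    have h4 : HasDerivAt (fun t : ℝ => 1 - t) (-1) t := by simpa using (hasDerivAt_id t).const_sub 1
    have h5 := h2.add (h4.mul h3)
    have e : (1 - t) * dd (x - y) (dd (x - y) f) (y + (t:ℂ) * (x - y)) = dd (x - y) f (y + (t:ℂ) * (x - y)) +
      (-1 * dd (x - y) f (y + (t:ℂ) * (x - y)) + (1 - t) * dd (x - y) (dd (x - y) f) (y + (t:ℂ) * (x - y))) := by ring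
    rw [e]
    exact h5
  · exact Continuous.intervalIntegrable (by fun_prop) _ _

/-- Sobolev type sup bound modulo affine functions -/
lemma sob {w : ℂ → ℝ} (hw : Sm w) : ∃ (S : ℝ) (P : ℂ), ∀ x : ℂ, ‖x‖ ≤ 1 →
    (w x - (S + P.re * x.re + P.im * x.im)) ^ 2 ≤ 3 * Ib 1 (hn w) := by
  obtain ⟨a1, a2, a3, a4, a5, a6, a7, a8, a9, a10, a11⟩ := sm_all hw
  have hpi := pi_pos
  have hpi3 := pi_gt_three
  refine ⟨Ib 1 (fun y => w y - dx w y * y.re - dy w y * y.im) / π, ⟨Ib 1 (dx w) / π, Ib 1 (dy w) / π⟩, ?_⟩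
  intro x hx
  have e1 : w x - (Ib 1 (fun y => w y - dx w y * y.re - dy w y * y.im) / π + Ib 1 (dx w) / π * x.re + Ib 1 (dy w) / π * x.im)
      = Ib 1 (fun y => w x - (w y + dd (x - y) w y)) / π := by
    have : (fun y => w x - (w y + dd (x - y) w y)) = fun y => (w x - (w y - dx w y * y.re - dy w y * y.im)) - (x.re * dx w y + x.im * dy w y) := by
      funext y; rw [dd_eq]; simp; ring
    rw [this, Ib_sub (f := fun y => w x - (w y - dx w y * y.re - dy w y * y.im)) (by fun_prop) (by fun_prop),
      Ib_sub (f := fun y => w x) (by fun_prop) (by fun_prop),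
      Ib_add (by fun_prop) (by fun_prop), Ib_mul, Ib_mul, Ib_const zero_le_one]
    field_simp
    ring
  simp only
  rw [e1]
  have hdd : ∀ (v : ℂ) z, dd v (dd v w) z = v.re ^ 2 * dx (dx w) z + 2 * v.re * v.im * dx (dy w) z + v.im ^ 2 * dy (dy w) z := by
    intro v z
    have h1 : dd v w = fun z => v.re * dx w z + v.im * dy w z := by funext z; exact dd_eq v z
    rw [h1, dd_add ((Sm.const _).mul hw.dx) ((Sm.const _).mul hw.dy), dd_const_mul hw.dx, dd_const_mul hw.dy]
    simp only
    rw [dd_eq v z, dd_eq v z, dx_dy_comm hw]; ring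
  have cc : Continuous (fun p : ℝ × ℂ => (1 - p.1) * dd (x - p.2) (dd (x - p.2) w) (p.2 + (p.1:ℂ) * (x - p.2))) := by
    simp only [hdd]
    fun_prop
  have e2 : Ib 1 (fun y => w x - (w y + dd (x - y) w y)) =
      ∫ t in (0:ℝ)..1, Ib 1 (fun y => (1 - t) * dd (x - y) (dd (x - y) w) (y + (t:ℂ) * (x - y))) := by
    rw [← Ib_swap (Φ := fun t y => (1 - t) * dd (x - y) (dd (x - y) w) (y + (t:ℂ) * (x - y))) cc]
    exact Ib_congr (fun y _ => taylor1 hw x y)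
  rw [e2]
  set J := fun t : ℝ => Ib 1 (fun y => (1 - t) * dd (x - y) (dd (x - y) w) (y + (t:ℂ) * (x - y))) with hJ
  have cJ : Continuous J := by
    rw [hJ]; unfold Ib
    exact continuous_parametric_integral_of_continuous (by exact cc) (isCompact_closedBall _ _)
  have h1 := cs_int cJ zero_le_one
  have h2 : ∀ t ∈ Icc (0:ℝ) 1, J t ^ 2 ≤ 8 * π * Ib 1 (hn w) := by
    intro t ht
    have hI : 0 ≤ Ib 1 (hn w) := Ib_nonneg (fun z _ => hn_nonneg w z)
    have cct : Continuous (fun y => (1 - t) * dd (x - y) (dd (x - y) w) (y + (t:ℂ) * (x - y))) :=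
      cc.comp (Continuous.prodMk continuous_const continuous_id)
    have h3 := cs_Ib cct one_pos
    rcases ht.2.eq_or_lt with h | h
    · subst h
      simp only [hJ, sub_self, zero_mul]
      rw [Ib_const zero_le_one]; simp; positivity
    have ht' : 0 < 1 - t := by linarith
    have h4 : Ib 1 (fun y => ((1 - t) * dd (x - y) (dd (x - y) w) (y + (t:ℂ) * (x - y))) ^ 2) ≤
        Ib 1 (fun y => ((1 - t) ^ 2 * 8) * hn w ((t:ℂ) * x + ((1 - t : ℝ) : ℂ) * y)) := by
      apply Ib_mono (by fun_prop) (by fun_prop)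
      intro y hy
      have h5 := dd2_sq_le hw (x - y) (y + (t:ℂ) * (x - y))
      have e : y + (t:ℂ) * (x - y) = (t:ℂ) * x + ((1 - t : ℝ) : ℂ) * y := by push_cast; ring
      rw [e] at h5 ⊢
      have h6 : ‖x - y‖ ^ 4 ≤ 2 ^ 4 := by
        gcongr
        exact (norm_sub_le _ _).trans (by linarith)
      have h7 := hn_nonneg w ((t:ℂ) * x + ((1 - t : ℝ) : ℂ) * y)
      rw [mul_pow, mul_assoc]
      gcongr
      refine h5.trans ?_
      gcongr
      linarith
    rw [Ib_mul] at h4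
    have h8 := Ib_scale (r := 1) ht' (fun z => hn w ((t:ℂ) * x + z))
    have h9 : Ib ((1 - t) * 1) (fun z => hn w ((t:ℂ) * x + z)) ≤ Ib 1 (hn w) := by
      apply Ib_trans _ _ a10 (fun z _ => hn_nonneg w z)
      rw [norm_mul, Complex.norm_real, norm_of_nonneg ht.1]
      nlinarith [ht.1]
    rw [h8] at h4
    calc J t ^ 2 ≤ _ := h3
      _ ≤ π * 1 ^ 2 * ((1 - t) ^ 2 * 8 * (((1 - t) ^ 2)⁻¹ * Ib 1 (hn w))) := by
        gcongr
        refine h4.trans ?_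
        gcongr
      _ = 8 * π * Ib 1 (hn w) := by field_simp
  have h3 := int_bound (J := fun s => J s ^ 2) (by fun_prop) h2
  have hI : 0 ≤ Ib 1 (hn w) := Ib_nonneg (fun z _ => hn_nonneg w z)
  rw [div_pow, div_le_iff₀ (by positivity)]
  have : 8 * π * Ib 1 (hn w) ≤ 3 * Ib 1 (hn w) * π ^ 2 := by nlinarith [mul_nonneg hI hpi.le, mul_nonneg (mul_nonneg hI hpi.le) (show 0 ≤ π - 3 by linarith)]
  linarith

lemma dd_tr {f : ℂ → ℝ} (hf : Sm f) (y v : ℂ) : dd v (fun z => f (y + z)) = fun z => dd v f (y + z) := by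
  have := dd_comp_aff hf y 1 v
  simpa using this
lemma Sm.tr {f : ℂ → ℝ} (hf : Sm f) (y : ℂ) : Sm (fun z => f (y + z)) := by
  simpa using hf.comp_aff y 1
lemma dx_tr {f : ℂ → ℝ} (hf : Sm f) (y : ℂ) : dx (fun z => f (y + z)) = fun z => dx f (y + z) := dd_tr hf y 1
lemma dy_tr {f : ℂ → ℝ} (hf : Sm f) (y : ℂ) : dy (fun z => f (y + z)) = fun z => dy f (y + z) := dd_tr hf y _
lemma La_tr {f : ℂ → ℝ} (hf : Sm f) (y : ℂ) : La (fun z => f (y + z)) = fun z => La f (y + z) := by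
  unfold La; rw [dx_tr hf, dy_tr hf, dx_tr hf.dx, dy_tr hf.dy]
lemma mm_tr {f : ℂ → ℝ} (hf : Sm f) (y : ℂ) : mm (fun z => f (y + z)) = fun z => mm f (y + z) := by
  unfold mm mr mi; rw [dx_tr hf, dy_tr hf, dx_tr hf.dx, dy_tr hf.dy, dx_tr hf.dy]

lemma qdiff {v : ℂ → ℝ} (hv : Sm v) (y : ℂ) :
    Sm (fun z => v (y + z) - v z) ∧
    La (fun z => v (y + z) - v z) = (fun z => La v (y + z) - La v z) ∧
    mm (fun z => v (y + z) - v z) = (fun z => mm v (y + z) - mm v z) ∧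
    dx (fun z => v (y + z) - v z) = (fun z => dx v (y + z) - dx v z) := by
  refine ⟨(hv.tr y).sub hv, ?_, ?_, ?_⟩
  · rw [La_sub (hv.tr y) hv, La_tr hv]
  · rw [mm_sub (hv.tr y) hv, mm_tr hv]
  · funext z; rw [show dx = dd 1 from rfl, dd_sub (hv.tr y) hv, dd_tr hv]

lemma lip_cont {k : ℝ} {G : ℂ → ℝ} (hG : ∀ a b : ℂ, |G a - G b| ≤ k * ‖a - b‖) : Continuous G := by
  have : LipschitzWith (Real.toNNReal |k|) G := by
    apply LipschitzWith.of_dist_le_mul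
    intro a b
    rw [Real.dist_eq, dist_eq_norm, Real.coe_toNNReal _ (abs_nonneg k)]
    exact (hG a b).trans (mul_le_mul_of_nonneg_right (le_abs_self k) (norm_nonneg _))
  exact this.continuous

lemma Ib_scale' (s r : ℝ) (hs : 0 < s) (f : ℂ → ℝ) :
    Ib r (fun z => f (0 + (s:ℂ) * z)) = (s ^ 2)⁻¹ * Ib (s * r) f := by
  simpa using Ib_scale hs f (r := r)

/-- decay of differences of hessians -/
lemma hdecay {k : ℝ} (hk0 : 0 ≤ k) (hk : k < 1) : ∃ C : ℝ, 0 < C ∧ ∀ (v : ℂ → ℝ) (G : ℂ → ℝ) (d : ℝ), Sm v →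
    (∀ a b : ℂ, |G a - G b| ≤ k * ‖a - b‖) → Ib 1 (hn v) ≤ 1 →
    Ib (1 / 2) (fun z => (La v z - G (mm v z)) ^ 2) ≤ d → ∀ (y : ℂ) (ρ : ℝ), ‖y‖ ≤ 1 / 4 → 0 < ρ → ρ ≤ 1 / 8 →
    Ib ρ (hn (fun z => v (y + z) - v z)) ≤ C * (ρ ^ mor k * ‖y‖ ^ 2 + d) := by
  have hd : 0 < 1 - k := by linarith
  have hmor := mor_pos hk
  have h8 : (0:ℝ) < 8 ^ mor k := by positivity
  refine ⟨8 ^ mor k * (2 * (4 / (1 - k)) * (128 / (1 - k)) * 256) + 8 ^ mor k * (2 * (4 / (1 - k)) * (2 / (1 - k) * 64)) + 4 / (1 - k) ^ 2 * 4, by positivity, ?_⟩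
  intro v G d hv hG hv1 hd1 y ρ hy hρ hρ8
  obtain ⟨a1, a2, a3, a4, a5, a6, a7, a8, a9, a10, a11⟩ := sm_all hv
  have cG := lip_cont hG
  obtain ⟨q1, q2, q3, q4⟩ := qdiff hv y
  set q := fun z => v (y + z) - v z with hq
  set e := fun z => La v z - G (mm v z) with he
  have ce : Continuous e := by rw [he]; fun_prop
  set h := fun z => |e (y + z)| + |e z| with hh
  have ch : Continuous h := by rw [hh]; fun_prop
  have hqh : ∀ z, |La q z| ≤ k * ‖mm q z‖ + h z := by
    intro z
    rw [q2, q3]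
    have h1 := hG (mm v (y + z)) (mm v z)
    have e1 : La v (y + z) - La v z = (G (mm v (y + z)) - G (mm v z)) + (e (y + z) - e z) := by simp only [he]; ring
    simp only
    rw [e1]
    refine (abs_add_le _ _).trans (add_le_add h1 ?_)
    exact abs_sub _ _
  have hH : Ib (1 / 4) (fun z => h z ^ 2) ≤ 4 * d := by
    have h1 : Ib (1 / 4) (fun z => h z ^ 2) ≤ Ib (1 / 4) (fun z => 2 * e (y + z) ^ 2 + 2 * e z ^ 2) := by
      apply Ib_mono (by fun_prop) (by fun_prop)
      intro z _
      have := sq_abs (e (y + z))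
      have := sq_abs (e z)
      simp only [hh]
      nlinarith [sq_nonneg (|e (y + z)| - |e z|)]
    rw [Ib_add (by fun_prop) (by fun_prop), Ib_mul, Ib_mul] at h1
    have h2 := Ib_trans (r := 1 / 4) (s := 1 / 2) (f := fun z => e z ^ 2) y (by linarith) (by fun_prop) (fun z _ => sq_nonneg _)
    have h3 := Ib_mono_set (r := 1 / 4) (s := 1 / 2) (by norm_num) (f := fun z => e z ^ 2) (by fun_prop) (fun z _ => sq_nonneg _)
    linarith
  have hD : Ib (1 / 4) (fun z => dx q z ^ 2) ≤ ‖y‖ ^ 2 := by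
    rw [q4]
    refine (diffq hv.dx (R := 1 / 2) (by linarith)).trans ?_
    have h1 : Ib (1 / 2) (fun z => dx (dx v) z ^ 2 + dy (dx v) z ^ 2) ≤ Ib (1 / 2) (hn v) := by
      have := hv.dx.dy.cont
      apply Ib_mono (by fun_prop) (by fun_prop)
      intro z _
      rw [dx_dy_comm hv]; unfold hn La mr mi
      nlinarith [sq_nonneg (dx (dx v) z), sq_nonneg (dy (dy v) z), sq_nonneg (dx (dy v) z)]
    have h2 := Ib_mono_set (r := 1 / 2) (s := 1) (by norm_num) a10 (fun z _ => hn_nonneg v z)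
    nlinarith [sq_nonneg ‖y‖]
  obtain ⟨b1, b2, b3, b4, b5, b6, b7, b8, b9, b10, b11⟩ := sm_all q1
  -- Caccioppoli on the ball of radius 1/4
  have hs4 : Sm (fun z => 16 * q (0 + ((1 / 4 : ℝ):ℂ) * z)) := (Sm.const 16).mul (q1.comp_aff 0 (1 / 4))
  have L4 := La_scal q1 16 0 (1 / 4)
  have M4 := mm_scal q1 16 0 (1 / 4)
  have H4 := hn_scal q1 16 0 (1 / 4)
  have D4 : dx (fun z => 16 * q (0 + ((1 / 4 : ℝ):ℂ) * z)) = fun z => 4 * dx q (0 + ((1 / 4 : ℝ):ℂ) * z) := by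
    rw [show dx = dd 1 from rfl, dd_const_mul (q1.comp_aff 0 (1 / 4)), dd_comp_aff q1]
    funext z; ring
  have c1 := cacc hk0 hk hs4 (h := fun z => h (0 + ((1 / 4 : ℝ):ℂ) * z)) (by fun_prop) (by
    intro z _
    rw [L4, M4]
    have := hqh (0 + ((1 / 4 : ℝ):ℂ) * z)
    norm_num at this ⊢
    linarith) 0
  rw [H4, D4] at c1
  have hq0 : 0 ≤ Ib (1 / 8) (hn q) := Ib_nonneg (fun z _ => hn_nonneg q z)
  have c2 : 64 * Ib (1 / 8) (hn q) ≤ 8 * (4 / (1 - k) * (128 / (1 - k) * 256 * ‖y‖ ^ 2 + 2 / (1 - k) * 64 * d)) := by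
    have t1 : Ib (1 / 2) (fun z => 1 / 2 * hn q (0 + ((1 / 4 : ℝ):ℂ) * z)) ≤
        Ib 1 (fun z => et z ^ 2 * ((16 * (1 / 4) ^ 2) ^ 2 * hn q (0 + ((1 / 4 : ℝ):ℂ) * z))) := by
      have cet := et_sm.cont
      refine le_trans ?_ (Ib_mono_set (r := 1 / 2) (by norm_num) (by fun_prop) ?_)
      · apply Ib_mono (by fun_prop) (by fun_prop)
        intro z hz
        have h1 : 1 / 2 ≤ et z ^ 2 := by
          have : 3 / 4 ≤ et z := by
            rw [et_eq]; nlinarith [norm_nonneg z]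
          nlinarith
        have h2 := hn_nonneg q (0 + ((1 / 4 : ℝ):ℂ) * z)
        norm_num at h1 h2 ⊢
        gcongr
      · intro z _
        have h2 := hn_nonneg q (0 + ((1 / 4 : ℝ):ℂ) * z)
        positivity
    rw [Ib_mul, Ib_scale' _ _ (by norm_num) (hn q)] at t1
    have t2 : Ib 1 (fun z => (4 * dx q (0 + ((1 / 4 : ℝ):ℂ) * z) - 0) ^ 2) = 256 * Ib (1 / 4) (fun z => dx q z ^ 2) := by
      have : (fun z => (4 * dx q (0 + ((1 / 4 : ℝ):ℂ) * z) - 0) ^ 2) = fun z => 16 * (fun z => dx q z ^ 2) (0 + ((1 / 4 : ℝ):ℂ) * z) := by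
        funext z; ring
      rw [this, Ib_mul, Ib_scale' _ _ (by norm_num) (fun z => dx q z ^ 2)]; norm_num; ring
    have t3 : Ib 1 (fun z => h (0 + ((1 / 4 : ℝ):ℂ) * z) ^ 2) = 16 * Ib (1 / 4) (fun z => h z ^ 2) := by
      rw [Ib_scale' _ _ (by norm_num) (fun z => h z ^ 2)]; norm_num
    rw [t2, t3] at c1
    norm_num at t1
    have t4 : (1 - k) / 4 * (8 * Ib (1 / 8) (hn q)) ≤ 128 / (1 - k) * 256 * ‖y‖ ^ 2 + 2 / (1 - k) * 64 * d := by
      norm_num at c1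
      have t1' : 8 * Ib (1 / 8) (hn q) ≤ Ib 1 (fun z => et z ^ 2 * hn q (1 / 4 * z)) := by linarith
      calc (1 - k) / 4 * (8 * Ib (1 / 8) (hn q)) ≤ _ := mul_le_mul_of_nonneg_left t1' (by positivity)
        _ ≤ _ := c1
        _ ≤ 128 / (1 - k) * (256 * ‖y‖ ^ 2) + 2 / (1 - k) * (16 * (4 * d)) := by gcongr
        _ = _ := by ring
    have t5 := mul_le_mul_of_nonneg_left t4 (show 0 ≤ 8 * (4 / (1 - k)) by positivity)
    have t6 : 8 * (4 / (1 - k)) * ((1 - k) / 4 * (8 * Ib (1 / 8) (hn q))) = 64 * Ib (1 / 8) (hn q) := by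
      field_simp
      ring
    rw [t6] at t5
    linarith
  -- Morrey on the ball of radius 1/8
  have hs8 : Sm (fun z => 64 * q (0 + ((1 / 8 : ℝ):ℂ) * z)) := (Sm.const 64).mul (q1.comp_aff 0 (1 / 8))
  have L8 := La_scal q1 64 0 (1 / 8)
  have M8 := mm_scal q1 64 0 (1 / 8)
  have H8 := hn_scal q1 64 0 (1 / 8)
  have m1 := morrey hk0 hk hs8 (h := fun z => h (0 + ((1 / 8 : ℝ):ℂ) * z)) (by fun_prop) (by
    intro z _
    rw [L8, M8]
    have := hqh (0 + ((1 / 8 : ℝ):ℂ) * z)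
    norm_num at this ⊢
    linarith) (r := 8 * ρ) (by positivity) (by linarith)
  rw [H8] at m1
  have t1 : ∀ r : ℝ, Ib r (fun z => (64 * (1 / 8) ^ 2) ^ 2 * hn q (0 + ((1 / 8 : ℝ):ℂ) * z)) = 64 * Ib (1 / 8 * r) (hn q) := by
    intro r
    rw [Ib_mul, Ib_scale' _ _ (by norm_num) (hn q)]; norm_num
  rw [t1, t1, Ib_scale' _ _ (by norm_num) (fun z => h z ^ 2)] at m1
  have hm := Ib_mono_set (r := 1 / 8) (s := 1 / 4) (by norm_num) (f := fun z => h z ^ 2) (by fun_prop) (fun z _ => sq_nonneg _)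
  rw [show 1 / 8 * (8 * ρ) = ρ by ring, mul_rpow (by norm_num) hρ.le] at m1
  norm_num at m1 hm hH c2
  have hd0 : 0 ≤ d := le_trans (Ib_nonneg (fun z _ => sq_nonneg _)) hd1
  have hr1 : ρ ^ mor k ≤ 1 := rpow_le_one hρ.le (by linarith) hmor.le
  have hr0 : 0 < ρ ^ mor k := by positivity
  set A := 4 / (1 - k) * (128 / (1 - k) * 256) with hA
  set B := 4 / (1 - k) * (2 / (1 - k) * 64) with hB
  set E := 4 / (1 - k) ^ 2 with hE
  have hAp : 0 < A := by positivity
  have hBp : 0 < B := by positivity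
  have hEp : 0 < E := by positivity
  have u1 : Ib (1 / 8) (hn q) ≤ A * ‖y‖ ^ 2 + B * d := by
    have : 8 * (4 / (1 - k) * (128 / (1 - k) * 256 * ‖y‖ ^ 2 + 2 / (1 - k) * 64 * d)) = 8 * (A * ‖y‖ ^ 2 + B * d) := by rw [hA, hB]; ring
    norm_num at this ⊢
    rw [this] at c2
    have : 0 ≤ A * ‖y‖ ^ 2 + B * d := by positivity
    linarith
  have u2 : Ib ρ (hn q) ≤ 8 ^ mor k * ρ ^ mor k * Ib (1 / 8) (hn q) + E * 4 * d := by
    have : E * (64 * Ib (1 / 8) (fun z => h z ^ 2)) ≤ E * (64 * (4 * d)) := by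
      norm_num
      gcongr
      exact hm.trans hH
    norm_num at this ⊢
    linarith
  have u3 : 8 ^ mor k * ρ ^ mor k * Ib (1 / 8) (hn q) ≤ 8 ^ mor k * A * (ρ ^ mor k * ‖y‖ ^ 2) + 8 ^ mor k * B * d := by
    calc _ ≤ 8 ^ mor k * ρ ^ mor k * (A * ‖y‖ ^ 2 + B * d) := by gcongr
      _ = 8 ^ mor k * A * (ρ ^ mor k * ‖y‖ ^ 2) + 8 ^ mor k * B * d * ρ ^ mor k := by ring
      _ ≤ 8 ^ mor k * A * (ρ ^ mor k * ‖y‖ ^ 2) + 8 ^ mor k * B * d * 1 := by gcongr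
      _ = _ := by ring
  have u4 : 0 ≤ 8 ^ mor k * A * (ρ ^ mor k * ‖y‖ ^ 2) := by positivity
  have u5 : 0 ≤ 8 ^ mor k * B * d := by positivity
  have u6 : 0 ≤ 8 ^ mor k * A * d := by positivity
  have u7 : 0 ≤ 8 ^ mor k * B * (ρ ^ mor k * ‖y‖ ^ 2) := by positivity
  have u8 : 0 ≤ E * (ρ ^ mor k * ‖y‖ ^ 2) := by positivity
  have u9 : (8 ^ mor k * (2 * (4 / (1 - k)) * (128 / (1 - k)) * 256) + 8 ^ mor k * (2 * (4 / (1 - k)) * (2 / (1 - k) * 64)) + E * 4)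
    = 8 ^ mor k * (2 * A) + 8 ^ mor k * (2 * B) + E * 4 := by rw [hA, hB]; ring
  rw [u9]
  nlinarith

lemma Ib_swap2 {r s : ℝ} {Φ : ℂ → ℂ → ℝ} (hΦ : Continuous (fun p : ℂ × ℂ => Φ p.1 p.2)) :
    Ib r (fun z => Ib s (fun y => Φ z y)) = Ib s (fun y => Ib r (fun z => Φ z y)) := by
  unfold Ib
  apply integral_integral_swap
  rw [Measure.prod_restrict, ← Measure.volume_eq_prod]
  exact hΦ.continuousOn.integrableOn_compact ((isCompact_closedBall _ _).prod (isCompact_closedBall _ _))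

lemma Ib_par {s : ℝ} {Φ : ℂ → ℂ → ℝ} (hΦ : Continuous (fun p : ℂ × ℂ => Φ p.1 p.2)) :
    Continuous (fun z => Ib s (fun y => Φ z y)) := by
  unfold Ib
  exact continuous_parametric_integral_of_continuous (by exact hΦ) (isCompact_closedBall _ _)

lemma Ib_pick {r : ℝ} (hr : 0 < r) {f : ℂ → ℝ} (hf : Continuous f) {c : ℝ} (h : Ib r f ≤ π * r ^ 2 * c) :
    ∃ z : ℂ, ‖z‖ ≤ r ∧ f z ≤ c := by
  by_contra hcon
  push Not at hcon
  -- minimum over compact ball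
  obtain ⟨z0, hz0, hm⟩ := (isCompact_closedBall (0:ℂ) r).exists_isMinOn ⟨0, by simp [hr.le]⟩ hf.continuousOn
  have h1 : Ib r (fun _ => f z0) ≤ Ib r f := by
    apply Ib_mono (by fun_prop) hf
    intro z hz
    exact hm (by simpa using hz)
  rw [Ib_const hr.le] at h1
  have h2 := hcon z0 (by simpa using hz0)
  have : 0 < π * r ^ 2 := by have := pi_pos; positivity
  nlinarith

/-- squared distance between the hessian at a point and `(τ, μ)` -/
def hd2 (v : ℂ → ℝ) (τ : ℝ) (μ : ℂ) (z : ℂ) : ℝ := (La v z - τ) ^ 2 + ‖mm v z - μ‖ ^ 2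

lemma hpick {k : ℝ} (hk0 : 0 ≤ k) (hk : k < 1) : ∃ C : ℝ, 0 < C ∧ ∀ (v : ℂ → ℝ) (G : ℂ → ℝ) (d : ℝ), Sm v →
    (∀ a b : ℂ, |G a - G b| ≤ k * ‖a - b‖) → Ib 1 (hn v) ≤ 1 →
    Ib (1 / 2) (fun z => (La v z - G (mm v z)) ^ 2) ≤ d → ∀ θ : ℝ, 0 < θ → θ ≤ 1 / 8 →
    ∃ τ μ, Ib θ (hd2 v τ μ) ≤ C * (θ ^ mor k * θ ^ 2 + d) := by
  obtain ⟨C, hC, h⟩ := hdecay hk0 hk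
  refine ⟨16 * C, by positivity, ?_⟩
  intro v G d hv hG hv1 hd1 θ hθ hθ8
  have hpi := pi_pos
  have hd0 : 0 ≤ d := le_trans (Ib_nonneg (fun z _ => sq_nonneg _)) hd1
  obtain ⟨a1, a2, a3, a4, a5, a6, a7, a8, a9, a10, a11⟩ := sm_all hv
  set D : ℂ → ℂ → ℝ := fun z y => (La v (y + z) - La v z) ^ 2 + ‖mm v (y + z) - mm v z‖ ^ 2 with hD
  have cD : Continuous (fun p : ℂ × ℂ => D p.1 p.2) := by simp only [hD]; fun_prop
  have cD' : Continuous (fun p : ℂ × ℂ => D p.2 p.1) := by simp only [hD]; fun_prop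
  have h1 : ∀ y : ℂ, ‖y‖ ≤ 2 * θ → Ib θ (fun z => D z y) ≤ C * (θ ^ mor k * (2 * θ) ^ 2 + d) := by
    intro y hy
    have h2 := h v G d hv hG hv1 hd1 y θ (by linarith) hθ hθ8
    obtain ⟨q1, q2, q3, q4⟩ := qdiff hv y
    have e : hn (fun z => v (y + z) - v z) = fun z => D z y := by
      funext z; rw [hn_eq, q2, q3]
    rw [e] at h2
    refine h2.trans ?_
    gcongr
  have h2 : Ib (2 * θ) (fun y => Ib θ (fun z => D z y)) ≤ Ib (2 * θ) (fun y => C * (θ ^ mor k * (2 * θ) ^ 2 + d)) := by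
    apply Ib_mono (Ib_par cD') (by fun_prop) h1
  rw [Ib_const (by positivity), ← Ib_swap2 cD] at h2
  obtain ⟨z0, hz0, h3⟩ := Ib_pick hθ (Ib_par cD) (c := 4 * (C * (θ ^ mor k * (2 * θ) ^ 2 + d))) (h2.trans (le_of_eq (by ring)))
  refine ⟨La v z0, mm v z0, ?_⟩
  have cz : Continuous (fun y => D z0 y) := by simp only [hD]; fun_prop
  have h4 := Ib_trans (r := θ) (s := 2 * θ) (-z0) (by rw [norm_neg]; linarith) cz (fun z _ => by simp only [hD]; positivity)
  have e : (fun z => D z0 (-z0 + z)) = hd2 v (La v z0) (mm v z0) := by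
    funext z; simp only [hD, hd2]; congr 4 <;> congr 1 <;> ring
  rw [e] at h4
  refine (h4.trans h3).trans ?_
  have : 0 < θ ^ mor k := by positivity
  nlinarith [mul_nonneg hC.le hd0]

/-- quadratic polynomials -/
def Qd (S : ℝ) (P : ℂ) (τ : ℝ) (μ : ℂ) (z : ℂ) : ℝ :=
  S + P.re * z.re + P.im * z.im + τ / 4 * (z.re ^ 2 + z.im ^ 2) +
    (μ.re / 4 * (z.re ^ 2 - z.im ^ 2) + μ.im / 2 * (z.re * z.im))

section Qd
variable (S : ℝ) (P : ℂ) (τ : ℝ) (μ : ℂ)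
lemma Qd_dx : dx (Qd S P τ μ) = Qd P.re ⟨τ / 2 + μ.re / 2, μ.im / 2⟩ 0 0 := by
  funext z
  unfold dx dd
  have hr : HasFDerivAt (fun z : ℂ => z.re) Complex.reCLM z := Complex.reCLM.hasFDerivAt
  have hi : HasFDerivAt (fun z : ℂ => z.im) Complex.imCLM z := Complex.imCLM.hasFDerivAt
  have : HasFDerivAt (Qd S P τ μ) _ z :=
    (((((hasFDerivAt_const S z).add (hr.const_mul P.re)).add (hi.const_mul P.im)).add
      (((hr.pow 2).add (hi.pow 2)).const_mul (τ / 4))).add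
      ((((hr.pow 2).sub (hi.pow 2)).const_mul (μ.re / 4)).add ((hr.mul hi).const_mul (μ.im / 2))))
  rw [this.fderiv]
  simp [Qd]
  ring
lemma Qd_dy : dy (Qd S P τ μ) = Qd P.im ⟨μ.im / 2, τ / 2 - μ.re / 2⟩ 0 0 := by
  funext z
  unfold dy dd
  have hr : HasFDerivAt (fun z : ℂ => z.re) Complex.reCLM z := Complex.reCLM.hasFDerivAt
  have hi : HasFDerivAt (fun z : ℂ => z.im) Complex.imCLM z := Complex.imCLM.hasFDerivAt
  have : HasFDerivAt (Qd S P τ μ) _ z :=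
    (((((hasFDerivAt_const S z).add (hr.const_mul P.re)).add (hi.const_mul P.im)).add
      (((hr.pow 2).add (hi.pow 2)).const_mul (τ / 4))).add
      ((((hr.pow 2).sub (hi.pow 2)).const_mul (μ.re / 4)).add ((hr.mul hi).const_mul (μ.im / 2))))
  rw [this.fderiv]
  simp [Qd]
  ring
lemma Qd_sm : Sm (Qd S P τ μ) := by
  have hr := Sm.re
  have hi := Sm.im
  exact ((((Sm.const S).add ((Sm.const _).mul hr)).add ((Sm.const _).mul hi)).add ((Sm.const _).mul ((hr.pow 2).add (hi.pow 2)))).add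
    (((Sm.const _).mul ((hr.pow 2).sub (hi.pow 2))).add ((Sm.const _).mul (hr.mul hi)))
lemma Qd_La : La (Qd S P τ μ) = fun _ => τ := by
  funext z; unfold La; rw [Qd_dx, Qd_dy, Qd_dx, Qd_dy]; simp [Qd]
lemma Qd_mm : mm (Qd S P τ μ) = fun _ => μ := by
  funext z; unfold mm mr mi; rw [Qd_dx, Qd_dy, Qd_dx, Qd_dy, Qd_dx]
  apply Complex.ext <;> simp [Qd] <;> ring
lemma Qd_gr : gr (Qd S P τ μ) = fun z => P + ((τ:ℂ) * z + μ * (starRingEnd ℂ) z) / 2 := by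
  funext z; unfold gr; rw [Qd_dx, Qd_dy]
  apply Complex.ext <;> simp [Qd] <;> ring
end Qd

lemma Qd_sub (S S' : ℝ) (P P' : ℂ) (τ τ' : ℝ) (μ μ' : ℂ) (z : ℂ) :
    Qd S P τ μ z - Qd S' P' τ' μ' z = Qd (S - S') (P - P') (τ - τ') (μ - μ') z := by
  simp [Qd]; ring
lemma Qd_add (S S' : ℝ) (P P' : ℂ) (τ τ' : ℝ) (μ μ' : ℂ) (z : ℂ) :
    Qd S P τ μ z + Qd S' P' τ' μ' z = Qd (S + S') (P + P') (τ + τ') (μ + μ') z := by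
  simp [Qd]; ring
lemma Qd_zero (z : ℂ) : Qd 0 0 0 0 z = 0 := by simp [Qd]
/-- rescaling of quadratics -/
lemma Qd_scale (c r : ℝ) (S : ℝ) (P : ℂ) (τ : ℝ) (μ : ℂ) (z : ℂ) :
    c * Qd S P τ μ ((r:ℂ) * z) = Qd (c * S) ((c * r : ℝ) * P) (c * r ^ 2 * τ) ((c * r ^ 2 : ℝ) * μ) z := by
  simp [Qd, -Complex.ofReal_mul, -Complex.ofReal_pow]; ring

lemma Qd_coef {S : ℝ} {P : ℂ} {τ : ℝ} {μ : ℂ} {r M : ℝ} (hr : 0 < r)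
    (h : ∀ z : ℂ, ‖z‖ ≤ r → |Qd S P τ μ z| ≤ M) :
    |S| ≤ M ∧ ‖P‖ ≤ 2 * M / r ∧ |τ| ≤ 8 * M / r ^ 2 ∧ ‖μ‖ ≤ 12 * M / r ^ 2 := by
  have nr : ‖(r:ℂ)‖ = r := by rw [Complex.norm_real, norm_of_nonneg hr.le]
  have n1 : ‖(⟨r / 2, r / 2⟩ : ℂ)‖ ≤ r := by
    refine (Complex.norm_le_abs_re_add_abs_im _).trans ?_
    simp only [abs_of_pos (half_pos hr)]; linarith
  have n2 : ‖(⟨r / 2, -(r / 2)⟩ : ℂ)‖ ≤ r := by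
    refine (Complex.norm_le_abs_re_add_abs_im _).trans ?_
    simp only [abs_neg, abs_of_pos (half_pos hr)]; linarith
  have h0 := h 0 (by simp [hr.le])
  have h1 := h r nr.le
  have h2 := h (-r) (by rw [norm_neg, nr])
  have h3 := h (r * Complex.I) (by simp [abs_of_pos hr])
  have h4 := h (-(r * Complex.I)) (by simp [abs_of_pos hr])
  have h5 := h _ n1
  have h6 := h (-⟨r / 2, r / 2⟩) (by rw [norm_neg]; exact n1)
  have h7 := h _ n2
  have h8 := h (-⟨r / 2, -(r / 2)⟩) (by rw [norm_neg]; exact n2)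
  simp [Qd] at h0 h1 h2 h3 h4 h5 h6 h7 h8
  rw [abs_le] at h0 h1 h2 h3 h4 h5 h6 h7 h8
  have hP1 : |P.re| ≤ M / r := by rw [le_div_iff₀ hr, ← abs_of_pos hr, ← abs_mul, abs_le]; constructor <;> linarith
  have hP2 : |P.im| ≤ M / r := by rw [le_div_iff₀ hr, ← abs_of_pos hr, ← abs_mul, abs_le]; constructor <;> linarith
  have hr2 : 0 < r ^ 2 := by positivity
  have hm1 : |μ.re| ≤ 4 * M / r ^ 2 := by rw [le_div_iff₀ hr2, ← abs_of_pos hr2, ← abs_mul, abs_le]; constructor <;> linarith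
  have hm2 : |μ.im| ≤ 8 * M / r ^ 2 := by rw [le_div_iff₀ hr2, ← abs_of_pos hr2, ← abs_mul, abs_le]; constructor <;> linarith
  refine ⟨abs_le.2 h0, ?_, ?_, ?_⟩
  · refine (Complex.norm_le_abs_re_add_abs_im _).trans ((add_le_add hP1 hP2).trans (le_of_eq ?_)); ring
  · rw [le_div_iff₀ hr2, ← abs_of_pos hr2, ← abs_mul, abs_le]; constructor <;> linarith
  · refine (Complex.norm_le_abs_re_add_abs_im _).trans ((add_le_add hm1 hm2).trans (le_of_eq ?_)); ring

lemma Qd_bd {S : ℝ} {P : ℂ} {τ : ℝ} {μ : ℂ} {r : ℝ} {z : ℂ} (hz : ‖z‖ ≤ r) :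
    |Qd S P τ μ z - S| ≤ 2 * ‖P‖ * r + (|τ| + ‖μ‖) * r ^ 2 := by
  have e : Qd S P τ μ z - S = (P.re * z.re + P.im * z.im) + (τ / 4 * (z.re ^ 2 + z.im ^ 2) +
    (μ.re / 4 * (z.re ^ 2 - z.im ^ 2) + μ.im / 2 * (z.re * z.im))) := by unfold Qd; ring
  rw [e]
  have a := Complex.abs_re_le_norm z
  have b := Complex.abs_im_le_norm z
  have c := Complex.abs_re_le_norm P
  have d := Complex.abs_im_le_norm P
  have c' := Complex.abs_re_le_norm μ
  have d' := Complex.abs_im_le_norm μ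
  have hr : 0 ≤ r := (norm_nonneg z).trans hz
  have a1 : |z.re| ≤ r := a.trans hz
  have b1 : |z.im| ≤ r := b.trans hz
  have p1 : |P.re * z.re| ≤ ‖P‖ * r := by rw [abs_mul]; gcongr
  have p2 : |P.im * z.im| ≤ ‖P‖ * r := by rw [abs_mul]; gcongr
  have hx : z.re ^ 2 ≤ r ^ 2 := sq_le_sq' (by linarith [(abs_le.1 a1).1]) (abs_le.1 a1).2
  have hy : z.im ^ 2 ≤ r ^ 2 := sq_le_sq' (by linarith [(abs_le.1 b1).1]) (abs_le.1 b1).2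
  have p3 : |τ / 4 * (z.re ^ 2 + z.im ^ 2)| ≤ |τ| * r ^ 2 := by
    rw [abs_mul, abs_div, abs_of_nonneg (by positivity : 0 ≤ z.re ^ 2 + z.im ^ 2)]
    norm_num
    have : z.re ^ 2 + z.im ^ 2 ≤ 4 * r ^ 2 := by nlinarith
    calc |τ| / 4 * (z.re ^ 2 + z.im ^ 2) ≤ |τ| / 4 * (4 * r ^ 2) := by gcongr
      _ = _ := by ring
  have p4 : |μ.re / 4 * (z.re ^ 2 - z.im ^ 2)| ≤ ‖μ‖ * r ^ 2 / 4 := by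
    rw [abs_mul, abs_div]
    norm_num
    have : |z.re ^ 2 - z.im ^ 2| ≤ r ^ 2 := by rw [abs_le]; constructor <;> nlinarith [sq_nonneg z.re, sq_nonneg z.im]
    calc |μ.re| / 4 * |z.re ^ 2 - z.im ^ 2| ≤ ‖μ‖ / 4 * r ^ 2 := by gcongr
      _ = _ := by ring
  have p5 : |μ.im / 2 * (z.re * z.im)| ≤ ‖μ‖ * r ^ 2 / 2 := by
    rw [abs_mul, abs_div, abs_mul]
    norm_num
    calc |μ.im| / 2 * (|z.re| * |z.im|) ≤ ‖μ‖ / 2 * (r * r) := by gcongr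
      _ = _ := by ring
  have p6 : 0 ≤ ‖μ‖ * r ^ 2 := by positivity
  calc _ ≤ (|P.re * z.re| + |P.im * z.im|) + (|τ / 4 * (z.re ^ 2 + z.im ^ 2)| + (|μ.re / 4 * (z.re ^ 2 - z.im ^ 2)| + |μ.im / 2 * (z.re * z.im)|)) := by
        refine (abs_add_le _ _).trans (add_le_add (abs_add_le _ _) ((abs_add_le _ _).trans (add_le_add le_rfl (abs_add_le _ _))))
    _ ≤ _ := by linarith

lemma hn_subQ {v : ℂ → ℝ} (hv : Sm v) (S : ℝ) (P : ℂ) (τ : ℝ) (μ : ℂ) :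
    hn (fun z => v z - Qd S P τ μ z) = hd2 v τ μ := by
  funext z
  rw [hn_eq, La_sub hv (Qd_sm _ _ _ _), mm_sub hv (Qd_sm _ _ _ _), Qd_La, Qd_mm]; rfl

lemma sobR {w : ℂ → ℝ} (hw : Sm w) {θ : ℝ} (hθ : 0 < θ) : ∃ (S : ℝ) (P : ℂ), ∀ x : ℂ, ‖x‖ ≤ θ →
    (w x - (S + P.re * x.re + P.im * x.im)) ^ 2 ≤ 3 * θ ^ 2 * Ib θ (hn w) := by
  obtain ⟨S, P, h⟩ := sob ((Sm.const 1).mul (hw.comp_aff 0 θ))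
  refine ⟨S, (θ⁻¹ : ℝ) * P, ?_⟩
  intro x hx
  have h1 := h ((θ⁻¹ : ℝ) * x) (by
    rw [norm_mul, Complex.norm_real, norm_of_nonneg (by positivity), inv_mul_le_iff₀ hθ]; linarith)
  rw [hn_scal hw, Ib_mul, Ib_scale' _ _ hθ (hn w)] at h1
  have e : (θ:ℂ) * (((θ⁻¹ : ℝ):ℂ) * x) = x := by
    rw [← mul_assoc, ← Complex.ofReal_mul, mul_inv_cancel₀ hθ.ne']; simp
  rw [e] at h1
  rw [Complex.re_ofReal_mul, Complex.im_ofReal_mul] at h1 ⊢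
  have e2 : 3 * ((1 * θ ^ 2) ^ 2 * ((θ ^ 2)⁻¹ * Ib (θ * 1) (hn w))) = 3 * θ ^ 2 * Ib θ (hn w) := by
    rw [mul_one]; field_simp
  rw [e2] at h1
  convert h1 using 2
  simp; ring

/-- Improvement lemma -/
lemma improve {k α : ℝ} (hk0 : 0 ≤ k) (hk : k < 1) (hα0 : 0 < α) (hα : 2 * α < mor k) :
    ∃ θ δ C : ℝ, 0 < θ ∧ θ ≤ 1 / 8 ∧ 0 < δ ∧ 0 < C ∧ ∀ (v : ℂ → ℝ) (G : ℂ → ℝ), Sm v →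
    (∀ a b : ℂ, |G a - G b| ≤ k * ‖a - b‖) → Ib 1 (hn v) ≤ 1 → (∀ z : ℂ, ‖z‖ ≤ 1 → |v z| ≤ 2) →
    Ib (1 / 2) (fun z => (La v z - G (mm v z)) ^ 2) ≤ δ →
    ∃ S P τ μ, |S| ≤ C ∧ ‖P‖ ≤ C ∧ |τ| ≤ C ∧ ‖μ‖ ≤ C ∧
      Ib θ (hn (fun z => v z - Qd S P τ μ z)) ≤ (θ ^ (1 + α)) ^ 2 ∧
      ∀ z : ℂ, ‖z‖ ≤ θ → |v z - Qd S P τ μ z| ≤ 2 * θ ^ (2 + α) := by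
  obtain ⟨C, hC, H⟩ := hpick hk0 hk
  set x := mor k - 2 * α with hx
  have hxp : 0 < x := by rw [hx]; linarith
  set θ := min (1 / 8) ((1 / (2 * C)) ^ (1 / x)) with hθ
  have hθ0 : 0 < θ := by rw [hθ]; positivity
  have hθ8 : θ ≤ 1 / 8 := min_le_left _ _
  have hθx : C * θ ^ x ≤ 1 / 2 := by
    have : θ ^ x ≤ ((1 / (2 * C)) ^ (1 / x)) ^ x := by
      apply rpow_le_rpow hθ0.le (min_le_right _ _) hxp.le
    rw [← rpow_mul (by positivity), one_div_mul_cancel hxp.ne', rpow_one] at this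
    calc C * θ ^ x ≤ C * (1 / (2 * C)) := by gcongr
      _ = 1 / 2 := by field_simp
  have eθ : (θ ^ (1 + α)) ^ 2 = θ ^ (2 * α) * θ ^ 2 := by
    rw [← rpow_natCast, ← rpow_natCast, ← rpow_mul hθ0.le, ← rpow_add hθ0]; congr 1; push_cast; ring
  have eθ2 : θ ^ mor k = θ ^ x * θ ^ (2 * α) := by rw [← rpow_add hθ0]; congr 1; rw [hx]; ring
  have eθ3 : θ ^ (2 + α) = θ * θ ^ (1 + α) := by
    rw [show 2 + α = 1 + (1 + α) by ring, rpow_add hθ0, rpow_one]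
  have hθα1 : θ ^ (2 + α) ≤ 1 := rpow_le_one hθ0.le (by linarith) (by linarith)
  refine ⟨θ, (θ ^ (1 + α)) ^ 2 / (2 * C), 48 / θ ^ 2, hθ0, hθ8, by positivity, by positivity, ?_⟩
  intro v G hv hG hv1 hv2 hd
  obtain ⟨τ, μ, h1⟩ := H v G _ hv hG hv1 hd θ hθ0 hθ8
  have h2 : Ib θ (hd2 v τ μ) ≤ (θ ^ (1 + α)) ^ 2 := by
    refine h1.trans ?_
    have e : C * (θ ^ mor k * θ ^ 2 + (θ ^ (1 + α)) ^ 2 / (2 * C)) = (C * θ ^ x) * (θ ^ (1 + α)) ^ 2 + (θ ^ (1 + α)) ^ 2 / 2 := by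
      rw [eθ2, eθ]; field_simp
    rw [e]
    have : 0 ≤ (θ ^ (1 + α)) ^ 2 := by positivity
    nlinarith
  have hv' : Sm (fun z => v z - Qd 0 0 τ μ z) := hv.sub (Qd_sm _ _ _ _)
  obtain ⟨S, P, h3⟩ := sobR hv' hθ0
  rw [hn_subQ hv] at h3
  have h4 : ∀ z : ℂ, ‖z‖ ≤ θ → |v z - Qd S P τ μ z| ≤ 2 * θ ^ (2 + α) := by
    intro z hz
    apply abs_le_of_sq_le_sq _ (by positivity)
    have h5 := h3 z hz
    have e : v z - Qd 0 0 τ μ z - (S + P.re * z.re + P.im * z.im) = v z - Qd S P τ μ z := by simp [Qd]; ring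
    rw [e] at h5
    rw [eθ3]
    have := mul_le_mul_of_nonneg_left h2 (show 0 ≤ 3 * θ ^ 2 by positivity)
    nlinarith [sq_nonneg (θ * θ ^ (1 + α))]
  have h5 := Qd_coef (S := S) (P := P) (τ := τ) (μ := μ) (M := 4) hθ0 (by
    intro z hz
    have a := h4 z hz
    have b := hv2 z (by linarith)
    have e : Qd S P τ μ z = v z - (v z - Qd S P τ μ z) := by ring
    rw [e]
    refine (abs_sub _ _).trans ?_
    linarith)
  obtain ⟨c1, c2, c3, c4⟩ := h5
  have hθ2 : 0 < θ ^ 2 := by positivity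
  have hθ1 : θ ^ 2 ≤ θ := by nlinarith
  have hθ11 : θ ^ 2 ≤ 1 := by nlinarith
  refine ⟨S, P, τ, μ, ?_, ?_, ?_, ?_, ?_, h4⟩
  · refine c1.trans ?_
    rw [le_div_iff₀ hθ2]; linarith
  · refine c2.trans ?_
    rw [div_le_div_iff₀ hθ0 hθ2]; linarith
  · refine c3.trans ?_
    gcongr; norm_num
  · refine c4.trans ?_
    gcongr; norm_num
  · rw [hn_subQ hv]; exact h2

/-- structural conditions on the nonlinearity solved for the Laplacian -/
structure Gok (k β K N α : ℝ) (g : ℂ → ℝ → ℂ → ℂ → ℝ) : Prop where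
  lip : ∀ z s s' p p' m m', |g z s p m - g z s' p' m'| ≤ k * ‖m - m'‖ + β * (‖p - p'‖ + |s - s'|)
  hol : ∀ z z' s p m, |g z s p m - g z' s p m| ≤ (K * (‖m‖ + ‖p‖ + |s|) + N) * ‖z - z'‖ ^ α

/-- the residual -/
def res (g : ℂ → ℝ → ℂ → ℂ → ℝ) (w : ℂ → ℝ) (z : ℂ) : ℝ := La w z - g z (w z) (gr w z) (mm w z)

def Approx (g : ℂ → ℝ → ℂ → ℂ → ℝ) (u : ℂ → ℝ) : Prop := ∀ ε : ℝ, 0 < ε → ∃ w, Sm w ∧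
  Ib 1 (fun z => res g w z ^ 2) ≤ ε ∧ ∀ z : ℂ, ‖z‖ ≤ 1 → |w z - u z| ≤ ε

lemma Gok.comp {k β K N α : ℝ} {g : ℂ → ℝ → ℂ → ℂ → ℝ} (hg : Gok k β K N α g) (hα : 0 < α)
    {s : ℂ → ℝ} {p m : ℂ → ℂ} (hs : Continuous s) (hp : Continuous p) (hm : Continuous m) :
    Continuous (fun z => g z (s z) (p z) (m z)) := by
  rw [continuous_iff_continuousAt]
  intro z0
  rw [ContinuousAt, tendsto_iff_dist_tendsto_zero]
  have hb : ∀ z, dist (g z (s z) (p z) (m z)) (g z0 (s z0) (p z0) (m z0)) ≤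
      (k * ‖m z - m z0‖ + β * (‖p z - p z0‖ + |s z - s z0|)) +
      (K * (‖m z0‖ + ‖p z0‖ + |s z0|) + N) * ‖z - z0‖ ^ α := by
    intro z
    rw [Real.dist_eq]
    have h1 := hg.lip z (s z) (s z0) (p z) (p z0) (m z) (m z0)
    have h2 := hg.hol z z0 (s z0) (p z0) (m z0)
    refine (abs_sub_le _ (g z (s z0) (p z0) (m z0)) _).trans (add_le_add h1 h2)
  refine squeeze_zero (fun _ => dist_nonneg) hb ?_
  have hc : Continuous (fun z => (k * ‖m z - m z0‖ + β * (‖p z - p z0‖ + |s z - s z0|)) +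
      (K * (‖m z0‖ + ‖p z0‖ + |s z0|) + N) * ‖z - z0‖ ^ α) := by
    have : Continuous (fun z => ‖z - z0‖ ^ α) := (by fun_prop : Continuous fun z => ‖z - z0‖).rpow_const (fun _ => Or.inr hα.le)
    fun_prop
  have := hc.tendsto z0
  simpa [zero_rpow hα.ne'] using this

lemma res_cont {k β K N α : ℝ} {g : ℂ → ℝ → ℂ → ℂ → ℝ} (hg : Gok k β K N α g) (hα : 0 < α)
    {w : ℂ → ℝ} (hw : Sm w) : Continuous (res g w) :=
  hw.La.cont.sub (hg.comp hα hw.cont hw.gr hw.mm)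

lemma hn_sub' {v : ℂ → ℝ} : hn v = hd2 v 0 0 := by
  funext z; rw [hn_eq]; simp [hd2]

lemma grB {v : ℂ → ℝ} (hv : Sm v) (h1 : Ib 1 (hn v) ≤ 1) (h2 : ∀ z : ℂ, ‖z‖ ≤ 1 → |v z| ≤ 2) :
    Ib (1 / 2) (fun z => ‖gr v z‖ ^ 2) ≤ 600 := by
  obtain ⟨a1, a2, a3, a4, a5, a6, a7, a8, a9, a10, a11⟩ := sm_all hv
  have ce := et_sm.cont
  have h := grad_int zero_lt_one hv
  have e1 : Ib 1 (fun z => et z ^ 4 * hn v z) ≤ 1 := by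
    refine le_trans (Ib_mono (by fun_prop) (by fun_prop) ?_) h1
    intro z hz
    have : et z ^ 4 ≤ 1 := pow_le_one₀ (et_nonneg hz) (et_le z)
    nlinarith [hn_nonneg v z]
  have e2 : Ib 1 (fun z => v z ^ 2) ≤ 16 := by
    refine le_trans (Ib_mono (g := fun _ => 4) (by fun_prop) (by fun_prop) ?_) ?_
    · intro z hz
      have := abs_le.1 (h2 z hz)
      nlinarith
    · rw [Ib_const zero_le_one]; linarith [pi_le_four]
  have e3 : Ib (1 / 2) (fun z => ‖gr v z‖ ^ 2) ≤ Ib (1 / 2) (fun z => 2 * (et z ^ 2 * ‖gr v z‖ ^ 2)) := by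
    refine Ib_mono (by fun_prop) (by fun_prop) ?_
    intro z hz
    have : 3 / 4 ≤ et z := by rw [et_eq]; nlinarith [norm_nonneg z]
    have : 1 ≤ 2 * et z ^ 2 := by nlinarith
    nlinarith [sq_nonneg ‖gr v z‖]
  rw [Ib_mul] at e3
  have e4 : Ib (1 / 2) (fun z => et z ^ 2 * ‖gr v z‖ ^ 2) ≤ Ib 1 (fun z => et z ^ 2 * ‖gr v z‖ ^ 2) :=
    Ib_mono_set (by norm_num) (by fun_prop) (fun z _ => by positivity)
  linarith

lemma err_pt {k δ N α : ℝ} {g : ℂ → ℝ → ℂ → ℂ → ℝ} (hg : Gok k δ δ N α g) (hδ : 0 ≤ δ)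
    (hα0 : 0 < α) (hα1 : α ≤ 1) {r X M Y : ℝ} (hr : 0 < r) (hr1 : r ≤ 1 / 2) (hX : 0 < X) (hM : 0 ≤ M)
    (hN : N ≤ δ * X) (hN0 : 0 ≤ N)
    (hY : Y = X * r ^ α) {S : ℝ} {P : ℂ} {τ : ℝ} {μ : ℂ} (cS : |S| ≤ X * M) (cP : ‖P‖ ≤ X * M) (cτ : |τ| ≤ X * M)
    (cμ : ‖μ‖ ≤ X * M) {x : ℂ} (hx : ‖x‖ ≤ r) {s : ℝ} {p m : ℂ} {gv mv : ℝ} (hgv : 0 ≤ gv) (hmv : 0 ≤ mv)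
    (hs : |s - Qd S P τ μ x| ≤ 2 * Y * r ^ 2) (hp : ‖p - gr (Qd S P τ μ) x‖ ≤ Y * r * gv)
    (hm : ‖m - μ‖ ≤ Y * mv) :
    |g x s p m - g 0 S P m| ≤ Y * (δ * (8 * M + 3) + δ * (gv + mv)) := by
  have hrα : r ≤ r ^ α := by
    calc r = r ^ (1:ℝ) := (rpow_one r).symm
      _ ≤ r ^ α := rpow_le_rpow_of_exponent_ge hr (by linarith) hα1
  have hrα1 : r ^ α ≤ 1 := rpow_le_one hr.le (by linarith) hα0.le
  have hrα0 : 0 < r ^ α := by positivity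
  have hY0 : 0 < Y := by rw [hY]; positivity
  have hXr : X * M * r ≤ Y * M := by
    rw [hY]; have := mul_le_mul_of_nonneg_left hrα (mul_nonneg hX.le hM); linarith
  have hXM : 0 ≤ X * M := by positivity
  have h1 := hg.lip x s S p P m m
  have h2 := hg.hol x 0 S P m
  rw [sub_self, norm_zero, mul_zero, zero_add] at h1
  rw [sub_zero] at h2
  have hpP : ‖p - P‖ ≤ Y * M + Y * gv := by
    have e : p - P = (p - gr (Qd S P τ μ) x) + ((τ:ℂ) * x + μ * (starRingEnd ℂ) x) / 2 := by
      rw [Qd_gr]; ring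
    rw [e]
    have e2 : ‖((τ:ℂ) * x + μ * (starRingEnd ℂ) x) / 2‖ ≤ X * M * r := by
      rw [norm_div]
      have := norm_add_le ((τ:ℂ) * x) (μ * (starRingEnd ℂ) x)
      rw [norm_mul, norm_mul, Complex.norm_real, Real.norm_eq_abs, RCLike.norm_conj] at this
      have t1 : |τ| * ‖x‖ ≤ X * M * r := by gcongr
      have t2 : ‖μ‖ * ‖x‖ ≤ X * M * r := by gcongr
      norm_num
      linarith
    have e3 : Y * r * gv ≤ Y * gv := by
      have : Y * gv * r ≤ Y * gv * 1 := by gcongr; linarith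
      linarith
    refine (norm_add_le _ _).trans ?_
    linarith
  have hsS : |s - S| ≤ 4 * (Y * M) + Y := by
    have := Qd_bd (S := S) (P := P) (τ := τ) (μ := μ) hx
    have t1 : 2 * ‖P‖ * r ≤ 2 * (X * M) * r := by gcongr
    have t2 : (|τ| + ‖μ‖) * r ^ 2 ≤ (X * M + X * M) * r ^ 2 := by gcongr
    have t3 : (X * M + X * M) * r ^ 2 ≤ 2 * (X * M * r) := by
      have : X * M * r * r ≤ X * M * r * 1 := by gcongr; linarith
      nlinarith
    have t4 : 2 * Y * r ^ 2 ≤ Y := by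
      have : r ^ 2 ≤ 1 / 2 := by nlinarith
      nlinarith
    have := abs_sub_le s (Qd S P τ μ x) S
    linarith
  have hmm : ‖m‖ ≤ X * M + Y * mv := by
    have : m = (m - μ) + μ := by ring
    rw [this]; refine (norm_add_le _ _).trans ?_; linarith
  have hb : (δ * (‖m‖ + ‖P‖ + |S|) + N) * ‖x‖ ^ α ≤ (δ * (3 * (X * M) + Y * mv) + δ * X) * r ^ α := by
    have : ‖x‖ ^ α ≤ r ^ α := rpow_le_rpow (norm_nonneg _) hx hα0.le
    have h3 : ‖m‖ + ‖P‖ + |S| ≤ 3 * (X * M) + Y * mv := by linarith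
    gcongr
  have hc : (δ * (3 * (X * M) + Y * mv) + δ * X) * r ^ α ≤ Y * (δ * (3 * M + 1 + mv)) := by
    have e : (δ * (3 * (X * M) + Y * mv) + δ * X) * r ^ α = Y * (δ * (3 * M + 1)) + δ * (Y * mv) * r ^ α := by
      rw [hY]; ring
    rw [e]
    have : δ * (Y * mv) * r ^ α ≤ δ * (Y * mv) * 1 := by gcongr
    nlinarith
  have hd : δ * (‖p - P‖ + |s - S|) ≤ Y * (δ * (5 * M + 1 + gv)) := by
    have : δ * (‖p - P‖ + |s - S|) ≤ δ * ((Y * M + Y * gv) + (4 * (Y * M) + Y)) := by gcongr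
    refine this.trans (le_of_eq (by ring))
  have hf := abs_sub_le (g x s p m) (g x S P m) (g 0 S P m)
  have hpos : 0 ≤ Y * δ := by positivity
  calc _ ≤ Y * (δ * (5 * M + 1 + gv)) + Y * (δ * (3 * M + 1 + mv)) := by linarith
    _ = Y * (δ * (8 * M + 3) + δ * (gv + mv)) - Y * δ := by ring
    _ ≤ _ := by linarith

structure Good (w : ℂ → ℝ) (α M X r S : ℝ) (P : ℂ) (τ : ℝ) (μ : ℂ) : Prop where
  hes : Ib r (hd2 w τ μ) ≤ (X * r ^ (1 + α)) ^ 2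
  sup : ∀ z : ℂ, ‖z‖ ≤ r → |w z - Qd S P τ μ z| ≤ 2 * X * r ^ (2 + α)
  cS : |S| ≤ X * M * (1 - r ^ α)
  cP : ‖P‖ ≤ X * M * (1 - r ^ α)
  cτ : |τ| ≤ X * M * (1 - r ^ α)
  cμ : ‖μ‖ ≤ X * M * (1 - r ^ α)

lemma hd2_cont {w : ℂ → ℝ} (hw : Sm w) (τ : ℝ) (μ : ℂ) : Continuous (hd2 w τ μ) := by
  obtain ⟨a1, a2, a3, a4, a5, a6, a7, a8, a9, a10, a11⟩ := sm_all hw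
  unfold hd2; fun_prop

/-- values of the rescaled function -/
lemma vscal {w : ℂ → ℝ} (hw : Sm w) (Y r S : ℝ) (P : ℂ) (τ : ℝ) (μ : ℂ) (hY : Y ≠ 0) (hr : r ≠ 0) :
    let v := fun z => (Y * r ^ 2)⁻¹ * (fun z => w z - Qd S P τ μ z) (0 + (r:ℂ) * z)
    Sm v ∧ ∀ z : ℂ, La w (0 + (r:ℂ) * z) = τ + Y * La v z ∧ mm w (0 + (r:ℂ) * z) = μ + Y * mm v z ∧
      w (0 + (r:ℂ) * z) - Qd S P τ μ (0 + (r:ℂ) * z) = Y * r ^ 2 * v z ∧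
      gr w (0 + (r:ℂ) * z) - gr (Qd S P τ μ) (0 + (r:ℂ) * z) = ((Y * r : ℝ):ℂ) * gr v z := by
  intro v
  have hQ := Qd_sm S P τ μ
  have hf := hw.sub hQ
  have e : (Y * r ^ 2)⁻¹ * r ^ 2 = Y⁻¹ := by field_simp
  have e' : (Y * r ^ 2)⁻¹ * r = (Y * r)⁻¹ := by field_simp
  have hYc : (Y:ℂ) ≠ 0 := by exact_mod_cast hY
  have hrc : (r:ℂ) ≠ 0 := by exact_mod_cast hr
  refine ⟨(Sm.const _).mul (hf.comp_aff 0 r), fun z => ⟨?_, ?_, ?_, ?_⟩⟩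
  · simp only [v]; rw [La_scal hf, La_sub hw hQ, Qd_La, e]; field_simp; ring
  · simp only [v]; rw [mm_scal hf, mm_sub hw hQ, Qd_mm, e]; push_cast; field_simp; ring
  · simp only [v]; field_simp
  · simp only [v]; rw [gr_scal hf, gr_sub hw hQ, e']; push_cast; field_simp

lemma scaled {k δ N α : ℝ} {g : ℂ → ℝ → ℂ → ℂ → ℝ} (hg : Gok k δ δ N α g) (hδ : 0 < δ) (hδ1 : δ ≤ 1)
    (hα0 : 0 < α) (hα1 : α ≤ 1) {r X M Y : ℝ} (hr : 0 < r) (hr1 : r ≤ 1 / 2) (hX : 0 < X) (hM : 0 ≤ M)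
    (hN : N ≤ δ * X) (hN0 : 0 ≤ N)
    (hY : Y = X * r ^ α) {S : ℝ} {P : ℂ} {τ : ℝ} {μ : ℂ} {w : ℂ → ℝ} (hw : Sm w)
    (hG : Good w α M X r S P τ μ) (he : Ib 1 (fun z => res g w z ^ 2) ≤ δ * (r * Y) ^ 2) :
    let v := fun z => (Y * r ^ 2)⁻¹ * (fun z => w z - Qd S P τ μ z) (0 + (r:ℂ) * z)
    let G := fun m : ℂ => (g 0 S P (μ + Y * m) - τ) / Y
    (∀ a b : ℂ, |G a - G b| ≤ k * ‖a - b‖) ∧ Ib 1 (hn v) ≤ 1 ∧ (∀ z : ℂ, ‖z‖ ≤ 1 → |v z| ≤ 2) ∧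
    Ib (1 / 2) (fun z => (La v z - G (mm v z)) ^ 2) ≤ δ * (4 * (602 + 4 * (8 * M + 3) ^ 2)) := by
  intro v G
  have hY0 : 0 < Y := by rw [hY]; positivity
  have hrα1 : r ^ α ≤ 1 := rpow_le_one hr.le (by linarith) hα0.le
  have hrα0 : 0 < r ^ α := by positivity
  have e1 : X * r ^ (1 + α) = r * Y := by rw [rpow_add hr, rpow_one, hY]; ring
  have e2 : X * r ^ (2 + α) = r ^ 2 * Y := by
    rw [rpow_add hr, hY, show (2:ℝ) = ((2:ℕ):ℝ) by norm_num, rpow_natCast]; ring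
  obtain ⟨hv, hval⟩ := vscal hw Y r S P τ μ hY0.ne' hr.ne'
  change Sm v at hv
  change ∀ z : ℂ, La w (0 + (r:ℂ) * z) = τ + Y * La v z ∧ mm w (0 + (r:ℂ) * z) = μ + Y * mm v z ∧
      w (0 + (r:ℂ) * z) - Qd S P τ μ (0 + (r:ℂ) * z) = Y * r ^ 2 * v z ∧
      gr w (0 + (r:ℂ) * z) - gr (Qd S P τ μ) (0 + (r:ℂ) * z) = ((Y * r : ℝ):ℂ) * gr v z at hval
  clear_value v
  have nx : ∀ z : ℂ, ‖z‖ ≤ 1 → ‖(0:ℂ) + (r:ℂ) * z‖ ≤ r := by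
    intro z hz
    rw [zero_add, norm_mul, Complex.norm_real, norm_of_nonneg hr.le]
    calc r * ‖z‖ ≤ r * 1 := by gcongr
      _ = r := mul_one r
  have nY : ∀ a : ℂ, ‖(Y:ℂ) * a‖ = Y * ‖a‖ := by
    intro a; rw [norm_mul, Complex.norm_real, norm_of_nonneg hY0.le]
  have hGl : ∀ a b : ℂ, |G a - G b| ≤ k * ‖a - b‖ := by
    intro a b
    have h := hg.lip 0 S S P P (μ + Y * a) (μ + Y * b)
    have ee : μ + Y * a - (μ + Y * b) = (Y:ℂ) * (a - b) := by ring
    rw [ee, nY] at h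
    simp at h
    have ef : G a - G b = (g 0 S P (μ + Y * a) - g 0 S P (μ + Y * b)) / Y := by simp only [G]; ring
    rw [ef, abs_div, abs_of_pos hY0, div_le_iff₀ hY0]
    linarith
  have hsup : ∀ z : ℂ, ‖z‖ ≤ 1 → |v z| ≤ 2 := by
    intro z hz
    have h := hG.sup _ (nx z hz)
    rw [(hval z).2.2.1, mul_assoc 2 X, e2, abs_mul, abs_of_pos (by positivity : 0 < Y * r ^ 2)] at h
    have hp : 0 < Y * r ^ 2 := by positivity
    by_contra hc
    push Not at hc
    nlinarith
  have hh : Ib 1 (hn v) ≤ 1 := by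
    have h := hG.hes
    rw [e1] at h
    have e3 := Ib_scale' r 1 hr (hd2 w τ μ)
    have e4 : (fun z => hd2 w τ μ (0 + (r:ℂ) * z)) = fun z => Y ^ 2 * hn v z := by
      funext z
      rw [hd2, (hval z).1, (hval z).2.1, hn_eq, add_sub_cancel_left, add_sub_cancel_left, nY]; ring
    rw [e4, Ib_mul, mul_one] at e3
    have : Y ^ 2 * Ib 1 (hn v) ≤ Y ^ 2 * 1 := by
      rw [e3, inv_mul_le_iff₀ (by positivity)]
      linarith
    exact le_of_mul_le_mul_left this (by positivity)
  refine ⟨hGl, hh, hsup, ?_⟩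
  obtain ⟨a1, a2, a3, a4, a5, a6, a7, a8, a9, a10, a11⟩ := sm_all hv
  have cG : Continuous G := by
    have : LipschitzWith (Real.toNNReal k) G := LipschitzWith.of_dist_le_mul (by
      intro a b; rw [Real.dist_eq, dist_eq_norm]
      exact (hGl a b).trans (by gcongr; exact Real.le_coe_toNNReal k))
    exact this.continuous
  have cr := res_cont hg hα0 hw
  have crc : Continuous (fun z : ℂ => res g w (0 + (r:ℂ) * z) ^ 2) := by fun_prop
  have hXM : X * M * (1 - r ^ α) ≤ X * M := by
    have : 0 ≤ X * M * r ^ α := by positivity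
    linarith
  have hpt : ∀ z : ℂ, ‖z‖ ≤ 1 / 2 → (La v z - G (mm v z)) ^ 2 ≤
      4 * ((Y ^ 2)⁻¹ * res g w (0 + (r:ℂ) * z) ^ 2 + ((δ * (8 * M + 3)) ^ 2 + (δ ^ 2 * ‖gr v z‖ ^ 2 + δ ^ 2 * ‖mm v z‖ ^ 2))) := by
    intro z hz
    have hz1 : ‖z‖ ≤ 1 := by linarith
    have h := err_pt hg hδ.le hα0 hα1 hr hr1 hX hM hN hN0 hY (hG.cS.trans hXM) (hG.cP.trans hXM)
      (hG.cτ.trans hXM) (hG.cμ.trans hXM) (nx z hz1) (norm_nonneg (gr v z)) (norm_nonneg (mm v z))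
      (s := w (0 + (r:ℂ) * z)) (p := gr w (0 + (r:ℂ) * z)) (m := mm w (0 + (r:ℂ) * z))
      (by have := hG.sup _ (nx z hz1); rw [mul_assoc, e2] at this; linarith)
      (by rw [(hval z).2.2.2, norm_mul, Complex.norm_real, norm_of_nonneg (by positivity)])
      (by rw [(hval z).2.1, add_sub_cancel_left, nY])
    have e5 : La v z - G (mm v z) = Y⁻¹ * res g w (0 + (r:ℂ) * z) +
        Y⁻¹ * (g (0 + (r:ℂ) * z) (w (0 + (r:ℂ) * z)) (gr w (0 + (r:ℂ) * z)) (mm w (0 + (r:ℂ) * z)) - g 0 S P (mm w (0 + (r:ℂ) * z))) := by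
      simp only [G, res]
      rw [← (hval z).2.1, (hval z).1]; field_simp; ring
    rw [e5]
    set A := g (0 + (r:ℂ) * z) (w (0 + (r:ℂ) * z)) (gr w (0 + (r:ℂ) * z)) (mm w (0 + (r:ℂ) * z)) - g 0 S P (mm w (0 + (r:ℂ) * z)) with hA
    have h' : |Y⁻¹ * A| ≤ δ * (8 * M + 3) + δ * (‖gr v z‖ + ‖mm v z‖) := by
      rw [abs_mul, abs_inv, abs_of_pos hY0, inv_mul_le_iff₀ hY0]; exact h
    have h2 : (Y⁻¹ * A) ^ 2 ≤ (δ * (8 * M + 3) + δ * (‖gr v z‖ + ‖mm v z‖)) ^ 2 := by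
      rw [← sq_abs]; gcongr
    rw [← inv_pow, ← mul_pow, ← mul_pow, ← mul_pow]
    generalize Y⁻¹ * A = t1 at *
    generalize Y⁻¹ * res g w (0 + (r:ℂ) * z) = t2 at *
    generalize δ * (8 * M + 3) = t3 at *
    rw [mul_add] at h2
    generalize δ * ‖gr v z‖ = t4 at *
    generalize δ * ‖mm v z‖ = t5 at *
    nlinarith [sq_nonneg (t1 - 3 * t2), sq_nonneg (t3 - t4), sq_nonneg (t4 - t5), sq_nonneg (t3 - t5)]
  have hI := Ib_mono (r := 1 / 2) (by fun_prop) (by fun_prop) hpt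
  rw [Ib_mul, Ib_add (by fun_prop) (by fun_prop), Ib_add (by fun_prop) (by fun_prop), Ib_add (by fun_prop) (by fun_prop),
    Ib_mul, Ib_mul, Ib_mul, Ib_const (by norm_num), Ib_scale' r (1 / 2) hr (fun z => res g w z ^ 2)] at hI
  have i1 : Ib (r * (1 / 2)) (fun z => res g w z ^ 2) ≤ δ * (r * Y) ^ 2 := by
    refine le_trans (Ib_mono_set (by linarith) (by fun_prop) (fun z _ => by positivity)) he
  have i2 : (Y ^ 2)⁻¹ * ((r ^ 2)⁻¹ * Ib (r * (1 / 2)) (fun z => res g w z ^ 2)) ≤ δ := by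
    rw [inv_mul_le_iff₀ (by positivity), inv_mul_le_iff₀ (by positivity)]
    linarith
  have i3 := grB hv hh hsup
  have i4 : Ib (1 / 2) (fun z => ‖mm v z‖ ^ 2) ≤ 1 := by
    refine le_trans (Ib_mono_set (s := 1) (by norm_num) (by fun_prop) (fun z _ => by positivity)) (le_trans (Ib_mono (by fun_prop) (by fun_prop) ?_) hh)
    intro z _
    rw [hn_eq]; nlinarith [sq_nonneg (La v z)]
  have hδ2 : δ ^ 2 ≤ δ := by nlinarith
  have i5 : δ ^ 2 * Ib (1 / 2) (fun z => ‖gr v z‖ ^ 2) ≤ δ * 600 := by gcongr; exact Ib_nonneg (fun z _ => by positivity)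
  have i6 : δ ^ 2 * Ib (1 / 2) (fun z => ‖mm v z‖ ^ 2) ≤ δ * 1 := by gcongr; exact Ib_nonneg (fun z _ => by positivity)
  have i7 : π * (1 / 2) ^ 2 * (δ * (8 * M + 3)) ^ 2 ≤ 4 * (δ * (8 * M + 3) ^ 2) := by
    rw [mul_pow]
    have : π * (1 / 2) ^ 2 ≤ 4 := by linarith [pi_le_four]
    gcongr
  linarith

lemma eq_bd {δ k : ℝ} (hk0 : 0 ≤ k) (hk : k < 1) {v : ℂ → ℝ} {G : ℂ → ℝ} (hv : Sm v) (hGl : ∀ a b : ℂ, |G a - G b| ≤ k * ‖a - b‖)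
    (hh : Ib 1 (hn v) ≤ 1) (he : Ib (1 / 2) (fun z => (La v z - G (mm v z)) ^ 2) ≤ δ) : |G 0| ≤ 4 + 4 * δ := by
  obtain ⟨a1, a2, a3, a4, a5, a6, a7, a8, a9, a10, a11⟩ := sm_all hv
  have cG : Continuous G := by
    have : LipschitzWith (Real.toNNReal k) G := LipschitzWith.of_dist_le_mul (by
      intro a b; rw [Real.dist_eq, dist_eq_norm]
      exact (hGl a b).trans (by gcongr; exact Real.le_coe_toNNReal k))
    exact this.continuous
  have h1 : Ib (1 / 2) (fun _ => G 0 ^ 2) ≤ Ib (1 / 2) (fun z => 3 * (hn v z + (La v z - G (mm v z)) ^ 2)) := by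
    refine Ib_mono (by fun_prop) (by fun_prop) ?_
    intro z _
    have h := hGl (mm v z) 0
    rw [sub_zero] at h
    have h2 : |G (mm v z) - G 0| ≤ ‖mm v z‖ := h.trans (by nlinarith [norm_nonneg (mm v z)])
    have h3 : (G (mm v z) - G 0) ^ 2 ≤ ‖mm v z‖ ^ 2 := by rw [← sq_abs]; gcongr
    rw [hn_eq]
    nlinarith [sq_nonneg (La v z + (La v z - G (mm v z))), sq_nonneg (La v z + (G (mm v z) - G 0)), sq_nonneg ((La v z - G (mm v z)) - (G (mm v z) - G 0))]
  rw [Ib_const (by norm_num), Ib_mul, Ib_add (by fun_prop) (by fun_prop)] at h1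
  have h2 : Ib (1 / 2) (hn v) ≤ 1 := le_trans (Ib_mono_set (by norm_num) (by fun_prop) (fun z _ => hn_nonneg v z)) hh
  have h3 : 3 / 4 * G 0 ^ 2 ≤ π * (1 / 2) ^ 2 * G 0 ^ 2 := by
    gcongr; linarith [pi_gt_three]
  have h4 : G 0 ^ 2 ≤ 4 + 4 * δ := by linarith
  have hδ : 0 ≤ δ := le_trans (Ib_nonneg (fun z _ => by positivity)) he
  apply abs_le_of_sq_le_sq _ (by linarith)
  nlinarith

lemma reg_step {k α : ℝ} (hk0 : 0 ≤ k) (hk : k < 1) (hα0 : 0 < α) (hα1 : α ≤ 1) (hα : 2 * α < mor k) :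
    ∃ θ δ M : ℝ, 0 < θ ∧ θ ≤ 1 / 8 ∧ 0 < δ ∧ δ ≤ 1 ∧ 0 < M ∧ ∀ (g : ℂ → ℝ → ℂ → ℂ → ℝ) (N X : ℝ),
    Gok k δ δ N α g → 0 < X → 0 ≤ N → N ≤ δ * X → ∀ (w : ℂ → ℝ), Sm w → ∀ r, 0 < r → r ≤ 1 / 2 →
    Ib 1 (fun z => res g w z ^ 2) ≤ δ * (r * (X * r ^ α)) ^ 2 → ∀ S P τ μ, Good w α M X r S P τ μ →
    |τ - g 0 S P μ| ≤ M * X * r ^ α ∧ ∃ S' P' τ' μ', Good w α M X (θ * r) S' P' τ' μ' := by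
  obtain ⟨θ, δ0, C, hθ0, hθ8, hδ0, hC, H⟩ := improve hk0 hk hα0 hα
  have hθα : θ ^ α < 1 := rpow_lt_one hθ0.le (by linarith) hα0
  have h1θ : 0 < 1 - θ ^ α := by linarith
  set M := C / (1 - θ ^ α) + 4 + 4 * δ0 with hM
  have hM0 : 0 < M := by rw [hM]; positivity
  have hMC : C ≤ M * (1 - θ ^ α) := by
    rw [hM]
    have e : (C / (1 - θ ^ α) + 4 + 4 * δ0) * (1 - θ ^ α) = C + (4 + 4 * δ0) * (1 - θ ^ α) := by field_simp; ring
    rw [e]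
    have : 0 < (4 + 4 * δ0) * (1 - θ ^ α) := by positivity
    linarith
  have hM4 : 4 + 4 * δ0 ≤ M := by
    rw [hM]; have : 0 < C / (1 - θ ^ α) := by positivity
    linarith
  set B := 4 * (602 + 4 * (8 * M + 3) ^ 2) with hB
  have hB0 : 0 < B := by rw [hB]; positivity
  clear_value M B
  refine ⟨θ, min 1 (δ0 / B), M, hθ0, hθ8, by positivity, min_le_left _ _, hM0, ?_⟩
  have hδB : min 1 (δ0 / B) * B ≤ δ0 := by
    rw [← le_div_iff₀ hB0]; exact min_le_right _ _
  have hd0 : 0 < min 1 (δ0 / B) := by positivity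
  have hd1 : min 1 (δ0 / B) ≤ 1 := min_le_left _ _
  generalize min 1 (δ0 / B) = δ at *
  intro g N X hg hX hN0 hN w hw r hr hr1 he S P τ μ hG
  set Y := X * r ^ α with hY
  have hY0 : 0 < Y := by rw [hY]; positivity
  obtain ⟨hGl, hh, hsup, hE⟩ := scaled hg hd0 hd1 hα0 hα1 hr hr1 hX hM0.le hN hN0 hY hw hG he
  obtain ⟨hv, hval⟩ := vscal hw Y r S P τ μ hY0.ne' hr.ne'
  set v := fun z => (Y * r ^ 2)⁻¹ * (fun z => w z - Qd S P τ μ z) (0 + (r:ℂ) * z) with hvdef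
  set G := fun m : ℂ => (g 0 S P (μ + Y * m) - τ) / Y with hGdef
  rw [← hB] at hE
  have hE' := hE.trans hδB
  have hq := eq_bd hk0 hk hv hGl hh hE'
  have e1 : ∀ x : ℝ, 0 < x → X * x ^ (1 + α) = x * (X * x ^ α) := by
    intro x hx; rw [rpow_add hx, rpow_one]; ring
  have e2 : ∀ x : ℝ, 0 < x → X * x ^ (2 + α) = x ^ 2 * (X * x ^ α) := by
    intro x hx
    rw [rpow_add hx, show (2:ℝ) = ((2:ℕ):ℝ) by norm_num, rpow_natCast]; ring
  have e3 : X * (θ * r) ^ α = θ ^ α * Y := by rw [mul_rpow hθ0.le hr.le, hY]; ring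
  have hθr : 0 < θ * r := by positivity
  constructor
  · simp only [hGdef, mul_zero, add_zero] at hq
    rw [abs_div, abs_of_pos hY0, div_le_iff₀ hY0, abs_sub_comm] at hq
    calc _ ≤ (4 + 4 * δ0) * Y := hq
      _ ≤ M * Y := by gcongr
      _ = _ := by rw [hY]; ring
  obtain ⟨s, p, t, m, cs, cp, ct, cm, hI, hS⟩ := H v G hv hGl hh hsup hE'
  have nY : ∀ a : ℂ, ‖(Y:ℂ) * a‖ = Y * ‖a‖ := by
    intro a; rw [norm_mul, Complex.norm_real, norm_of_nonneg hY0.le]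
  have hco : X * M * (1 - r ^ α) + Y * C ≤ X * M * (1 - (θ * r) ^ α) := by
    have : X * M * (1 - (θ * r) ^ α) = X * M * (1 - r ^ α) + Y * (M * (1 - θ ^ α)) := by
      rw [mul_rpow hθ0.le hr.le, hY]; ring
    rw [this]; gcongr
  have hr11 : r ≤ 1 := by linarith
  have hr2 : r ^ 2 ≤ 1 := by nlinarith
  refine ⟨S + Y * r ^ 2 * s, P + (Y * r : ℝ) * p, τ + Y * t, μ + Y * m, ?_, ?_, ?_, ?_, ?_, ?_⟩
  · have i1 := Ib_scale' r θ hr (hd2 w (τ + Y * t) (μ + Y * m))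
    have e4 : (fun z => hd2 w (τ + Y * t) (μ + Y * m) (0 + (r:ℂ) * z)) = fun z => Y ^ 2 * hd2 v t m z := by
      funext z
      have q : μ + Y * mm v z - (μ + Y * m) = (Y:ℂ) * (mm v z - m) := by ring
      rw [hd2, (hval z).1, (hval z).2.1, q, nY, hd2]; ring
    rw [e4, Ib_mul, mul_comm r θ] at i1
    rw [hn_subQ hv] at hI
    have i2 : Ib (θ * r) (hd2 w (τ + Y * t) (μ + Y * m)) = r ^ 2 * (Y ^ 2 * Ib θ (hd2 v t m)) := by
      rw [i1]; field_simp
    rw [i2, e1 _ hθr, e3]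
    calc r ^ 2 * (Y ^ 2 * Ib θ (hd2 v t m)) ≤ r ^ 2 * (Y ^ 2 * (θ ^ (1 + α)) ^ 2) := by gcongr
      _ = _ := by rw [rpow_add hθ0, rpow_one]; ring
  · intro z hz
    have hz' : z = 0 + (r:ℂ) * ((r⁻¹ : ℝ) * z) := by
      have : (r:ℂ) ≠ 0 := by exact_mod_cast hr.ne'
      push_cast; field_simp; simp
    have hn' : ‖((r⁻¹ : ℝ):ℂ) * z‖ ≤ θ := by
      rw [norm_mul, Complex.norm_real, norm_of_nonneg (by positivity), inv_mul_le_iff₀ hr]; linarith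
    have h1 := hS _ hn'
    have h2 := (hval ((r⁻¹ : ℝ) * z)).2.2.1
    rw [← hz'] at h2
    have h3 : w z - Qd (S + Y * r ^ 2 * s) (P + (Y * r : ℝ) * p) (τ + Y * t) (μ + Y * m) z =
        Y * r ^ 2 * (v ((r⁻¹ : ℝ) * z) - Qd s p t m ((r⁻¹ : ℝ) * z)) := by
      rw [mul_sub, ← h2, Qd_scale, ← Qd_add]
      have q1 : Y * r ^ 2 * r⁻¹ = Y * r := by field_simp
      have q2 : Y * r ^ 2 * r⁻¹ ^ 2 = Y := by field_simp
      rw [q1, q2]; ring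
    rw [h3, abs_mul, abs_of_pos (by positivity), mul_assoc 2 X, e2 _ hθr, e3]
    calc _ ≤ Y * r ^ 2 * (2 * θ ^ (2 + α)) := by gcongr
      _ = _ := by
        rw [rpow_add hθ0, show (2:ℝ) = ((2:ℕ):ℝ) by norm_num, rpow_natCast]; push_cast; ring
  · refine le_trans (abs_add_le _ _) (le_trans (add_le_add hG.cS ?_) hco)
    rw [abs_mul, abs_of_pos (by positivity)]
    calc Y * r ^ 2 * |s| ≤ Y * 1 * C := by gcongr
      _ = _ := by ring
  · refine le_trans (norm_add_le _ _) (le_trans (add_le_add hG.cP ?_) hco)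
    rw [norm_mul, Complex.norm_real, norm_of_nonneg (by positivity)]
    calc Y * r * ‖p‖ ≤ Y * 1 * C := by gcongr
      _ = _ := by ring
  · refine le_trans (abs_add_le _ _) (le_trans (add_le_add hG.cτ ?_) hco)
    rw [abs_mul, abs_of_pos (by positivity)]
    gcongr
  · refine le_trans (norm_add_le _ _) (le_trans (add_le_add hG.cμ ?_) hco)
    rw [nY]
    gcongr

/-- base of the induction -/
lemma reg_base {k α : ℝ} (hk0 : 0 ≤ k) (hk : k < 1) (hα0 : 0 < α) (hα1 : α ≤ 1) : ∃ C : ℝ, 1 ≤ C ∧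
    ∀ (g : ℂ → ℝ → ℂ → ℂ → ℝ) (δ K N M : ℝ), 0 ≤ δ → δ ≤ 1 → 0 < N → 0 ≤ M → Gok k δ K N α g → |g 0 0 0 0| ≤ N →
    ∀ w, Sm w → (∀ z : ℂ, ‖z‖ ≤ 1 → |w z| ≤ 2 * N) → Ib 1 (fun z => res g w z ^ 2) ≤ N ^ 2 →
    ∀ X, C * N ≤ X → Good w α M X (1 / 2) 0 0 0 0 := by
  obtain ⟨C, hC, H⟩ := energy hk0 hk
  refine ⟨16 + 4 * (4 * (C * 180)), by linarith, ?_⟩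
  intro g δ K N M hδ0 hδ1 hN hM hg hg0 w hw hwN he X hX
  obtain ⟨a1, a2, a3, a4, a5, a6, a7, a8, a9, a10, a11⟩ := sm_all hw
  have cr := res_cont hg hα0 hw
  have ce := et_sm.cont
  have h1 := H w (fun z => |res g w z| + 4 * N) hw (by fun_prop) (by
    intro z hz
    have l := hg.lip z (w z) 0 (gr w z) 0 (mm w z) 0
    have l2 := hg.hol z 0 0 0 0
    simp only [sub_zero, norm_zero, abs_zero, add_zero, mul_zero, zero_add] at l l2
    have l3 : ‖z‖ ^ α ≤ 1 := rpow_le_one (norm_nonneg _) hz hα0.le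
    have l4 : N * ‖z‖ ^ α ≤ N := by nlinarith
    have l5 : δ * (‖gr w z‖ + |w z|) ≤ 1 * (‖gr w z‖ + |w z|) := by gcongr
    have l6 := hwN z hz
    have e : La w z = res g w z + ((g z (w z) (gr w z) (mm w z) - g z 0 0 0) + ((g z 0 0 0 - g 0 0 0 0) + g 0 0 0 0)) := by
      unfold res; ring
    rw [e]
    refine (abs_add_le _ _).trans ?_
    have := abs_add_le (g z (w z) (gr w z) (mm w z) - g z 0 0 0) ((g z 0 0 0 - g 0 0 0 0) + g 0 0 0 0)
    have := abs_add_le (g z 0 0 0 - g 0 0 0 0) (g 0 0 0 0)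
    linarith)
  have h2 : Ib 1 (fun z => w z ^ 2) ≤ 16 * N ^ 2 := by
    refine le_trans (Ib_mono (g := fun _ => 4 * N ^ 2) (by fun_prop) (by fun_prop) ?_) ?_
    · intro z hz
      have := abs_le.1 (hwN z hz)
      nlinarith
    · rw [Ib_const zero_le_one]; nlinarith [pi_le_four, sq_nonneg N]
  have h3 : Ib 1 (fun z => (|res g w z| + 4 * N) ^ 2) ≤ 130 * N ^ 2 := by
    refine le_trans (Ib_mono (g := fun z => 2 * res g w z ^ 2 + 32 * N ^ 2) (by fun_prop) (by fun_prop) ?_) ?_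
    · intro z hz
      rw [← sq_abs (res g w z)]
      nlinarith [sq_nonneg (|res g w z| - 4 * N)]
    · rw [Ib_add (by fun_prop) (by fun_prop), Ib_mul, Ib_const zero_le_one]; nlinarith [pi_le_four, sq_nonneg N]
  have h4 : Ib (1 / 2) (hn w) ≤ 4 * Ib 1 (fun z => et z ^ 4 * hn w z) := by
    rw [← Ib_mul]
    refine le_trans (Ib_mono (g := fun z => 4 * (et z ^ 4 * hn w z)) (by fun_prop) (by fun_prop) ?_) (Ib_mono_set (by norm_num) (by fun_prop) (fun z hz => ?_))
    · intro z hz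
      have h5 : 3 / 4 ≤ et z := by rw [et_eq]; nlinarith [norm_nonneg z]
      have h6 : (3 / 4) ^ 4 ≤ et z ^ 4 := by gcongr
      nlinarith [hn_nonneg w z]
    · have := hn_nonneg w z; positivity
  have h5 : Ib (1 / 2) (hn w) ≤ 4 * (C * 180) * N ^ 2 := by
    have : C * (Ib 1 (fun z => w z ^ 2) + Ib 1 (fun z => (|res g w z| + 4 * N) ^ 2)) ≤ C * (16 * N ^ 2 + 130 * N ^ 2) := by gcongr
    have : 0 ≤ C * N ^ 2 := by positivity
    linarith
  have hp : ∀ e : ℝ, e ≤ 3 → (1 / 8 : ℝ) ≤ (1 / 2) ^ e := by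
    intro e he
    calc (1 / 8 : ℝ) = (1 / 2) ^ (3:ℝ) := by rw [show (3:ℝ) = ((3:ℕ):ℝ) by norm_num, rpow_natCast]; norm_num
      _ ≤ _ := rpow_le_rpow_of_exponent_ge (by norm_num) (by norm_num) he
  have hp2 : ∀ e : ℝ, e ≤ 2 → (1 / 4 : ℝ) ≤ (1 / 2) ^ e := by
    intro e he
    calc (1 / 4 : ℝ) = (1 / 2) ^ (2:ℝ) := by rw [show (2:ℝ) = ((2:ℕ):ℝ) by norm_num, rpow_natCast]; norm_num
      _ ≤ _ := rpow_le_rpow_of_exponent_ge (by norm_num) (by norm_num) he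
  have hα2 : ((1:ℝ) / 2) ^ α ≤ 1 := rpow_le_one (by norm_num) (by norm_num) hα0.le
  set D := 4 * (C * 180) with hD
  have hD0 : 0 < D := by rw [hD]; positivity
  have hX0 : 0 ≤ X := le_trans (by positivity) hX
  have hco : 0 ≤ X * M * (1 - (1 / 2) ^ α) := by
    have : 0 ≤ 1 - ((1:ℝ) / 2) ^ α := by linarith
    positivity
  refine ⟨?_, ?_, by simpa using hco, by simpa using hco, by simpa using hco, by simpa using hco⟩
  · rw [← hn_sub']
    refine h5.trans ?_
    have i1 : (4 + D) * N ≤ X * (1 / 2) ^ (1 + α) := by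
      calc (4 + D) * N = (16 + 4 * D) * N * (1 / 4) := by ring
        _ ≤ X * (1 / 2) ^ (1 + α) := by
          have := hp2 (1 + α) (by linarith)
          gcongr
    calc D * N ^ 2 ≤ ((4 + D) * N) ^ 2 := by nlinarith [sq_nonneg N, mul_pos hD0 (pow_pos hN 2), sq_nonneg (D * N)]
      _ ≤ _ := by gcongr
  · intro z hz
    rw [Qd_zero, sub_zero]
    refine (hwN z (by linarith)).trans ?_
    have i1 : 2 * N ≤ X * (1 / 8) := by nlinarith [mul_pos hD0 hN]
    have i2 : X * (1 / 8) ≤ X * (1 / 2) ^ (2 + α) := by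
      have := hp (2 + α) (by linarith)
      gcongr
    nlinarith

lemma geoR {E : Type*} [NormedAddCommGroup E] [CompleteSpace E] {θ α A : ℝ} (hθ0 : 0 < θ) (hθ1 : θ < 1)
    (hα : 0 < α) (hA : 0 ≤ A) (i : ℕ) (a : ℕ → E)
    (h : ∀ j, ‖a j - a (j + 1)‖ ≤ A * (θ ^ j / 2) ^ i * (θ ^ j / 2) ^ α) :
    ∃ l, Filter.Tendsto a Filter.atTop (nhds l) ∧
      ∀ j, ‖a j - l‖ ≤ A / (1 - θ ^ α) * (θ ^ j / 2) ^ i * (θ ^ j / 2) ^ α := by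
  have hq : θ ^ α < 1 := rpow_lt_one hθ0.le hθ1 hα
  have hq0 : 0 < θ ^ α := by positivity
  set ρ := θ ^ i * θ ^ α with hρ
  have hti : θ ^ i ≤ 1 := pow_le_one₀ hθ0.le hθ1.le
  have hρq : ρ ≤ θ ^ α := by rw [hρ]; nlinarith
  have e : ∀ (B : ℝ) (j : ℕ), B * (θ ^ j / 2) ^ i * (θ ^ j / 2) ^ α = (B * (1 / 2) ^ i * (1 / 2) ^ α) * ρ ^ j := by
    intro B j
    rw [div_eq_mul_one_div (θ ^ j) 2, mul_rpow (by positivity) (by norm_num), ← rpow_natCast θ j, ← rpow_mul hθ0.le, mul_comm (j:ℝ) α,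
      rpow_mul hθ0.le, rpow_natCast, rpow_natCast, hρ, mul_pow, mul_pow, ← pow_mul, ← pow_mul, mul_comm i j]; ring
  have h' : ∀ j, dist (a j) (a (j + 1)) ≤ (A * (1 / 2) ^ i * (1 / 2) ^ α) * ρ ^ j := by
    intro j; rw [dist_eq_norm, ← e]; exact h j
  obtain ⟨l, hl⟩ := cauchySeq_tendsto_of_complete (cauchySeq_of_le_geometric _ _ (lt_of_le_of_lt hρq hq) h')
  refine ⟨l, hl, fun j => ?_⟩
  have := dist_le_of_le_geometric_of_tendsto ρ _ (lt_of_le_of_lt hρq hq) h' hl j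
  rw [dist_eq_norm] at this
  refine this.trans ?_
  rw [e]
  have hρ0 : 0 ≤ ρ := by positivity
  have h1 : 0 < 1 - θ ^ α := by linarith
  calc A * (1 / 2) ^ i * (1 / 2) ^ α * ρ ^ j / (1 - ρ) ≤ A * (1 / 2) ^ i * (1 / 2) ^ α * ρ ^ j / (1 - θ ^ α) := by
        gcongr
    _ = _ := by ring

lemma quad_limit {θ α : ℝ} (hθ0 : 0 < θ) (hθ1 : θ < 1) (hα : 0 < α) : ∃ C : ℝ, 0 < C ∧
    ∀ (u : ℂ → ℝ) (S : ℕ → ℝ) (P : ℕ → ℂ) (τ : ℕ → ℝ) (μ : ℕ → ℂ) (D : ℝ), 0 ≤ D →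
    (∀ j (z : ℂ), ‖z‖ ≤ θ ^ j / 2 → |u z - Qd (S j) (P j) (τ j) (μ j) z| ≤ D * (θ ^ j / 2) ^ (2 + α)) →
    ∃ S' P' τ' μ', Filter.Tendsto S Filter.atTop (nhds S') ∧ Filter.Tendsto P Filter.atTop (nhds P') ∧
      Filter.Tendsto τ Filter.atTop (nhds τ') ∧ Filter.Tendsto μ Filter.atTop (nhds μ') ∧
      ∀ z : ℂ, ‖z‖ ≤ 1 / 2 → |u z - Qd S' P' τ' μ' z| ≤ C * D * ‖z‖ ^ (2 + α) := by
  have hq : θ ^ α < 1 := rpow_lt_one hθ0.le hθ1 hα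
  have h1q : 0 < 1 - θ ^ α := by linarith
  refine ⟨(1 + 5 * (24 / θ ^ 2 / (1 - θ ^ α))) * (1 / θ) ^ (2 + α), by positivity, ?_⟩
  intro u S P τ μ D hD h
  set A := 24 * D / θ ^ 2 with hA
  have hA0 : 0 ≤ A := by rw [hA]; positivity
  have e2 : ∀ x : ℝ, 0 < x → x ^ (2 + α) = x ^ 2 * x ^ α := by
    intro x hx; rw [rpow_add hx, show (2:ℝ) = ((2:ℕ):ℝ) by norm_num, rpow_natCast]
  have key : ∀ j, |S j - S (j + 1)| ≤ A * (θ ^ j / 2) ^ 2 * (θ ^ j / 2) ^ α ∧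
      ‖P j - P (j + 1)‖ ≤ A * (θ ^ j / 2) ^ 1 * (θ ^ j / 2) ^ α ∧
      |τ j - τ (j + 1)| ≤ A * (θ ^ j / 2) ^ 0 * (θ ^ j / 2) ^ α ∧
      ‖μ j - μ (j + 1)‖ ≤ A * (θ ^ j / 2) ^ 0 * (θ ^ j / 2) ^ α := by
    intro j
    set R := θ ^ j / 2 with hR
    have hR0 : 0 < R := by positivity
    have hR' : θ ^ (j + 1) / 2 = θ * R := by rw [hR]; ring
    have hRR : θ * R ≤ R := by nlinarith
    have hx := Qd_coef (S := S j - S (j + 1)) (P := P j - P (j + 1)) (τ := τ j - τ (j + 1)) (μ := μ j - μ (j + 1))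
      (r := θ * R) (M := 2 * D * (R ^ 2 * R ^ α)) (by positivity) (by
        intro z hz
        have h1 := h j z (by linarith)
        have h2 := h (j + 1) z (by rw [hR']; exact hz)
        rw [hR'] at h2
        rw [← hR, e2 R hR0] at h1
        have h3 : D * (θ * R) ^ (2 + α) ≤ D * (R ^ 2 * R ^ α) := by
          rw [← e2 R hR0]; gcongr
        rw [← Qd_sub]
        have e : Qd (S j) (P j) (τ j) (μ j) z - Qd (S (j + 1)) (P (j + 1)) (τ (j + 1)) (μ (j + 1)) z =
          (u z - Qd (S (j + 1)) (P (j + 1)) (τ (j + 1)) (μ (j + 1)) z) - (u z - Qd (S j) (P j) (τ j) (μ j) z) := by ring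
        rw [e]
        refine (abs_sub _ _).trans ?_
        linarith)
    obtain ⟨x1, x2, x3, x4⟩ := hx
    have hθ2 : 0 < θ ^ 2 := by positivity
    have hθ21 : θ ^ 2 ≤ θ := by nlinarith
    have hθ22 : θ ^ 2 ≤ 1 := by nlinarith
    have hDR : 0 ≤ D * R ^ α := by positivity
    refine ⟨x1.trans ?_, x2.trans ?_, x3.trans ?_, x4.trans ?_⟩
    · have : 2 * D * (R ^ 2 * R ^ α) * θ ^ 2 ≤ 24 * D * (R ^ 2 * R ^ α) * 1 := by gcongr; norm_num
      rw [hA, div_mul_eq_mul_div, div_mul_eq_mul_div, le_div_iff₀ hθ2]; linarith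
    · have : 4 * (D * R ^ α * R) * (1 * θ) ≤ 24 * (D * R ^ α * R) * 1 := by gcongr; norm_num; linarith
      rw [hA, div_mul_eq_mul_div, div_mul_eq_mul_div, div_le_div_iff₀ (by positivity) hθ2]
      calc _ = (4 * (D * R ^ α * R) * (1 * θ)) * (θ * R) := by ring
        _ ≤ (24 * (D * R ^ α * R) * 1) * (θ * R) := by gcongr
        _ = _ := by ring
    · calc _ = (16 * D / θ ^ 2) * R ^ α := by field_simp; ring
        _ ≤ A * R ^ 0 * R ^ α := by rw [hA, pow_zero, mul_one]; gcongr; norm_num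
    · refine le_of_eq ?_
      rw [hA]; field_simp; ring
  obtain ⟨S', s1, s2⟩ := geoR hθ0 hθ1 hα hA0 2 S (fun j => (key j).1)
  obtain ⟨P', p1, p2⟩ := geoR hθ0 hθ1 hα hA0 1 P (fun j => (key j).2.1)
  obtain ⟨τ', t1, t2⟩ := geoR hθ0 hθ1 hα hA0 0 τ (fun j => (key j).2.2.1)
  obtain ⟨μ', m1, m2⟩ := geoR hθ0 hθ1 hα hA0 0 μ (fun j => (key j).2.2.2)
  refine ⟨S', P', τ', μ', s1, p1, t1, m1, ?_⟩
  set B := A / (1 - θ ^ α) with hB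
  have hB0 : 0 ≤ B := by positivity
  have hj : ∀ j (z : ℂ), ‖z‖ ≤ θ ^ j / 2 → |u z - Qd S' P' τ' μ' z| ≤ (D + 5 * B) * (θ ^ j / 2) ^ (2 + α) := by
    intro j z hz
    have x1 := h j z hz
    have y1 := s2 j
    have y2 := p2 j
    have y3 := t2 j
    have y4 := m2 j
    set R := θ ^ j / 2 with hR
    have hR0 : 0 < R := by positivity
    rw [Real.norm_eq_abs] at y1 y3
    rw [pow_one] at y2
    rw [pow_zero, mul_one] at y3 y4
    have x2 := Qd_bd (S := S j - S') (P := P j - P') (τ := τ j - τ') (μ := μ j - μ') hz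
    rw [← Qd_sub] at x2
    have z2 : 2 * ‖P j - P'‖ * R ≤ 2 * (B * R * R ^ α) * R := by gcongr
    have z3 : (|τ j - τ'| + ‖μ j - μ'‖) * R ^ 2 ≤ (B * R ^ α + B * R ^ α) * R ^ 2 := by gcongr
    have e : u z - Qd S' P' τ' μ' z = (u z - Qd (S j) (P j) (τ j) (μ j) z) + ((Qd (S j) (P j) (τ j) (μ j) z - Qd S' P' τ' μ' z - (S j - S')) + (S j - S')) := by ring
    rw [e, e2 R hR0]
    rw [e2 R hR0] at x1
    refine (abs_add_le _ _).trans ?_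
    have := abs_add_le (Qd (S j) (P j) (τ j) (μ j) z - Qd S' P' τ' μ' z - (S j - S')) (S j - S')
    calc _ ≤ D * (R ^ 2 * R ^ α) + ((2 * (B * R * R ^ α) * R + (B * R ^ α + B * R ^ α) * R ^ 2) + B * R ^ 2 * R ^ α) := by linarith
      _ = _ := by ring
  intro z hz
  have hBD : B = 24 / θ ^ 2 / (1 - θ ^ α) * D := by rw [hB, hA]; ring
  by_cases hz0 : z = 0
  · subst hz0
    rw [norm_zero, zero_rpow (by linarith), mul_zero]
    refine le_of_forall_pos_le_add (fun ε hε => ?_)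
    have ht : Filter.Tendsto (fun j : ℕ => (D + 5 * B) * (θ ^ j / 2) ^ (2 + α)) Filter.atTop (nhds 0) := by
      have h1 : Filter.Tendsto (fun j : ℕ => θ ^ j / 2) Filter.atTop (nhds 0) := by
        simpa using (tendsto_pow_atTop_nhds_zero_of_lt_one hθ0.le hθ1).div_const 2
      have h2 := h1.rpow_const (p := 2 + α) (Or.inr (by linarith))
      rw [zero_rpow (by linarith)] at h2
      simpa using h2.const_mul (D + 5 * B)
    obtain ⟨j, hjj⟩ := (ht.eventually (gt_mem_nhds hε)).exists
    have := hj j 0 (by rw [norm_zero]; positivity)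
    linarith
  · have hzp : 0 < ‖z‖ := norm_pos_iff.2 hz0
    obtain ⟨j, j1, j2⟩ := exists_nat_pow_near_of_lt_one (x := 2 * ‖z‖) (by positivity) (by linarith) hθ0 hθ1
    refine (hj j z (by linarith)).trans ?_
    have hR : θ ^ j / 2 ≤ (1 / θ) * ‖z‖ := by
      rw [div_mul_eq_mul_div, le_div_iff₀ hθ0]
      rw [pow_succ] at j1; linarith
    calc (D + 5 * B) * (θ ^ j / 2) ^ (2 + α) ≤ (D + 5 * B) * ((1 / θ) * ‖z‖) ^ (2 + α) := by gcongr
      _ = _ := by rw [mul_rpow (by positivity) hzp.le, hBD]; ring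

theorem reg {k α : ℝ} (hk0 : 0 ≤ k) (hk : k < 1) (hα0 : 0 < α) (hα1 : α ≤ 1) (hα : 2 * α < mor k) :
    ∃ δ C : ℝ, 0 < δ ∧ δ ≤ 1 ∧ 0 < C ∧ ∀ (g : ℂ → ℝ → ℂ → ℂ → ℝ) (u : ℂ → ℝ) (N : ℝ), 0 < N →
    Gok k δ δ N α g → |g 0 0 0 0| ≤ N → (∀ z : ℂ, ‖z‖ ≤ 1 → |u z| ≤ N) → Approx g u →
    ∃ S P τ μ, |S| ≤ C * N ∧ ‖P‖ ≤ C * N ∧ |τ| ≤ C * N ∧ ‖μ‖ ≤ C * N ∧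
      (∀ z : ℂ, ‖z‖ ≤ 1 / 2 → |u z - Qd S P τ μ z| ≤ C * N * ‖z‖ ^ (2 + α)) ∧ τ = g 0 S P μ := by
  obtain ⟨θ, δ, M, hθ0, hθ8, hδ0, hδ1, hM, Hs⟩ := reg_step hk0 hk hα0 hα1 hα
  obtain ⟨C1, hC1, Hb⟩ := reg_base hk0 hk hα0 hα1
  have hθ1 : θ < 1 := by linarith
  obtain ⟨C2, hC2, Hl⟩ := quad_limit hθ0 hθ1 hα0
  set C3 := C1 + 1 / δ with hC3
  have hC30 : 0 < C3 := by rw [hC3]; positivity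
  refine ⟨δ, C3 * M + C2 * (3 * C3), hδ0, hδ1, by positivity, ?_⟩
  intro g u N hN hg hg0 hu hA
  set X := C3 * N with hX
  have hX0 : 0 < X := by positivity
  have hX1 : C1 * N ≤ X := by rw [hX, hC3]; gcongr; have : 0 < 1 / δ := by positivity
                              linarith
  have hX2 : N ≤ δ * X := by
    rw [hX, hC3]
    have : δ * ((C1 + 1 / δ) * N) = δ * C1 * N + N := by field_simp
    rw [this]; have : 0 < δ * C1 * N := by positivity
    linarith
  have hj : ∀ j : ℕ, ∃ S P τ μ, |S| ≤ X * M ∧ ‖P‖ ≤ X * M ∧ |τ| ≤ X * M ∧ ‖μ‖ ≤ X * M ∧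
      (∀ z : ℂ, ‖z‖ ≤ θ ^ j / 2 → |u z - Qd S P τ μ z| ≤ (3 * X) * (θ ^ j / 2) ^ (2 + α)) ∧
      |τ - g 0 S P μ| ≤ M * X * (θ ^ j / 2) ^ α := by
    intro j
    set R := θ ^ j / 2 with hR
    have hR0 : 0 < R := by positivity
    set ε := min (δ * (R * (X * R ^ α)) ^ 2) (min (N ^ 2) (min N (X * R ^ (2 + α)))) with hε
    have hε0 : 0 < ε := by rw [hε]; positivity
    have ε1 : ε ≤ δ * (R * (X * R ^ α)) ^ 2 := min_le_left _ _
    have ε2 : ε ≤ N ^ 2 := (min_le_right _ _).trans (min_le_left _ _)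
    have ε3 : ε ≤ N := (min_le_right _ _).trans ((min_le_right _ _).trans (min_le_left _ _))
    have ε4 : ε ≤ X * R ^ (2 + α) := (min_le_right _ _).trans ((min_le_right _ _).trans (min_le_right _ _))
    obtain ⟨w, hw, hw1, hw2⟩ := hA ε hε0
    have hi : ∀ i : ℕ, i ≤ j → ∃ S P τ μ, Good w α M X (θ ^ i / 2) S P τ μ := by
      intro i
      induction i with
      | zero =>
        intro _
        refine ⟨0, 0, 0, 0, ?_⟩
        rw [pow_zero]
        refine Hb g δ δ N M hδ0.le hδ1 hN hM.le hg hg0 w hw ?_ (hw1.trans ε2) X hX1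
        intro z hz
        have h1 := hw2 z hz
        have h2 := hu z hz
        have : w z = (w z - u z) + u z := by ring
        rw [this]; refine (abs_add_le _ _).trans ?_; linarith
      | succ i ih =>
        intro hij
        obtain ⟨S, P, τ, μ, h⟩ := ih (by omega)
        have hRi : R ≤ θ ^ i / 2 := by
          rw [hR]; have := pow_le_pow_of_le_one hθ0.le hθ1.le (show i ≤ j by omega); linarith
        have h1 := (Hs g N X hg hX0 hN.le hX2 w hw (θ ^ i / 2) (by positivity)
          (by have := pow_le_one₀ (n := i) hθ0.le hθ1.le; linarith)
          (hw1.trans (ε1.trans (by gcongr))) S P τ μ h).2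
        rw [show θ ^ (i + 1) / 2 = θ * (θ ^ i / 2) by ring]
        exact h1
    obtain ⟨S, P, τ, μ, h⟩ := hi j le_rfl
    rw [← hR] at h
    have hR2 : R ≤ 1 / 2 := by have := pow_le_one₀ (n := j) hθ0.le hθ1.le; rw [hR]; linarith
    have h1 := (Hs g N X hg hX0 hN.le hX2 w hw R hR0 hR2 (hw1.trans ε1) S P τ μ h).1
    have hXM : X * M * (1 - R ^ α) ≤ X * M := by
      have : 0 ≤ X * M * R ^ α := by positivity
      linarith
    refine ⟨S, P, τ, μ, h.cS.trans hXM, h.cP.trans hXM, h.cτ.trans hXM, h.cμ.trans hXM, ?_, h1⟩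
    intro z hz
    have h2 := h.sup z hz
    have h3 := hw2 z (by linarith)
    have e : u z - Qd S P τ μ z = (w z - Qd S P τ μ z) - (w z - u z) := by ring
    rw [e]; refine (abs_sub _ _).trans ?_
    linarith
  choose S P τ μ c1 c2 c3 c4 c5 c6 using hj
  obtain ⟨S', P', τ', μ', t1, t2, t3, t4, t5⟩ := Hl u S P τ μ (3 * X) (by positivity) c5
  have hle : X * M ≤ (C3 * M + C2 * (3 * C3)) * N := by
    have : 0 ≤ C2 * (3 * C3) * N := by positivity
    rw [hX]; linarith
  refine ⟨S', P', τ', μ', (le_of_tendsto t1.abs (Filter.Eventually.of_forall c1)).trans hle,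
    (le_of_tendsto t2.norm (Filter.Eventually.of_forall c2)).trans hle,
    (le_of_tendsto t3.abs (Filter.Eventually.of_forall c3)).trans hle,
    (le_of_tendsto t4.norm (Filter.Eventually.of_forall c4)).trans hle, ?_, ?_⟩
  · intro z hz
    refine (t5 z hz).trans ?_
    have : C2 * (3 * X) ≤ (C3 * M + C2 * (3 * C3)) * N := by
      have : 0 ≤ C3 * M * N := by positivity
      rw [hX]; linarith
    gcongr
  · have hlim : Filter.Tendsto (fun j => |τ j - g 0 (S j) (P j) (μ j)|) Filter.atTop (nhds 0) := by
      refine squeeze_zero (fun _ => abs_nonneg _) c6 ?_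
      have h1 : Filter.Tendsto (fun j : ℕ => θ ^ j / 2) Filter.atTop (nhds 0) := by
        simpa using (tendsto_pow_atTop_nhds_zero_of_lt_one hθ0.le hθ1).div_const 2
      have h2 := h1.rpow_const (p := α) (Or.inr hα0.le)
      rw [zero_rpow hα0.ne'] at h2
      simpa using h2.const_mul (M * X)
    have hgl : Filter.Tendsto (fun j => |g 0 (S j) (P j) (μ j) - g 0 S' P' μ'|) Filter.atTop (nhds 0) := by
      refine squeeze_zero (fun _ => abs_nonneg _) (fun j => hg.lip 0 (S j) S' (P j) P' (μ j) μ') ?_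
      have a1 := (t4.sub_const μ').norm.const_mul k
      have a2 := (((t2.sub_const P').norm).add (t1.sub_const S').abs).const_mul δ
      simpa using a1.add a2
    have hf := ((t3.sub_const τ').abs.add hlim).add hgl
    simp only [sub_self, abs_zero, add_zero] at hf
    have : |τ' - g 0 S' P' μ'| ≤ 0 := by
      refine ge_of_tendsto' hf (fun j => ?_)
      have := abs_sub_le τ' (τ j) (g 0 S' P' μ')
      have h2 := abs_sub_le (τ j) (g 0 (S j) (P j) (μ j)) (g 0 S' P' μ')
      rw [abs_sub_comm τ' (τ j)] at this
      linarith
    have := abs_nonpos_iff.1 this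
    linarith

/-- Real parts of monomials in `z` and its conjugate. -/
def Rm (c : ℂ) (m n : ℕ) : ℂ → ℝ := fun z => (c * (z ^ m * (starRingEnd ℂ z) ^ n)).re

lemma Rm_sm (c : ℂ) (m n : ℕ) : Sm (Rm c m n) := by
  unfold Sm Rm
  have h1 : ContDiff ℝ ∞ (fun z : ℂ => starRingEnd ℂ z) := Complex.conjCLE.contDiff
  exact Complex.reCLM.contDiff.comp (contDiff_const.mul ((contDiff_id.pow m).mul (h1.pow n)))

lemma Rm_dd (c : ℂ) (m n : ℕ) (v : ℂ) : dd v (Rm c m n) =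
    fun z => Rm (c * m * v) (m - 1) n z + Rm (c * n * starRingEnd ℂ v) m (n - 1) z := by
  funext z
  have h0 : HasFDerivAt (fun z : ℂ => starRingEnd ℂ z) (Complex.conjCLE : ℂ →L[ℝ] ℂ) z :=
    Complex.conjCLE.hasFDerivAt
  have h1 := ((hasFDerivAt_id (𝕜 := ℝ) z).pow m).mul (h0.pow n)
  have h2 := Complex.reCLM.hasFDerivAt.comp z (h1.const_mul c)
  have h3 : HasFDerivAt (Rm c m n) _ z := h2
  simp only [dd]
  rw [h3.fderiv]
  simp [Rm]
  ring

lemma Rm_addc (c d : ℂ) (m n : ℕ) (z : ℂ) : Rm (c + d) m n z = Rm c m n z + Rm d m n z := by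
  simp only [Rm, add_mul, Complex.add_re]

lemma Rm_La (c : ℂ) (m n : ℕ) : La (Rm c m n) = Rm (4 * m * n * c) (m - 1) (n - 1) := by
  funext z
  simp only [La, dx, dy, Rm_dd]
  rw [dd_add (Rm_sm _ _ _) (Rm_sm _ _ _), dd_add (Rm_sm _ _ _) (Rm_sm _ _ _)]
  simp only [Rm_dd]
  have hI : Complex.I * Complex.I = -1 := Complex.I_mul_I
  simp only [Rm, ← Complex.add_re]
  congr 1
  simp only [map_one, Complex.conj_I]
  linear_combination (c * m * ((m-1 : ℕ):ℂ) * (z ^ (m-1-1) * (starRingEnd ℂ z) ^ n) 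
    + c * n * ((n-1:ℕ):ℂ) * (z ^ m * (starRingEnd ℂ z) ^ (n - 1 - 1)) - 2 * c * m * n * (z ^ (m-1) * (starRingEnd ℂ z) ^ (n - 1))) * hI

lemma Rm_sol (c : ℂ) (a b : ℕ) : ∃ Ψ : ℂ → ℝ, Sm Ψ ∧ (∀ z : ℂ, ‖z‖ = 1 → Ψ z = 0) ∧
    La Ψ = Rm c a b := by
  have ha : ((a:ℂ) + 1) ≠ 0 := by exact_mod_cast Nat.succ_ne_zero a
  have hb : ((b:ℂ) + 1) ≠ 0 := by exact_mod_cast Nat.succ_ne_zero b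
  set d : ℂ := c / (4 * (a + 1) * (b + 1)) with hd
  refine ⟨fun z => Rm d (a+1) (b+1) z - Rm d (a - b) (b - a) z, (Rm_sm _ _ _).sub (Rm_sm _ _ _), ?_, ?_⟩
  · intro z hz
    have hzz : z * starRingEnd ℂ z = 1 := by
      rw [Complex.mul_conj, Complex.normSq_eq_norm_sq, hz]; simp
    have key : z ^ (a+1) * (starRingEnd ℂ z) ^ (b+1) = z ^ (a - b) * (starRingEnd ℂ z) ^ (b - a) := by
      rcases le_total a b with h | h
      · obtain ⟨e, rfl⟩ := Nat.exists_eq_add_of_le h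
        rw [show a - (a + e) = 0 by omega, show a + e - a = e by omega,
          show a + e + 1 = (a + 1) + e by omega, pow_add _ (a+1) e, ← mul_assoc, ← mul_pow, hzz]; simp
      · obtain ⟨e, rfl⟩ := Nat.exists_eq_add_of_le h
        rw [show b - (b + e) = 0 by omega, show b + e - b = e by omega,
          show b + e + 1 = e + (b + 1) by omega, pow_add _ e (b+1), mul_assoc, ← mul_pow, hzz]; simp
    simp only [Rm, key, sub_self]
  · rw [La_sub (Rm_sm _ _ _) (Rm_sm _ _ _), Rm_La, Rm_La]
    funext z
    have h0 : ((a - b : ℕ) : ℂ) * ((b - a : ℕ) : ℂ) = 0 := by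
      rcases le_total a b with h | h
      · simp [Nat.sub_eq_zero_of_le h]
      · simp [Nat.sub_eq_zero_of_le h]
    have e1 : 4 * ((a - b : ℕ) : ℂ) * ((b - a : ℕ) : ℂ) * d = 0 := by
      linear_combination 4 * d * h0
    have e2 : 4 * ((a + 1 : ℕ) : ℂ) * ((b + 1 : ℕ) : ℂ) * d = c := by
      rw [hd]; push_cast; field_simp
    rw [e1, e2]; simp [Rm]

lemma poly_sol (p : MvPolynomial (Fin 2) ℂ) : ∃ Ψ : ℂ → ℝ, Sm Ψ ∧ (∀ z : ℂ, ‖z‖ = 1 → Ψ z = 0) ∧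
    La Ψ = fun z => (MvPolynomial.eval ![z, starRingEnd ℂ z] p).re := by
  induction p using MvPolynomial.induction_on' with
  | monomial s c =>
    obtain ⟨Ψ, h1, h2, h3⟩ := Rm_sol c (s 0) (s 1)
    refine ⟨Ψ, h1, h2, ?_⟩
    rw [h3]; funext z
    rw [MvPolynomial.eval_monomial, Finsupp.prod_fintype _ _ (by simp)]
    simp [Rm]
  | add p q hp hq =>
    obtain ⟨Ψ, h1, h2, h3⟩ := hp
    obtain ⟨Φ, g1, g2, g3⟩ := hq
    refine ⟨fun z => Ψ z + Φ z, h1.add g1, fun z hz => by simp [h2 z hz, g2 z hz], ?_⟩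
    rw [La_add h1 g1, h3, g3]; funext z; simp

lemma poly_sm (p : MvPolynomial (Fin 2) ℂ) :
    Sm (fun z => (MvPolynomial.eval ![z, starRingEnd ℂ z] p).re) := by
  obtain ⟨Ψ, h1, -, h3⟩ := poly_sol p
  rw [← h3]; exact h1.La

lemma poly_star (p : MvPolynomial (Fin 2) ℂ) : ∃ q : MvPolynomial (Fin 2) ℂ, ∀ z : ℂ,
    MvPolynomial.eval ![z, starRingEnd ℂ z] q = starRingEnd ℂ (MvPolynomial.eval ![z, starRingEnd ℂ z] p) := by
  induction p using MvPolynomial.induction_on with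
  | C a => exact ⟨MvPolynomial.C (starRingEnd ℂ a), fun z => by simp⟩
  | add p q hp hq =>
    obtain ⟨a, ha⟩ := hp
    obtain ⟨b, hb⟩ := hq
    exact ⟨a + b, fun z => by simp [ha, hb]⟩
  | mul_X p i hp =>
    obtain ⟨a, ha⟩ := hp
    fin_cases i
    · exact ⟨a * MvPolynomial.X 1, fun z => by simp [ha]⟩
    · exact ⟨a * MvPolynomial.X 0, fun z => by simp [ha]⟩

lemma poly_approx {h : ℂ → ℝ} (hh : ContinuousOn h (closedBall 0 1)) {τ : ℝ} (hτ : 0 < τ) :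
    ∃ p : MvPolynomial (Fin 2) ℂ, ∀ z : ℂ, ‖z‖ ≤ 1 →
      |(MvPolynomial.eval ![z, starRingEnd ℂ z] p).re - h z| ≤ τ := by
  haveI : CompactSpace (closedBall (0:ℂ) 1) := isCompact_iff_compactSpace.mp (isCompact_closedBall _ _)
  have htop := polynomialFunctions.starClosure_topologicalClosure (𝕜 := ℂ) (closedBall (0:ℂ) 1)
  let H : C(closedBall (0:ℂ) 1, ℂ) := ⟨fun z => (h z : ℂ), by
    exact Complex.continuous_ofReal.comp (continuousOn_iff_continuous_domRestrict.mp hh)⟩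
  have hmem : H ∈ (polynomialFunctions (closedBall (0:ℂ) 1)).starClosure.topologicalClosure := by
    rw [htop]; trivial
  have hmem' : H ∈ closure ((polynomialFunctions (closedBall (0:ℂ) 1)).starClosure : Set C(closedBall (0:ℂ) 1, ℂ)) := hmem
  obtain ⟨G, hG, hd⟩ := Metric.mem_closure_iff.mp hmem' τ hτ
  have hrep : ∃ p : MvPolynomial (Fin 2) ℂ, ∀ z : closedBall (0:ℂ) 1,
      MvPolynomial.eval ![(z:ℂ), starRingEnd ℂ (z:ℂ)] p = G z := by
    have hG' : G ∈ (polynomialFunctions (closedBall (0:ℂ) 1)).starClosure := hG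
    rw [polynomialFunctions.starClosure_eq_adjoin_X] at hG'
    clear hd hG
    induction hG' using StarAlgebra.adjoin_induction with
    | mem x hx => 
      rw [Set.mem_singleton_iff] at hx
      subst hx
      exact ⟨MvPolynomial.X 0, fun z => by simp⟩
    | algebraMap r => exact ⟨MvPolynomial.C r, fun z => by simp⟩
    | add x y _ _ hx hy =>
      obtain ⟨a, ha⟩ := hx
      obtain ⟨b, hb⟩ := hy
      exact ⟨a + b, fun z => by simp [ha, hb]⟩
    | mul x y _ _ hx hy =>
      obtain ⟨a, ha⟩ := hx
      obtain ⟨b, hb⟩ := hy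
      exact ⟨a * b, fun z => by simp [ha, hb]⟩
    | star x _ hx =>
      obtain ⟨a, ha⟩ := hx
      obtain ⟨b, hb⟩ := poly_star a
      exact ⟨b, fun z => by rw [hb, ha]; rfl⟩
  obtain ⟨p, hp⟩ := hrep
  refine ⟨p, fun z hz => ?_⟩
  have hz' : z ∈ closedBall (0:ℂ) 1 := by simpa using hz
  have h1 := hp ⟨z, hz'⟩
  have h2 : dist (H ⟨z, hz'⟩) (G ⟨z, hz'⟩) ≤ τ := (ContinuousMap.dist_apply_le_dist _).trans hd.le
  rw [dist_comm, dist_eq_norm, ← h1] at h2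
  have h3 := (Complex.abs_re_le_norm _).trans h2
  simpa [H] using h3

lemma poisson {h : ℂ → ℝ} (hh : Continuous h) {τ : ℝ} (hτ : 0 < τ) :
    ∃ ψ : ℂ → ℝ, Sm ψ ∧ (∀ z : ℂ, ‖z‖ = 1 → ψ z = 0) ∧ ∀ z : ℂ, ‖z‖ ≤ 1 → |La ψ z - h z| ≤ τ := by
  obtain ⟨p, hp⟩ := poly_approx (hh.continuousOn (s := closedBall 0 1)) hτ
  obtain ⟨Ψ, h1, h2, h3⟩ := poly_sol p
  exact ⟨Ψ, h1, h2, by rw [h3]; exact hp⟩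

lemma sm_approx {u : ℂ → ℝ} (hu : ContinuousOn u (closedBall 0 1)) {τ : ℝ} (hτ : 0 < τ) :
    ∃ φ : ℂ → ℝ, Sm φ ∧ ∀ z : ℂ, ‖z‖ ≤ 1 → |φ z - u z| ≤ τ := by
  obtain ⟨p, hp⟩ := poly_approx hu hτ
  exact ⟨_, poly_sm p, hp⟩

lemma dot_le (P x : ℂ) : |P.re * x.re + P.im * x.im| ≤ ‖P‖ * ‖x‖ := by
  have h : P.re * x.re + P.im * x.im = (P * starRingEnd ℂ x).re := by simp
  rw [h]
  refine (Complex.abs_re_le_norm _).trans ?_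
  simp

lemma aff_circle {S M : ℝ} {P : ℂ} (h : ∀ x : ℂ, ‖x‖ = 1 → |S + P.re * x.re + P.im * x.im| ≤ M) :
    |S| + ‖P‖ ≤ M := by
  by_cases hP : P = 0
  · have := h 1 (by simp)
    simpa [hP] using this
  have hn : 0 < ‖P‖ := norm_pos_iff.mpr hP
  have hsq : P.re * P.re + P.im * P.im = ‖P‖ * ‖P‖ := by
    rw [← sq ‖P‖, ← Complex.normSq_eq_norm_sq, Complex.normSq_apply]
  have key : ∀ e : ℝ, |e| = 1 → |S + e * ‖P‖| ≤ M := by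
    intro e he
    have h1 := h ((e / ‖P‖ : ℝ) * P) (by
      rw [norm_mul, Complex.norm_real, Real.norm_eq_abs, abs_div, he, abs_norm]; field_simp)
    have e1 : S + P.re * (((e / ‖P‖ : ℝ) : ℂ) * P).re + P.im * (((e / ‖P‖ : ℝ) : ℂ) * P).im = S + e * ‖P‖ := by
      rw [Complex.re_ofReal_mul, Complex.im_ofReal_mul]
      have : e / ‖P‖ * (P.re * P.re + P.im * P.im) = e * ‖P‖ := by rw [hsq]; field_simp
      linarith
    rwa [e1] at h1
  have h1 := key 1 (by simp)
  have h2 := key (-1) (by simp)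
  rw [abs_le] at h1 h2
  rcases abs_cases S with ⟨h, _⟩ | ⟨h, _⟩ <;> rw [h] <;> linarith [h1.1, h1.2, h2.1, h2.2]

section zb
variable {ψ : ℂ → ℝ} (hψ : Sm ψ) (h0 : ∀ z : ℂ, ‖z‖ = 1 → ψ z = 0)
include hψ h0

lemma zb_sup (x : ℂ) (hx : ‖x‖ ≤ 1) : ψ x ^ 2 ≤ 24 * Ib 1 (fun z => La ψ z ^ 2) := by
  have hMT := MT2 hψ h0
  obtain ⟨a1, a2, a3, a4, a5, a6, a7, a8, a9, a10, a11⟩ := sm_all hψ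
  have hn2 : Ib 1 (hn ψ) ≤ 2 * Ib 1 (fun z => La ψ z ^ 2) := by
    have : Ib 1 (hn ψ) = Ib 1 (fun z => La ψ z ^ 2) + Ib 1 (fun z => ‖mm ψ z‖ ^ 2) := by
      rw [← Ib_add (by fun_prop) (by fun_prop)]
      exact Ib_congr (fun z _ => hn_eq _ _)
    linarith
  set L := Ib 1 (fun z => La ψ z ^ 2) with hL
  have hL0 : 0 ≤ L := Ib_nonneg (fun z _ => by positivity)
  obtain ⟨S, P, hSP⟩ := sob hψ
  set M := √(6 * L) with hM
  have hM2 : M ^ 2 = 6 * L := Real.sq_sqrt (by positivity)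
  have hb : ∀ x : ℂ, ‖x‖ ≤ 1 → |ψ x - (S + P.re * x.re + P.im * x.im)| ≤ M := fun x hx =>
    Real.abs_le_sqrt (by have := hSP x hx; linarith)
  have hc : |S| + ‖P‖ ≤ M := aff_circle (fun x hx => by
    have := hb x hx.le
    rw [h0 x hx] at this
    rwa [zero_sub, abs_neg] at this)
  have h1 := hb x hx
  have h2 := dot_le P x
  have h3 : ‖P‖ * ‖x‖ ≤ ‖P‖ := mul_le_of_le_one_right (norm_nonneg _) hx
  have h4 : |ψ x| ≤ 2 * M := by
    have h5 := le_abs_self S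
    have h6 := neg_abs_le S
    rw [abs_le] at h1 h2 ⊢
    constructor <;> linarith [h1.1, h1.2, h2.1, h2.2]
  have h7 : ψ x ^ 2 ≤ (2 * M) ^ 2 := sq_le_sq' (by linarith [neg_abs_le (ψ x)]) (by linarith [le_abs_self (ψ x)])
  nlinarith

lemma zb_int : Ib 1 (fun z => (‖gr ψ z‖ + |ψ z|) ^ 2) ≤ 240 * Ib 1 (fun z => La ψ z ^ 2) := by
  obtain ⟨a1, a2, a3, a4, a5, a6, a7, a8, a9, a10, a11⟩ := sm_all hψ
  set L := Ib 1 (fun z => La ψ z ^ 2) with hL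
  have hL0 : 0 ≤ L := Ib_nonneg (fun z _ => by positivity)
  have h1 : Ib 1 (fun z => ψ z ^ 2) ≤ Ib 1 (fun _ => 24 * L) :=
    Ib_mono (by fun_prop) (by fun_prop) (fun z hz => zb_sup hψ h0 z hz)
  rw [Ib_const (by norm_num)] at h1
  have h2 := grad_zero hψ h0
  have h3 : Ib 1 (fun z => (‖gr ψ z‖ + |ψ z|) ^ 2) ≤ Ib 1 (fun z => 2 * ‖gr ψ z‖ ^ 2 + 2 * ψ z ^ 2) :=
    Ib_mono (by fun_prop) (by fun_prop) (fun z _ => by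
      rw [← sq_abs (ψ z)]; nlinarith [sq_nonneg (‖gr ψ z‖ - |ψ z|)])
  rw [Ib_add (by fun_prop) (by fun_prop), Ib_mul, Ib_mul] at h3
  have hpi := pi_lt_d2
  have h4 : π * 1 ^ 2 * (24 * L) ≤ 3.15 * (24 * L) := by nlinarith
  linarith

lemma zb_A {k β : ℝ} (hk0 : 0 ≤ k) (hk : k < 1) (hβ0 : 0 ≤ β) (hβ : β ≤ (1 - k) / 40) :
    Ib 1 (fun z => (k * ‖mm ψ z‖ + β * (‖gr ψ z‖ + |ψ z|)) ^ 2) ≤ (1 - 3 * ((1 - k) / 4)) * Ib 1 (fun z => La ψ z ^ 2) := by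
  obtain ⟨a1, a2, a3, a4, a5, a6, a7, a8, a9, a10, a11⟩ := sm_all hψ
  have hd : 0 < 1 - k := by linarith
  have h1 := MT2 hψ h0
  have h2 := zb_int hψ h0
  set L := Ib 1 (fun z => La ψ z ^ 2) with hL
  have hL0 : 0 ≤ L := Ib_nonneg (fun z _ => by positivity)
  have hpt : ∀ m y : ℝ, (k * m + β * y) ^ 2 ≤ k * m ^ 2 + (1 - k) / 1600 * y ^ 2 := by
    intro m y
    have e1 : (k * m + β * y) ^ 2 ≤ k * m ^ 2 + β ^ 2 / (1 - k) * y ^ 2 := by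
      have : k * m ^ 2 + β ^ 2 / (1 - k) * y ^ 2 - (k * m + β * y) ^ 2 = k / (1 - k) * ((1 - k) * m - β * y) ^ 2 := by
        field_simp; ring
      have : 0 ≤ k / (1 - k) * ((1 - k) * m - β * y) ^ 2 := by positivity
      linarith
    have e2 : β ^ 2 / (1 - k) ≤ (1 - k) / 1600 := by
      rw [div_le_iff₀ hd]; nlinarith
    nlinarith [sq_nonneg y]
  have h3 : Ib 1 (fun z => (k * ‖mm ψ z‖ + β * (‖gr ψ z‖ + |ψ z|)) ^ 2) ≤
      Ib 1 (fun z => k * ‖mm ψ z‖ ^ 2 + (1 - k) / 1600 * (‖gr ψ z‖ + |ψ z|) ^ 2) :=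
    Ib_mono (by fun_prop) (by fun_prop) (fun z _ => hpt _ _)
  rw [Ib_add (by fun_prop) (by fun_prop), Ib_mul, Ib_mul] at h3
  have h4 := mul_le_mul_of_nonneg_left h1 hk0
  have h5 := mul_le_mul_of_nonneg_left h2 (by positivity : 0 ≤ (1 - k) / 1600)
  nlinarith
end zb

lemma sq_wt {d a b : ℝ} (hd : 0 < d) : (a + b) ^ 2 ≤ (1 + 1 / d) * a ^ 2 + (1 + d) * b ^ 2 := by
  have : (1 + 1 / d) * a ^ 2 + (1 + d) * b ^ 2 - (a + b) ^ 2 = 1 / d * (a - d * b) ^ 2 := by field_simp; ring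
  have : 0 ≤ 1 / d * (a - d * b) ^ 2 := by positivity
  linarith

lemma res_add {k β K N α : ℝ} {g : ℂ → ℝ → ℂ → ℂ → ℝ} (hg : Gok k β K N α g) {w ψ : ℂ → ℝ}
    (hw : Sm w) (hψ : Sm ψ) (z : ℂ) :
    |res g (fun z => w z + ψ z) z - res g w z - La ψ z| ≤ k * ‖mm ψ z‖ + β * (‖gr ψ z‖ + |ψ z|) := by
  unfold res
  rw [La_add hw hψ, gr_add hw hψ, mm_add hw hψ]
  have := hg.lip z (w z) (w z + ψ z) (gr w z) (gr w z + gr ψ z) (mm w z) (mm w z + mm ψ z)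
  simp only [sub_add_cancel_left, norm_neg, abs_neg] at this
  have e : La w z + La ψ z - g z (w z + ψ z) (gr w z + gr ψ z) (mm w z + mm ψ z) - (La w z - g z (w z) (gr w z) (mm w z)) - La ψ z
    = g z (w z) (gr w z) (mm w z) - g z (w z + ψ z) (gr w z + gr ψ z) (mm w z + mm ψ z) := by ring
  rw [e]; exact this

lemma abs_sq_le {a b : ℝ} (h : |a| ≤ b) : a ^ 2 ≤ b ^ 2 := by
  rw [← sq_abs a]; exact pow_le_pow_left₀ (abs_nonneg _) h 2

section ex
variable {k β K N α : ℝ} (hk0 : 0 ≤ k) (hk : k < 1) (hβ0 : 0 ≤ β) (hβ : β ≤ (1 - k) / 40)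
  {g : ℂ → ℝ → ℂ → ℂ → ℝ} (hg : Gok k β K N α g) (hα : 0 < α)
include hk0 hk hβ0 hβ hg hα

lemma correct {w : ℂ → ℝ} (hw : Sm w) {ε : ℝ} (hε : 0 < ε) : ∃ w', Sm w' ∧ (∀ z : ℂ, ‖z‖ = 1 → w' z = w z) ∧
    Ib 1 (fun z => res g w' z ^ 2) ≤ (1 - (1 - k) / 4) * Ib 1 (fun z => res g w z ^ 2) + ε := by
  set d := (1 - k) / 4 with hd
  have hd0 : 0 < d := by rw [hd]; linarith
  have hd1 : d ≤ 1 / 4 := by rw [hd]; linarith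
  have hrc := res_cont hg hα hw
  set c := (1 + 1 / d) * π * 3 with hc
  have hc0 : 0 < c := by positivity
  set τ := √(ε / c) with hτ
  have hτ0 : 0 < τ := Real.sqrt_pos.mpr (by positivity)
  have hτ2 : τ ^ 2 = ε / c := Real.sq_sqrt (by positivity)
  obtain ⟨ψ, hψ, h0, hL⟩ := poisson (h := fun z => - res g w z) hrc.neg hτ0
  obtain ⟨a1, a2, a3, a4, a5, a6, a7, a8, a9, a10, a11⟩ := sm_all hψ
  have hw' := hw.add hψ
  have hrc' := res_cont hg hα hw'
  refine ⟨_, hw', fun z hz => by simp [h0 z hz], ?_⟩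
  set R := Ib 1 (fun z => res g w z ^ 2) with hR
  have hR0 : 0 ≤ R := Ib_nonneg (fun z _ => by positivity)
  have hA := zb_A hψ h0 hk0 hk hβ0 hβ
  rw [← hd] at hA
  set A : ℂ → ℝ := fun z => k * ‖mm ψ z‖ + β * (‖gr ψ z‖ + |ψ z|) with hAd
  have hAc : Continuous A := by fun_prop
  have hA0 : ∀ z, 0 ≤ A z := fun z => by positivity
  have h1 : Ib 1 (fun z => La ψ z ^ 2) ≤ Ib 1 (fun z => (1 + 1 / d) * τ ^ 2 + (1 + d) * res g w z ^ 2) :=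
    Ib_mono (by fun_prop) (by fun_prop) (fun z hz => by
      have e : La ψ z ^ 2 = ((La ψ z - - res g w z) + (- res g w z)) ^ 2 := by ring
      rw [e]
      refine (sq_wt hd0).trans ?_
      have := abs_sq_le (hL z hz)
      rw [neg_sq (res g w z)]
      gcongr)
  have h2 : Ib 1 (fun z => res g (fun z => w z + ψ z) z ^ 2) ≤ Ib 1 (fun z => (1 + 1 / d) * τ ^ 2 + (1 + d) * A z ^ 2) :=
    Ib_mono (by fun_prop) (by fun_prop) (fun z hz => by
      have e : res g (fun z => w z + ψ z) z ^ 2 = ((La ψ z - - res g w z) + (res g (fun z => w z + ψ z) z - res g w z - La ψ z)) ^ 2 := by ring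
      rw [e]
      refine (sq_wt hd0).trans ?_
      have := abs_sq_le (hL z hz)
      have := abs_sq_le (res_add hg hw hψ z)
      gcongr)
  rw [Ib_add (by fun_prop) (by fun_prop), Ib_mul _ (1 + d), Ib_const (by norm_num)] at h1 h2
  have hεc : (1 + 1 / d) * π * 3 * τ ^ 2 = ε := by rw [hτ2, ← hc]; field_simp
  set T := π * 1 ^ 2 * ((1 + 1 / d) * τ ^ 2) with hT
  have hT3 : 3 * T = ε := by rw [hT, ← hεc]; ring
  have hT0 : 0 ≤ T := by positivity
  have h4 : (1 + d) * Ib 1 (fun z => A z ^ 2) ≤ (1 + d) * ((1 - 3 * d) * (T + (1 + d) * R)) := by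
    have h13 : 0 ≤ 1 - 3 * d := by linarith
    have := mul_le_mul_of_nonneg_left h1 h13
    exact mul_le_mul_of_nonneg_left (hA.trans this) (by linarith)
  have h5 : (1 + d) * ((1 - 3 * d) * (T + (1 + d) * R)) ≤ 2 * T + (1 - d) * R := by
    have e1 : (1 + d) * (1 - 3 * d) ≤ 1 := by nlinarith
    have e2 : (1 + d) * (1 - 3 * d) * (1 + d) ≤ 1 - d := by nlinarith [sq_nonneg d, mul_nonneg hd0.le (sq_nonneg d)]
    have := mul_le_mul_of_nonneg_right e1 hT0
    have := mul_le_mul_of_nonneg_right e2 hR0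
    linarith
  linarith

lemma cauchy_est {w w' : ℂ → ℝ} (hw : Sm w) (hw' : Sm w') (hb : ∀ z : ℂ, ‖z‖ = 1 → w' z = w z) {ε : ℝ}
    (h1 : Ib 1 (fun z => res g w z ^ 2) ≤ ε) (h2 : Ib 1 (fun z => res g w' z ^ 2) ≤ ε) (x : ℂ) (hx : ‖x‖ ≤ 1) :
    (w' x - w x) ^ 2 ≤ 400 / ((1 - k) / 4) ^ 2 * ε := by
  set d := (1 - k) / 4 with hd
  have hd0 : 0 < d := by rw [hd]; linarith
  have hd1 : d ≤ 1 / 4 := by rw [hd]; linarith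
  have hrc := res_cont hg hα hw
  have hrc' := res_cont hg hα hw'
  have hψ := hw'.sub hw
  have h0 : ∀ z : ℂ, ‖z‖ = 1 → (fun z => w' z - w z) z = 0 := fun z hz => by simp [hb z hz]
  set ψ := fun z => w' z - w z with hψd
  have hww : (fun z => w z + ψ z) = w' := by funext z; simp [hψd]
  have hS := zb_sup hψ h0 x hx
  have hA := zb_A hψ h0 hk0 hk hβ0 hβ
  have hra : ∀ z, |res g w' z - res g w z - La ψ z| ≤ k * ‖mm ψ z‖ + β * (‖gr ψ z‖ + |ψ z|) := by
    intro z
    have := res_add hg hw hψ z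
    rwa [hww] at this
  obtain ⟨a1, a2, a3, a4, a5, a6, a7, a8, a9, a10, a11⟩ := sm_all hψ
  rw [← hd] at hA
  set A : ℂ → ℝ := fun z => k * ‖mm ψ z‖ + β * (‖gr ψ z‖ + |ψ z|) with hAd
  have hAc : Continuous A := by fun_prop
  set L := Ib 1 (fun z => La ψ z ^ 2) with hL
  have hL0 : 0 ≤ L := Ib_nonneg (fun z _ => by positivity)
  have h3 : L ≤ Ib 1 (fun z => (1 + 1 / d) * (2 * res g w' z ^ 2 + 2 * res g w z ^ 2) + (1 + d) * A z ^ 2) :=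
    Ib_mono (by fun_prop) (by fun_prop) (fun z hz => by
      have e : La ψ z ^ 2 = ((res g w' z - res g w z) + (-(res g w' z - res g w z - La ψ z))) ^ 2 := by ring
      rw [e]
      refine (sq_wt hd0).trans ?_
      have i1 := abs_sq_le (hra z)
      have i2 : (res g w' z - res g w z) ^ 2 ≤ 2 * res g w' z ^ 2 + 2 * res g w z ^ 2 := by
        nlinarith [sq_nonneg (res g w' z + res g w z)]
      rw [neg_sq]
      gcongr)
  rw [Ib_add (by fun_prop) (by fun_prop), Ib_mul _ (1 + d), Ib_mul _ (1 + 1 / d), Ib_add (by fun_prop) (by fun_prop), Ib_mul, Ib_mul] at h3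
  have h4 : (1 + 1 / d) * (2 * Ib 1 (fun z => res g w' z ^ 2) + 2 * Ib 1 (fun z => res g w z ^ 2)) ≤ (1 + 1 / d) * (4 * ε) :=
    mul_le_mul_of_nonneg_left (by linarith) (by positivity)
  have h5 : (1 + d) * Ib 1 (fun z => A z ^ 2) ≤ (1 - 2 * d) * L := by
    have e1 : (1 + d) * (1 - 3 * d) ≤ 1 - 2 * d := by nlinarith
    have := mul_le_mul_of_nonneg_left hA (by linarith : 0 ≤ 1 + d)
    have := mul_le_mul_of_nonneg_right e1 hL0
    linarith
  have h6 : 2 * d * L ≤ (1 + 1 / d) * (4 * ε) := by linarith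
  have hε : 0 ≤ ε := le_trans (Ib_nonneg (fun z _ => by positivity)) h1
  have h7 : (1 + 1 / d) ≤ 2 / d := by
    rw [le_div_iff₀ hd0]; field_simp; linarith
  have h8 : 2 * d * L ≤ 2 / d * (4 * ε) := h6.trans (mul_le_mul_of_nonneg_right h7 (by positivity))
  have h9 : L ≤ 4 / d ^ 2 * ε := by
    have : 2 * d * (4 / d ^ 2 * ε) = 2 / d * (4 * ε) := by field_simp
    rw [← this] at h8
    exact le_of_mul_le_mul_left h8 (by positivity)
  have h10 : 24 * L ≤ 24 * (4 / d ^ 2 * ε) := by linarith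
  have h11 : 24 * (4 / d ^ 2 * ε) ≤ 400 / d ^ 2 * ε := by
    have : 0 ≤ ε / d ^ 2 := by positivity
    have e1 : 24 * (4 / d ^ 2 * ε) = 96 * (ε / d ^ 2) := by ring
    have e2 : 400 / d ^ 2 * ε = 400 * (ε / d ^ 2) := by ring
    rw [e1, e2]; linarith
  exact hS.trans (h10.trans h11)

lemma minseq {φ : ℂ → ℝ} (hφ : Sm φ) {ε : ℝ} (hε : 0 < ε) : ∃ w, Sm w ∧ (∀ z : ℂ, ‖z‖ = 1 → w z = φ z) ∧
    Ib 1 (fun z => res g w z ^ 2) ≤ ε := by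
  set T : Set ℝ := {t | ∃ w, Sm w ∧ (∀ z : ℂ, ‖z‖ = 1 → w z = φ z) ∧ Ib 1 (fun z => res g w z ^ 2) = t} with hT
  have hne : T.Nonempty := ⟨_, φ, hφ, fun _ _ => rfl, rfl⟩
  have h0 : ∀ t ∈ T, 0 ≤ t := by
    rintro t ⟨w, -, -, rfl⟩
    exact Ib_nonneg (fun z _ => by positivity)
  have hbd : BddBelow T := ⟨0, h0⟩
  set m := sInf T with hm
  have hm0 : m ≤ 0 := by
    by_contra hcon
    push Not at hcon
    set d := (1 - k) / 4 with hd
    have hd0 : 0 < d := by rw [hd]; linarith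
    have hd1 : d ≤ 1 / 4 := by rw [hd]; linarith
    obtain ⟨t, ⟨w, hw, hwb, hwt⟩, htlt⟩ := exists_lt_of_csInf_lt hne (show sInf T < m + d * m / 3 by rw [← hm]; nlinarith)
    obtain ⟨w', hw', hb', hR⟩ := correct hk0 hk hβ0 hβ hg hα hw (show 0 < d * m / 3 by positivity)
    rw [hwt, ← hd] at hR
    have : m ≤ Ib 1 (fun z => res g w' z ^ 2) := csInf_le hbd ⟨w', hw', fun z hz => (hb' z hz).trans (hwb z hz), rfl⟩
    have h3 : (1 - d) * t ≤ (1 - d) * (m + d * m / 3) := mul_le_mul_of_nonneg_left htlt.le (by linarith)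
    nlinarith [mul_pos hd0 hcon, mul_pos hd0 (mul_pos hd0 hcon)]
  obtain ⟨t, ⟨w, hw, hwb, hwt⟩, htlt⟩ := exists_lt_of_csInf_lt hne (show sInf T < ε by rw [← hm]; linarith)
  exact ⟨w, hw, hwb, by rw [hwt]; exact htlt.le⟩

lemma exist {φ : ℂ → ℝ} (hφ : Sm φ) : ∃ W : ℂ → ℝ, ContinuousOn W (closedBall 0 1) ∧
    (∀ z : ℂ, ‖z‖ = 1 → W z = φ z) ∧ Approx g W := by
  have hch := fun n : ℕ => minseq hk0 hk hβ0 hβ hg hα hφ (show (0:ℝ) < 1 / (n + 1) by positivity)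
  choose w hw hwb hwr using hch
  set C := 400 / ((1 - k) / 4) ^ 2 with hC
  have hk1 : 0 < 1 - k := by linarith
  have hC0 : 0 < C := by positivity
  have hdist : ∀ n m, n ≤ m → ∀ z : ℂ, ‖z‖ ≤ 1 → |w m z - w n z| ≤ √(C * (1 / (n + 1))) := by
    intro n m hnm z hz
    refine Real.abs_le_sqrt ?_
    refine cauchy_est hk0 hk hβ0 hβ hg hα (hw n) (hw m) (fun z hz => by rw [hwb n z hz, hwb m z hz]) (hwr n) ((hwr m).trans ?_) z hz
    have : (n:ℝ) ≤ m := by exact_mod_cast hnm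
    gcongr
  have hlim0 : Filter.Tendsto (fun n : ℕ => √(C * (1 / ((n:ℝ) + 1)))) Filter.atTop (nhds 0) := by
    have := (tendsto_one_div_add_atTop_nhds_zero_nat (𝕜 := ℝ)).const_mul C
    have := (Real.continuous_sqrt.tendsto _).comp this
    simpa [Function.comp_def] using this
  have hcs : ∀ z : ℂ, ‖z‖ ≤ 1 → ∃ l, Filter.Tendsto (fun n => w n z) Filter.atTop (nhds l) := by
    intro z hz
    apply cauchySeq_tendsto_of_complete
    refine cauchySeq_of_le_tendsto_0' _ (fun n m hnm => ?_) hlim0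
    rw [dist_comm, Real.dist_eq]; exact hdist n m hnm z hz
  choose! W hW using hcs
  have hWd : ∀ n, ∀ z : ℂ, ‖z‖ ≤ 1 → |W z - w n z| ≤ √(C * (1 / ((n:ℝ) + 1))) := by
    intro n z hz
    have h1 : Filter.Tendsto (fun m => |w m z - w n z|) Filter.atTop (nhds |W z - w n z|) :=
      ((hW z hz).sub_const _).abs
    refine le_of_tendsto h1 ?_
    filter_upwards [Filter.eventually_ge_atTop n] with m hm using hdist n m hm z hz
  refine ⟨W, ?_, ?_, ?_⟩
  · have hu : TendstoUniformlyOn w W Filter.atTop (closedBall 0 1) := by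
      rw [Metric.tendstoUniformlyOn_iff]
      intro ε hε
      filter_upwards [hlim0.eventually (gt_mem_nhds hε)] with n hn z hz
      rw [Real.dist_eq]
      exact (hWd n z (by simpa using hz)).trans_lt hn
    exact hu.continuousOn (Filter.Eventually.of_forall (fun n => (hw n).cont.continuousOn)).frequently
  · intro z hz
    have h1 := hW z hz.le
    have h2 : (fun n => w n z) = fun _ => φ z := by funext n; exact hwb n z hz
    rw [h2] at h1
    exact tendsto_nhds_unique h1 tendsto_const_nhds
  · intro ε hε
    have h1 := hlim0.eventually (gt_mem_nhds hε)
    have h2 := (tendsto_one_div_add_atTop_nhds_zero_nat (𝕜 := ℝ)).eventually (gt_mem_nhds hε)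
    obtain ⟨n, hn1, hn2⟩ := (h1.and h2).exists
    refine ⟨w n, hw n, (hwr n).trans hn2.le, fun z hz => ?_⟩
    rw [abs_sub_comm]
    exact (hWd n z hz).trans hn1.le
end ex

/-- rescaled nonlinearity -/
def gs (x0 : ℂ) (ρ : ℝ) (g : ℂ → ℝ → ℂ → ℂ → ℝ) : ℂ → ℝ → ℂ → ℂ → ℝ :=
  fun z s p m => g (x0 + ρ * z) (ρ ^ 2 * s) (ρ * p) m

/-- viscosity (sub/super) solution property at a point, tested with quadratics -/
def Vsub (g : ℂ → ℝ → ℂ → ℂ → ℝ) (u : ℂ → ℝ) (z0 : ℂ) : Prop :=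
  ∀ (P : ℂ) (τ : ℝ) (μ : ℂ), IsLocalMax (fun z => u z - Qd 0 P τ μ (z - z0)) z0 → g z0 (u z0) P μ ≤ τ
def Vsup (g : ℂ → ℝ → ℂ → ℂ → ℝ) (u : ℂ → ℝ) (z0 : ℂ) : Prop :=
  ∀ (P : ℂ) (τ : ℝ) (μ : ℂ), IsLocalMin (fun z => u z - Qd 0 P τ μ (z - z0)) z0 → τ ≤ g z0 (u z0) P μ

lemma gs_ok {k β K N α : ℝ} {g : ℂ → ℝ → ℂ → ℂ → ℝ} (hg : Gok k β K N α g) (hβ : 0 ≤ β) (hK : 0 ≤ K)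
    (x0 : ℂ) {ρ : ℝ} (hρ : 0 < ρ) (hρ1 : ρ ≤ 1) : Gok k (β * ρ) (K * ρ ^ α) (N * ρ ^ α) α (gs x0 ρ g) where
  lip z s s' p p' m m' := by
    have h := hg.lip (x0 + ρ * z) (ρ ^ 2 * s) (ρ ^ 2 * s') (ρ * p) (ρ * p') m m'
    rw [← mul_sub, ← mul_sub, norm_mul, Complex.norm_real, Real.norm_of_nonneg hρ.le, abs_mul, abs_of_pos (pow_pos hρ 2)] at h
    refine h.trans ?_
    have h1 : ρ * ‖p - p'‖ + ρ ^ 2 * |s - s'| ≤ ρ * (‖p - p'‖ + |s - s'|) := by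
      have : ρ ^ 2 ≤ ρ := by nlinarith
      nlinarith [abs_nonneg (s - s')]
    have := mul_le_mul_of_nonneg_left h1 hβ
    linarith
  hol z z' s p m := by
    have h := hg.hol (x0 + ρ * z) (x0 + ρ * z') (ρ ^ 2 * s) (ρ * p) m
    have e : x0 + ρ * z - (x0 + ρ * z') = ρ * (z - z') := by ring
    rw [e, norm_mul, norm_mul, Complex.norm_real, Real.norm_of_nonneg hρ.le, abs_mul, abs_of_pos (pow_pos hρ 2),
      mul_rpow hρ.le (norm_nonneg _)] at h
    refine h.trans ?_
    have h1 : ρ * ‖p‖ ≤ ‖p‖ := mul_le_of_le_one_left (norm_nonneg _) hρ1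
    have h2 : ρ ^ 2 * |s| ≤ |s| := mul_le_of_le_one_left (abs_nonneg _) (pow_le_one₀ hρ.le hρ1)
    calc (K * (‖m‖ + ρ * ‖p‖ + ρ ^ 2 * |s|) + N) * (ρ ^ α * ‖z - z'‖ ^ α)
        ≤ (K * (‖m‖ + ‖p‖ + |s|) + N) * (ρ ^ α * ‖z - z'‖ ^ α) := by gcongr
      _ = _ := by ring

lemma Gok.mono {k β K N α β' K' N' : ℝ} {g : ℂ → ℝ → ℂ → ℂ → ℝ} (hg : Gok k β K N α g) (h1 : β ≤ β') (h2 : K ≤ K')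
    (h3 : N ≤ N') : Gok k β' K' N' α g where
  lip z s s' p p' m m' := (hg.lip z s s' p p' m m').trans (by gcongr)
  hol z z' s p m := (hg.hol z z' s p m).trans (by gcongr)

lemma gs_approx {k β K N α : ℝ} {g : ℂ → ℝ → ℂ → ℂ → ℝ} (hg : Gok k β K N α g) (hα : 0 < α) {W : ℂ → ℝ}
    (hW : Approx g W) {x0 : ℂ} {ρ : ℝ} (hρ : 0 < ρ) (hx : ‖x0‖ + ρ ≤ 1) :
    Approx (gs x0 ρ g) (fun z => (ρ ^ 2)⁻¹ * W (x0 + ρ * z)) := by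
  intro ε hε
  have hρ1 : ρ ≤ 1 := by linarith [norm_nonneg x0]
  have hρ2 : ρ ^ 2 ≤ 1 := pow_le_one₀ hρ.le hρ1
  obtain ⟨w, hw, hr, hd⟩ := hW (ρ ^ 2 * ε) (by positivity)
  have hws : Sm (fun z => (ρ ^ 2)⁻¹ * w (x0 + ρ * z)) := (Sm.const _).mul (hw.comp_aff x0 ρ)
  refine ⟨_, hws, ?_, ?_⟩
  · have e : ∀ z, res (gs x0 ρ g) (fun z => (ρ ^ 2)⁻¹ * w (x0 + ρ * z)) z = res g w (x0 + ρ * z) := by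
      intro z
      have hne : (ρ:ℂ) ≠ 0 := by exact_mod_cast hρ.ne'
      unfold res gs
      rw [La_scal hw, gr_scal hw, mm_scal hw]
      have e1 : (ρ ^ 2)⁻¹ * ρ ^ 2 = 1 := by field_simp
      have e2 : (ρ:ℂ) * ((((ρ ^ 2)⁻¹ * ρ : ℝ):ℂ) * gr w (x0 + ρ * z)) = gr w (x0 + ρ * z) := by
        push_cast; field_simp
      have e3 : ρ ^ 2 * ((ρ ^ 2)⁻¹ * w (x0 + ρ * z)) = w (x0 + ρ * z) := by field_simp
      simp only [e1, e2, e3]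
      simp
    have hrc := res_cont hg hα hw
    have e2 : (fun z => res (gs x0 ρ g) (fun z => (ρ ^ 2)⁻¹ * w (x0 + ρ * z)) z ^ 2) =
        fun z => (fun y => res g w (x0 + y) ^ 2) (ρ * z) := by
      funext z; rw [e]
    rw [e2, Ib_scale hρ (fun y => res g w (x0 + y) ^ 2), mul_one]
    have h1 := Ib_trans x0 hx (f := fun z => res g w z ^ 2) (by fun_prop) (fun z _ => by positivity)
    calc (ρ ^ 2)⁻¹ * Ib ρ (fun y => res g w (x0 + y) ^ 2) ≤ (ρ ^ 2)⁻¹ * (ρ ^ 2 * ε) := by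
          gcongr; exact h1.trans hr
      _ = ε := by field_simp
  · intro z hz
    have h1 := hd (x0 + ρ * z) (by
      refine (norm_add_le _ _).trans ?_
      rw [norm_mul, Complex.norm_real, Real.norm_of_nonneg hρ.le]
      nlinarith)
    simp only [← mul_sub]
    rw [abs_mul, abs_of_pos (by positivity)]
    calc (ρ ^ 2)⁻¹ * |w (x0 + ρ * z) - W (x0 + ρ * z)| ≤ (ρ ^ 2)⁻¹ * (ρ ^ 2 * ε) := by gcongr
      _ = ε := by field_simp

section expand
variable {k α : ℝ} (hk0 : 0 ≤ k) (hk : k < 1) (hα0 : 0 < α) (hα1 : α ≤ 1) (hα : 2 * α < mor k)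
include hk0 hk hα0 hα1 hα

/-- small scale selection -/
lemma small_scale {δ β K : ℝ} (hδ : 0 < δ) (hβ : 0 ≤ β) (hK : 0 ≤ K) {R : ℝ} (hR : 0 < R) :
    ∃ ρ : ℝ, 0 < ρ ∧ ρ ≤ 1 ∧ ρ ≤ R ∧ β * ρ ≤ δ ∧ K * ρ ^ α ≤ δ := by
  set A := (δ / (K + 1)) ^ (1 / α) with hA
  have hA0 : 0 < A := by positivity
  refine ⟨min (min 1 R) (min (δ / (β + 1)) A), by positivity, ?_, ?_, ?_, ?_⟩
  · exact (min_le_left _ _).trans (min_le_left _ _)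
  · exact (min_le_left _ _).trans (min_le_right _ _)
  · set ρ := min (min 1 R) (min (δ / (β + 1)) A) with hρ
    have h1 : ρ ≤ δ / (β + 1) := (min_le_right _ _).trans (min_le_left _ _)
    have h0 : 0 < ρ := by positivity
    rw [le_div_iff₀ (by positivity)] at h1
    nlinarith
  · set ρ := min (min 1 R) (min (δ / (β + 1)) A) with hρ
    have h1 : ρ ≤ A := (min_le_right _ _).trans (min_le_right _ _)
    have h0 : 0 < ρ := by positivity
    have h2 : ρ ^ α ≤ A ^ α := rpow_le_rpow h0.le h1 hα0.le
    have h3 : A ^ α = δ / (K + 1) := by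
      rw [hA, ← rpow_mul (by positivity), one_div, inv_mul_cancel₀ hα0.ne', rpow_one]
    rw [h3, le_div_iff₀ (by positivity)] at h2
    have : 0 < ρ ^ α := by positivity
    nlinarith

lemma expand {β K N : ℝ} {g : ℂ → ℝ → ℂ → ℂ → ℝ} (hg : Gok k β K N α g) (hβ : 0 ≤ β) (hK : 0 ≤ K)
    {W : ℂ → ℝ} (hWc : ContinuousOn W (closedBall 0 1)) (hW : Approx g W) {z0 : ℂ} (hz0 : ‖z0‖ < 1) :
    ∃ P τ μ C r, 0 < r ∧ 0 ≤ C ∧ (∀ y : ℂ, ‖y‖ ≤ r → |W (z0 + y) - Qd (W z0) P τ μ y| ≤ C * ‖y‖ ^ (2 + α)) ∧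
      τ = g z0 (W z0) P μ := by
  obtain ⟨δ, C, hδ, hδ1, hC, H⟩ := reg hk0 hk hα0 hα1 hα
  obtain ⟨ρ, hρ0, hρ1, hρR, hβρ, hKρ⟩ := small_scale hk0 hk hα0 hα1 hα hδ hβ hK (sub_pos.mpr hz0)
  obtain ⟨M, hM⟩ := (isCompact_closedBall (0:ℂ) 1).exists_bound_of_continuousOn hWc
  set N' := |N * ρ ^ α| + |gs z0 ρ g 0 0 0 0| + (ρ ^ 2)⁻¹ * |M| + 1 with hN'
  have hN'0 : 0 < N' := by positivity
  have t1 : 0 ≤ |N * ρ ^ α| := abs_nonneg _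
  have t2 : 0 ≤ |gs z0 ρ g 0 0 0 0| := abs_nonneg _
  have t3 : 0 ≤ (ρ ^ 2)⁻¹ * |M| := by positivity
  have hg' : Gok k δ δ N' α (gs z0 ρ g) := (gs_ok hg hβ hK z0 hρ0 hρ1).mono hβρ hKρ
    (by have := le_abs_self (N * ρ ^ α); linarith)
  have hin : ∀ z : ℂ, ‖z‖ ≤ 1 → ‖z0 + ρ * z‖ ≤ 1 := by
    intro z hz
    refine (norm_add_le _ _).trans ?_
    rw [norm_mul, Complex.norm_real, Real.norm_of_nonneg hρ0.le]
    nlinarith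
  obtain ⟨S, P, τ, μ, -, -, -, -, hexp, hτ⟩ := H (gs z0 ρ g) (fun z => (ρ ^ 2)⁻¹ * W (z0 + ρ * z)) N' hN'0 hg' (by linarith)
    (fun z hz => by
      have h1 := hM (z0 + ρ * z) (by simpa using hin z hz)
      rw [abs_mul, abs_of_pos (by positivity : 0 < (ρ ^ 2)⁻¹)]
      have h2 : (ρ ^ 2)⁻¹ * |W (z0 + ρ * z)| ≤ (ρ ^ 2)⁻¹ * |M| := by
        exact mul_le_mul_of_nonneg_left (h1.trans (le_abs_self M)) (by positivity)
      linarith) (gs_approx hg hα0 hW hρ0 (by linarith))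
  have hne : (ρ:ℂ) ≠ 0 := by exact_mod_cast hρ0.ne'
  have hS : S = (ρ ^ 2)⁻¹ * W z0 := by
    have := hexp 0 (by simp)
    simp only [mul_zero, add_zero, norm_zero, zero_rpow (by positivity : (2 + α) ≠ 0)] at this
    have h3 := abs_nonpos_iff.mp this
    have h4 : Qd S P τ μ 0 = S := by simp [Qd]
    rw [h4] at h3; linarith
  have hS' : ρ ^ 2 * S = W z0 := by rw [hS]; field_simp
  refine ⟨ρ * P, τ, μ, ρ ^ 2 * (C * N' * (ρ⁻¹) ^ (2 + α)), ρ / 2, by positivity, by positivity, ?_, ?_⟩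
  · intro y hy
    have hyy : (ρ:ℂ) * (((ρ⁻¹:ℝ):ℂ) * y) = y := by push_cast; field_simp
    have hny : ‖((ρ⁻¹:ℝ):ℂ) * y‖ = ρ⁻¹ * ‖y‖ := by
      rw [norm_mul, Complex.norm_real, Real.norm_of_nonneg (by positivity)]
    have h1 := hexp (((ρ⁻¹:ℝ):ℂ) * y) (by
      rw [hny]
      calc ρ⁻¹ * ‖y‖ ≤ ρ⁻¹ * (ρ / 2) := by gcongr
        _ = 1 / 2 := by field_simp)
    simp only [hyy] at h1
    rw [hny, mul_rpow (by positivity) (norm_nonneg _)] at h1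
    have h2 := Qd_scale (ρ ^ 2) ρ⁻¹ S P τ μ y
    have e1 : ((ρ ^ 2 * ρ⁻¹ : ℝ) : ℂ) = ρ := by push_cast; field_simp
    have e2 : ρ ^ 2 * ρ⁻¹ ^ 2 = 1 := by field_simp
    rw [e1, e2, hS', one_mul, Complex.ofReal_one, one_mul] at h2
    rw [← h2]
    have e3 : W (z0 + y) - ρ ^ 2 * Qd S P τ μ (((ρ⁻¹:ℝ):ℂ) * y) = ρ ^ 2 * ((ρ ^ 2)⁻¹ * W (z0 + y) - Qd S P τ μ (((ρ⁻¹:ℝ):ℂ) * y)) := by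
      field_simp
    rw [e3, abs_mul, abs_of_pos (by positivity : 0 < ρ ^ 2)]
    calc _ ≤ ρ ^ 2 * (C * N' * (ρ⁻¹ ^ (2 + α) * ‖y‖ ^ (2 + α))) := by gcongr
      _ = _ := by ring
  · rw [hτ]; simp only [gs, mul_zero, add_zero, hS']

lemma pow_small {C ε : ℝ} (hC : 0 ≤ C) (hε : 0 < ε) : ∀ᶠ y : ℂ in nhds 0, C * ‖y‖ ^ (2 + α) ≤ ε * ‖y‖ ^ 2 := by
  have h1 : Filter.Tendsto (fun y : ℂ => C * ‖y‖ ^ α) (nhds 0) (nhds 0) := by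
    have : Continuous (fun y : ℂ => C * ‖y‖ ^ α) := continuous_const.mul (continuous_norm.rpow_const (fun _ => Or.inr hα0.le))
    simpa [zero_rpow hα0.ne'] using this.tendsto 0
  filter_upwards [h1.eventually (gt_mem_nhds hε)] with y hy
  have e : ‖y‖ ^ (2 + α) = ‖y‖ ^ 2 * ‖y‖ ^ α := by
    by_cases h : ‖y‖ = 0
    · rw [h, zero_rpow (by positivity)]; simp
    · have : 0 < ‖y‖ := lt_of_le_of_ne (norm_nonneg _) (Ne.symm h)
      rw [rpow_add this]; norm_cast
  rw [e]
  nlinarith [sq_nonneg ‖y‖]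

set_option maxHeartbeats 800000 in
lemma cmpW {β K N : ℝ} {g : ℂ → ℝ → ℂ → ℂ → ℝ} (hg : Gok k β K N α g) (hβ : 0 ≤ β) (hβ1 : β < 1) (hK : 0 ≤ K)
    {u W : ℂ → ℝ} (huc : ContinuousOn u (closedBall 0 1)) (hWc : ContinuousOn W (closedBall 0 1)) (hW : Approx g W)
    (hu : ∀ z : ℂ, ‖z‖ < 1 → Vsub g u z) {δ : ℝ} (hδ : 0 ≤ δ) (hb : ∀ z : ℂ, ‖z‖ = 1 → u z ≤ W z + δ)
    (z : ℂ) (hz : ‖z‖ ≤ 1) : u z ≤ W z + 2 * δ := by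
  have hpos : ∀ z : ℂ, ‖z‖ ≤ 1 → 1 ≤ 2 - ‖z‖ ^ 2 := fun z hz => by nlinarith [norm_nonneg z]
  have hqc : ContinuousOn (fun z => (u z - W z) / (2 - ‖z‖ ^ 2)) (closedBall 0 1) := by
    refine (huc.sub hWc).div (by fun_prop) (fun z hz => ?_)
    have := hpos z (by simpa using hz)
    linarith
  obtain ⟨z0, hz0, hmax⟩ := (isCompact_closedBall (0:ℂ) 1).exists_isMaxOn ⟨0, by simp⟩ hqc
  have hz0' : ‖z0‖ ≤ 1 := by simpa using hz0
  set T := (u z0 - W z0) / (2 - ‖z0‖ ^ 2) with hT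
  have hle : ∀ z : ℂ, ‖z‖ ≤ 1 → u z - W z ≤ T * (2 - ‖z‖ ^ 2) := by
    intro z hz
    have h1 : (u z - W z) / (2 - ‖z‖ ^ 2) ≤ T := hmax (by simpa using hz)
    have h2 := hpos z hz
    rwa [div_le_iff₀ (by linarith)] at h1
  have heq : u z0 - W z0 = T * (2 - ‖z0‖ ^ 2) := by
    have h2 := hpos z0 hz0'
    rw [hT]; field_simp
  have key : T ≤ δ := by
    by_contra hcon
    push Not at hcon
    have hTp : 0 < T := by linarith
    have hlt : ‖z0‖ < 1 := by
      refine lt_of_le_of_ne hz0' (fun h1 => ?_)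
      have h2 := hb z0 h1
      rw [h1] at heq
      linarith
    obtain ⟨P, τ, μ, C, r, hr, hC, hexp, hτ⟩ := expand hk0 hk hα0 hα1 hα hg hβ hK hWc hW hlt
    set ε := T * (1 - β) / 2 with hε
    have hε0 : 0 < ε := by rw [hε]; have : 0 < 1 - β := by linarith
                           positivity
    have hsm := pow_small hk0 hk hα0 hα1 hα hC hε0
    have htend : Filter.Tendsto (fun z : ℂ => z - z0) (nhds z0) (nhds 0) := by
      have : Continuous (fun z : ℂ => z - z0) := by fun_prop
      simpa using this.tendsto z0
    have hloc : IsLocalMax (fun z => u z - Qd 0 (P - (2 * T : ℝ) * z0) (τ - 4 * T + 4 * ε) μ (z - z0)) z0 := by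
      have e1 := htend.eventually hsm
      have e2 : ∀ᶠ z in nhds z0, ‖z - z0‖ < r := by
        have := Metric.ball_mem_nhds z0 hr
        filter_upwards [this] with z hz
        simpa [dist_eq_norm] using hz
      have e3 : ∀ᶠ z in nhds z0, ‖z‖ < 1 := (continuous_norm.tendsto z0).eventually (gt_mem_nhds hlt)
      filter_upwards [e1, e2, e3] with z h1 h2 h3
      have h4 := hle z h3.le
      have h5 := hexp (z - z0) h2.le
      rw [add_sub_cancel] at h5
      have h6 := (abs_le.mp h5).2
      have n1 : ‖z‖ ^ 2 = z.re ^ 2 + z.im ^ 2 := by rw [← Complex.normSq_eq_norm_sq, Complex.normSq_apply]; ring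
      have n2 : ‖z0‖ ^ 2 = z0.re ^ 2 + z0.im ^ 2 := by rw [← Complex.normSq_eq_norm_sq, Complex.normSq_apply]; ring
      have n3 : ‖z - z0‖ ^ 2 = (z.re - z0.re) ^ 2 + (z.im - z0.im) ^ 2 := by
        rw [← Complex.normSq_eq_norm_sq, Complex.normSq_apply]; simp; ring
      rw [n3] at h1
      rw [n1] at h4
      rw [n2] at heq
      simp only [Qd, sub_self, Complex.zero_re, Complex.zero_im, Complex.sub_re, Complex.sub_im, Complex.re_ofReal_mul, Complex.im_ofReal_mul] at h6 ⊢
      linarith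
    have hv := hu z0 hlt _ _ _ hloc
    have hl := hg.lip z0 (u z0) (W z0) (P - (2 * T : ℝ) * z0) P μ μ
    rw [← hτ] at hl
    have hl2 := (abs_le.mp hl).1
    have n4 : ‖P - (2 * T : ℝ) * z0 - P‖ = 2 * T * ‖z0‖ := by
      have : P - (2 * T : ℝ) * z0 - P = -(((2 * T : ℝ) : ℂ) * z0) := by ring
      rw [this, norm_neg, norm_mul, Complex.norm_real, Real.norm_of_nonneg (by linarith)]
    have n5 : |u z0 - W z0| = T * (2 - ‖z0‖ ^ 2) := by
      rw [heq, abs_of_nonneg]; have := hpos z0 hz0'; nlinarith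
    rw [n4, n5, sub_self, norm_zero, mul_zero, zero_add] at hl2
    have h7 : 2 * T * ‖z0‖ + T * (2 - ‖z0‖ ^ 2) ≤ 4 * T := by
      have : ‖z0‖ * 2 ≤ 2 + ‖z0‖ ^ 2 := by nlinarith [norm_nonneg z0]
      nlinarith
    have h8 := mul_le_mul_of_nonneg_left h7 hβ
    have h9 : T * (1 - β) ≤ ε := by linarith
    have : 0 < T * (1 - β) := mul_pos hTp (by linarith)
    linarith
  have h1 := hle z hz
  have h2 := hpos z hz
  nlinarith [sq_nonneg ‖z‖]
end expand

/-- reflected nonlinearity -/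
def gn (g : ℂ → ℝ → ℂ → ℂ → ℝ) : ℂ → ℝ → ℂ → ℂ → ℝ := fun z s p m => - g z (-s) (-p) (-m)

lemma gn_ok {k β K N α : ℝ} {g : ℂ → ℝ → ℂ → ℂ → ℝ} (hg : Gok k β K N α g) : Gok k β K N α (gn g) where
  lip z s s' p p' m m' := by
    have := hg.lip z (-s) (-s') (-p) (-p') (-m) (-m')
    unfold gn
    rw [neg_sub_neg, neg_sub_neg, neg_sub_neg, norm_sub_rev m', norm_sub_rev p', abs_sub_comm s'] at this
    rw [neg_sub_neg, abs_sub_comm]; exact this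
  hol z z' s p m := by
    have := hg.hol z z' (-s) (-p) (-m)
    rw [norm_neg, norm_neg, abs_neg] at this
    unfold gn
    rw [neg_sub_neg, abs_sub_comm]; exact this

lemma Qd_neg (P : ℂ) (τ : ℝ) (μ z : ℂ) : Qd 0 (-P) (-τ) (-μ) z = - Qd 0 P τ μ z := by
  simp [Qd]; ring

lemma gn_Vsub {g : ℂ → ℝ → ℂ → ℂ → ℝ} {u : ℂ → ℝ} {z0 : ℂ} (h : Vsup g u z0) : Vsub (gn g) (fun z => - u z) z0 := by
  intro P τ μ hm
  have := h (-P) (-τ) (-μ) (by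
    have := hm.neg
    refine this.congr (Filter.Eventually.of_forall fun z => ?_)
    simp only [Qd_neg]; ring)
  simp only [gn, neg_neg]
  linarith

lemma gn_approx {g : ℂ → ℝ → ℂ → ℂ → ℝ} {u : ℂ → ℝ} (h : Approx g u) : Approx (gn g) (fun z => - u z) := by
  intro ε hε
  obtain ⟨w, hw, h1, h2⟩ := h ε hε
  refine ⟨_, hw.neg, ?_, fun z hz => by rw [neg_sub_neg, abs_sub_comm]; exact h2 z hz⟩
  have e : ∀ z, res (gn g) (fun z => - w z) z = - res g w z := by
    intro z
    have e1 : dx (fun z => - w z) = fun z => - dx w z := dd_neg _ _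
    have e2 : dy (fun z => - w z) = fun z => - dy w z := dd_neg _ _
    have eg : gr (fun z => - w z) z = - gr w z := by
      unfold gr; rw [e1, e2]; apply Complex.ext <;> simp
    have em : mm (fun z => - w z) z = - mm w z := by
      unfold mm mr mi; rw [e1, e2, dx_neg, dx_neg, dy_neg]; apply Complex.ext <;> simp <;> ring
    have eL : La (fun z => - w z) z = - La w z := by
      unfold La; rw [e1, e2, dx_neg, dy_neg]; ring
    unfold res gn
    rw [eg, em, eL]; simp only [neg_neg]; ring
  simp only [e, neg_sq]; exact h1

theorem core {k α : ℝ} (hk0 : 0 ≤ k) (hk : k < 1) (hα0 : 0 < α) (hα1 : α ≤ 1) (hα : 2 * α < mor k) :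
    ∃ δ C : ℝ, 0 < δ ∧ δ ≤ 1 ∧ 0 < C ∧ ∀ (g : ℂ → ℝ → ℂ → ℂ → ℝ) (u : ℂ → ℝ) (N : ℝ), 0 < N →
    Gok k δ δ N α g → |g 0 0 0 0| ≤ N → (∀ z : ℂ, ‖z‖ ≤ 1 → |u z| ≤ N) → ContinuousOn u (closedBall 0 1) →
    (∀ z : ℂ, ‖z‖ < 1 → Vsub g u z) → (∀ z : ℂ, ‖z‖ < 1 → Vsup g u z) →
    ∃ S P τ μ, |S| ≤ C * N ∧ ‖P‖ ≤ C * N ∧ |τ| ≤ C * N ∧ ‖μ‖ ≤ C * N ∧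
      (∀ z : ℂ, ‖z‖ ≤ 1 / 2 → |u z - Qd S P τ μ z| ≤ C * N * ‖z‖ ^ (2 + α)) := by
  obtain ⟨δ, C, hδ, hδ1, hC, H⟩ := reg hk0 hk hα0 hα1 hα
  have hk1 : 0 < 1 - k := by linarith
  set δ' := min δ ((1 - k) / 40) with hδ'
  have hδ'0 : 0 < δ' := by positivity
  have hle1 : δ' ≤ δ := min_le_left _ _
  have hle2 : δ' ≤ (1 - k) / 40 := min_le_right _ _
  refine ⟨δ', C, hδ'0, hle1.trans hδ1, hC, ?_⟩
  intro g u N hN hg h0 hu huc hsub hsup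
  have hA : Approx g u := by
    intro ε hε
    obtain ⟨φ, hφ, hφu⟩ := sm_approx huc (show 0 < ε / 4 by positivity)
    obtain ⟨W, hWc, hWb, hWA⟩ := exist hk0 hk hδ'0.le hle2 hg hα0 hφ
    have c1 := cmpW hk0 hk hα0 hα1 hα hg hδ'0.le (by linarith) hδ'0.le huc hWc hWA hsub (show 0 ≤ ε / 4 by positivity)
      (fun z hz => by rw [hWb z hz]; have := (abs_le.mp (hφu z hz.le)).1; linarith)
    have c2 := cmpW hk0 hk hα0 hα1 hα (gn_ok hg) hδ'0.le (by linarith) hδ'0.le huc.neg hWc.neg (gn_approx hWA)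
      (fun z hz => gn_Vsub (hsup z hz)) (show 0 ≤ ε / 4 by positivity)
      (fun z hz => by simp only [Pi.neg_apply]; rw [hWb z hz]; have := (abs_le.mp (hφu z hz.le)).2; linarith)
    obtain ⟨w, hw, hr, hd⟩ := hWA (ε / 2) (by positivity)
    refine ⟨w, hw, by linarith, fun z hz => ?_⟩
    have d1 := c1 z hz
    have d2 := c2 z hz
    have d3 := abs_le.mp (hd z hz)
    simp only [Pi.neg_apply] at d2
    rw [abs_le]; constructor <;> linarith [d3.1, d3.2]
  obtain ⟨S, P, τ, μ, h1, h2, h3, h4, h5, -⟩ := H g u N hN (hg.mono hle1 hle1 le_rfl) h0 hu hA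
  exact ⟨S, P, τ, μ, h1, h2, h3, h4, h5⟩

lemma unscale {W : ℂ → ℝ} {z0 : ℂ} {ρ α D S τ : ℝ} {P μ : ℂ} (hρ0 : 0 < ρ) (hα0 : 0 < α)
    (hexp : ∀ z : ℂ, ‖z‖ ≤ 1 / 2 → |(ρ ^ 2)⁻¹ * W (z0 + ρ * z) - Qd S P τ μ z| ≤ D * ‖z‖ ^ (2 + α)) :
    ∀ y : ℂ, ‖y‖ ≤ ρ / 2 → |W (z0 + y) - Qd (W z0) (ρ * P) τ μ y| ≤ ρ ^ 2 * (D * (ρ⁻¹) ^ (2 + α)) * ‖y‖ ^ (2 + α) := by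
  have hne : (ρ:ℂ) ≠ 0 := by exact_mod_cast hρ0.ne'
  have hS : S = (ρ ^ 2)⁻¹ * W z0 := by
    have := hexp 0 (by simp)
    simp only [mul_zero, add_zero, norm_zero, zero_rpow (by positivity : (2 + α) ≠ 0)] at this
    have h3 := abs_nonpos_iff.mp this
    have h4 : Qd S P τ μ 0 = S := by simp [Qd]
    rw [h4] at h3; linarith
  have hS' : ρ ^ 2 * S = W z0 := by rw [hS]; field_simp
  intro y hy
  have hyy : (ρ:ℂ) * (((ρ⁻¹:ℝ):ℂ) * y) = y := by push_cast; field_simp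
  have hny : ‖((ρ⁻¹:ℝ):ℂ) * y‖ = ρ⁻¹ * ‖y‖ := by
    rw [norm_mul, Complex.norm_real, Real.norm_of_nonneg (by positivity)]
  have h1 := hexp (((ρ⁻¹:ℝ):ℂ) * y) (by
    rw [hny]
    calc ρ⁻¹ * ‖y‖ ≤ ρ⁻¹ * (ρ / 2) := by gcongr
      _ = 1 / 2 := by field_simp)
  simp only [hyy] at h1
  rw [hny, mul_rpow (by positivity) (norm_nonneg _)] at h1
  have h2 := Qd_scale (ρ ^ 2) ρ⁻¹ S P τ μ y
  have e1 : ((ρ ^ 2 * ρ⁻¹ : ℝ) : ℂ) = ρ := by push_cast; field_simp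
  have e2 : ρ ^ 2 * ρ⁻¹ ^ 2 = 1 := by field_simp
  rw [e1, e2, hS', one_mul, Complex.ofReal_one, one_mul] at h2
  rw [← h2]
  have e3 : W (z0 + y) - ρ ^ 2 * Qd S P τ μ (((ρ⁻¹:ℝ):ℂ) * y) = ρ ^ 2 * ((ρ ^ 2)⁻¹ * W (z0 + y) - Qd S P τ μ (((ρ⁻¹:ℝ):ℂ) * y)) := by
    field_simp
  rw [e3, abs_mul, abs_of_pos (by positivity : 0 < ρ ^ 2)]
  calc _ ≤ ρ ^ 2 * (D * (ρ⁻¹ ^ (2 + α) * ‖y‖ ^ (2 + α))) := by gcongr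
    _ = _ := by ring

lemma gs_test {u : ℂ → ℝ} {x0 z1 : ℂ} {ρ : ℝ} (hρ : 0 < ρ) (P : ℂ) (τ : ℝ) (μ : ℂ) (y : ℂ) :
    u y - Qd 0 (ρ * P) τ μ (y - (x0 + ρ * z1)) =
      ρ ^ 2 * ((ρ ^ 2)⁻¹ * u (x0 + ρ * (((ρ⁻¹:ℝ):ℂ) * (y - x0))) - Qd 0 P τ μ ((((ρ⁻¹:ℝ):ℂ) * (y - x0)) - z1)) := by
  have hne : (ρ:ℂ) ≠ 0 := by exact_mod_cast hρ.ne'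
  have e0 : x0 + ρ * (((ρ⁻¹:ℝ):ℂ) * (y - x0)) = y := by push_cast; field_simp; ring
  have e1 : (((ρ⁻¹:ℝ):ℂ) * (y - x0)) - z1 = ((ρ⁻¹:ℝ):ℂ) * (y - (x0 + ρ * z1)) := by
    push_cast; field_simp; ring
  have h2 := Qd_scale (ρ ^ 2) ρ⁻¹ 0 P τ μ (y - (x0 + ρ * z1))
  have e2 : ((ρ ^ 2 * ρ⁻¹ : ℝ) : ℂ) = ρ := by push_cast; field_simp
  have e3 : ρ ^ 2 * ρ⁻¹ ^ 2 = 1 := by field_simp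
  rw [e2, e3, mul_zero, one_mul, Complex.ofReal_one, one_mul] at h2
  rw [e0, e1, mul_sub, h2]
  field_simp

lemma aff_tend {x0 z1 : ℂ} {ρ : ℝ} (hρ : 0 < ρ) :
    Filter.Tendsto (fun y : ℂ => ((ρ⁻¹:ℝ):ℂ) * (y - x0)) (nhds (x0 + ρ * z1)) (nhds z1) := by
  have hne : (ρ:ℂ) ≠ 0 := by exact_mod_cast hρ.ne'
  have hc : Continuous (fun y : ℂ => ((ρ⁻¹:ℝ):ℂ) * (y - x0)) := by fun_prop
  have := hc.tendsto (x0 + ρ * z1)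
  have e : ((ρ⁻¹:ℝ):ℂ) * (x0 + ρ * z1 - x0) = z1 := by push_cast; field_simp; ring
  rwa [e] at this

lemma gs_Vsub {g : ℂ → ℝ → ℂ → ℂ → ℝ} {u : ℂ → ℝ} {x0 z1 : ℂ} {ρ : ℝ} (hρ : 0 < ρ) (h : Vsub g u (x0 + ρ * z1)) :
    Vsub (gs x0 ρ g) (fun z => (ρ ^ 2)⁻¹ * u (x0 + ρ * z)) z1 := by
  intro P τ μ hm
  have hm' : IsLocalMax (fun y => u y - Qd 0 (ρ * P) τ μ (y - (x0 + ρ * z1))) (x0 + ρ * z1) := by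
    filter_upwards [(aff_tend hρ).eventually hm] with y hy
    rw [gs_test hρ, gs_test hρ]
    refine mul_le_mul_of_nonneg_left ?_ (by positivity)
    have e : ((ρ⁻¹:ℝ):ℂ) * (x0 + ρ * z1 - x0) = z1 := by
      have hne : (ρ:ℂ) ≠ 0 := by exact_mod_cast hρ.ne'
      push_cast; field_simp; ring
    rw [e]; exact hy
  have := h _ _ _ hm'
  have e3 : ρ ^ 2 * ((ρ ^ 2)⁻¹ * u (x0 + ρ * z1)) = u (x0 + ρ * z1) := by field_simp
  simp only [gs, e3]; exact this

lemma gs_Vsup {g : ℂ → ℝ → ℂ → ℂ → ℝ} {u : ℂ → ℝ} {x0 z1 : ℂ} {ρ : ℝ} (hρ : 0 < ρ) (h : Vsup g u (x0 + ρ * z1)) :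
    Vsup (gs x0 ρ g) (fun z => (ρ ^ 2)⁻¹ * u (x0 + ρ * z)) z1 := by
  intro P τ μ hm
  have hm' : IsLocalMin (fun y => u y - Qd 0 (ρ * P) τ μ (y - (x0 + ρ * z1))) (x0 + ρ * z1) := by
    filter_upwards [(aff_tend hρ).eventually hm] with y hy
    rw [gs_test hρ, gs_test hρ]
    refine mul_le_mul_of_nonneg_left ?_ (by positivity)
    have e : ((ρ⁻¹:ℝ):ℂ) * (x0 + ρ * z1 - x0) = z1 := by
      have hne : (ρ:ℂ) ≠ 0 := by exact_mod_cast hρ.ne'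
      push_cast; field_simp; ring
    rw [e]; exact hy
  have := h _ _ _ hm'
  have e3 : ρ ^ 2 * ((ρ ^ 2)⁻¹ * u (x0 + ρ * z1)) = u (x0 + ρ * z1) := by field_simp
  simp only [gs, e3]; exact this

theorem main_C {k α : ℝ} (hk0 : 0 ≤ k) (hk : k < 1) (hα0 : 0 < α) (hα1 : α ≤ 1) (hα : 2 * α < mor k)
    {β K : ℝ} (hβ : 0 ≤ β) (hK : 0 ≤ K) : ∃ C r : ℝ, 0 < C ∧ 0 < r ∧
    ∀ (g : ℂ → ℝ → ℂ → ℂ → ℝ) (u : ℂ → ℝ) (N : ℝ), 0 < N → Gok k β K N α g → |g 0 0 0 0| ≤ N →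
    (∀ z : ℂ, ‖z‖ ≤ 3 / 5 → |u z| ≤ N) → ContinuousOn u (closedBall 0 (3 / 5)) →
    (∀ z : ℂ, ‖z‖ ≤ 3 / 5 → Vsub g u z ∧ Vsup g u z) →
    ∀ x : ℂ, ‖x‖ ≤ 11 / 20 → ∃ P τ μ, ‖P‖ ≤ C * N ∧ |τ| ≤ C * N ∧ ‖μ‖ ≤ C * N ∧
      ∀ y : ℂ, ‖y‖ ≤ r → |u (x + y) - Qd (u x) P τ μ y| ≤ C * N * ‖y‖ ^ (2 + α) := by
  obtain ⟨δ, C, hδ, hδ1, hC, H⟩ := core hk0 hk hα0 hα1 hα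
  obtain ⟨ρ, hρ0, hρ1, hρR, hβρ, hKρ⟩ := small_scale hk0 hk hα0 hα1 hα hδ hβ hK (show (0:ℝ) < 1 / 20 by norm_num)
  set C1 := C * (2 * (ρ ^ 2)⁻¹) with hC1
  set C2 := ρ ^ 2 * (C1 * (ρ⁻¹) ^ (2 + α)) with hC2
  have hC10 : 0 < C1 := by positivity
  have hC20 : 0 < C2 := by positivity
  refine ⟨C1 + C2, ρ / 2, by positivity, by positivity, ?_⟩
  intro g u N hN hg h0 hu huc hv x hx
  have hin : ∀ z : ℂ, ‖z‖ ≤ 1 → ‖x + ρ * z‖ ≤ 3 / 5 := by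
    intro z hz
    refine (norm_add_le _ _).trans ?_
    rw [norm_mul, Complex.norm_real, Real.norm_of_nonneg hρ0.le]
    nlinarith
  have hρi : 1 ≤ (ρ ^ 2)⁻¹ := (one_le_inv₀ (by positivity)).mpr (pow_le_one₀ hρ0.le hρ1)
  set N' := 2 * (ρ ^ 2)⁻¹ * N with hN'
  have hNN : 2 * N ≤ N' := by rw [hN']; nlinarith
  have hg' : Gok k δ δ N' α (gs x ρ g) := (gs_ok hg hβ hK x hρ0 hρ1).mono hβρ hKρ (by
    have : ρ ^ α ≤ 1 := rpow_le_one hρ0.le hρ1 hα0.le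
    nlinarith)
  have hg0 : |gs x ρ g 0 0 0 0| ≤ N' := by
    have h1 := hg.hol x 0 0 0 0
    have h2 : ‖x‖ ^ α ≤ 1 := rpow_le_one (norm_nonneg _) (by linarith) hα0.le
    simp only [norm_zero, abs_zero, add_zero, mul_zero, zero_add, sub_zero] at h1
    simp only [gs, mul_zero, add_zero]
    have h3 : N * ‖x‖ ^ α ≤ N := by nlinarith
    have h4 := abs_sub_abs_le_abs_sub (g x 0 0 0) (g 0 0 0 0)
    linarith
  obtain ⟨S, P, τ, μ, b1, b2, b3, b4, hexp⟩ := H (gs x ρ g) (fun z => (ρ ^ 2)⁻¹ * u (x + ρ * z)) N' (by positivity) hg' hg0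
    (fun z hz => by
      have h1 := hu (x + ρ * z) (hin z hz)
      rw [abs_mul, abs_of_pos (by positivity : 0 < (ρ ^ 2)⁻¹)]
      have h2 : (ρ ^ 2)⁻¹ * |u (x + ρ * z)| ≤ (ρ ^ 2)⁻¹ * N := mul_le_mul_of_nonneg_left h1 (by positivity)
      have h3 : 0 < (ρ ^ 2)⁻¹ * N := by positivity
      rw [hN']; linarith)
    (by
      refine continuousOn_const.mul (huc.comp (by fun_prop) ?_)
      intro z hz
      have := hin z (by simpa using hz)
      simpa using this)
    (fun z hz => gs_Vsub hρ0 (hv _ (hin z hz.le)).1)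
    (fun z hz => gs_Vsup hρ0 (hv _ (hin z hz.le)).2)
  have eN : C * N' = C1 * N := by rw [hN', hC1]; ring
  rw [eN] at b1 b2 b3 b4 hexp
  have hCN : 0 < C2 * N := by positivity
  refine ⟨ρ * P, τ, μ, ?_, by linarith, by linarith, ?_⟩
  · rw [norm_mul, Complex.norm_real, Real.norm_of_nonneg hρ0.le]
    have : ρ * ‖P‖ ≤ ‖P‖ := mul_le_of_le_one_left (norm_nonneg _) hρ1
    linarith
  · intro y hy
    refine (unscale hρ0 hα0 hexp y hy).trans ?_
    have : 0 ≤ ‖y‖ ^ (2 + α) := by positivity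
    have e : ρ ^ 2 * (C1 * N * ρ⁻¹ ^ (2 + α)) = C2 * N := by rw [hC2]; ring
    rw [e]
    have : 0 ≤ C1 * N := by positivity
    gcongr
    linarith

/-- derivative of quadratics: recentering -/
lemma Qd_shift (S : ℝ) (P : ℂ) (τ : ℝ) (μ h y : ℂ) :
    Qd S P τ μ (h + y) = Qd (Qd S P τ μ h) (P + ((τ / 2 : ℝ) * h + (1 / 2 : ℝ) * (μ * starRingEnd ℂ h))) τ μ y := by
  simp only [Qd, Complex.add_re, Complex.add_im, Complex.mul_re, Complex.mul_im, Complex.ofReal_re, Complex.ofReal_im,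
    Complex.conj_re, Complex.conj_im]
  ring

lemma coef_hol {u : ℂ → ℝ} {P : ℂ → ℂ} {τ : ℂ → ℝ} {μ : ℂ → ℂ} {D r α R : ℝ} (hα0 : 0 < α) (hα1 : α ≤ 1)
    (hD : 0 ≤ D)
    (H : ∀ x : ℂ, ‖x‖ ≤ R → ∀ y : ℂ, ‖y‖ ≤ r → |u (x + y) - Qd (u x) (P x) (τ x) (μ x) y| ≤ D * ‖y‖ ^ (2 + α))
    {x h : ℂ} (hx : ‖x‖ ≤ R) (hxh : ‖x + h‖ ≤ R) (hh : 2 * ‖h‖ ≤ r) :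
    ‖P (x + h) - P x - ((τ x / 2 : ℝ) * h + (1 / 2 : ℝ) * (μ x * starRingEnd ℂ h))‖ ≤ 18 * D * ‖h‖ ^ (1 + α) ∧
    |τ (x + h) - τ x| ≤ 72 * D * ‖h‖ ^ α ∧ ‖μ (x + h) - μ x‖ ≤ 108 * D * ‖h‖ ^ α := by
  by_cases h0 : h = 0
  · subst h0
    simp [zero_rpow hα0.ne', zero_rpow (by positivity : (1 + α) ≠ 0)]
  have hn : 0 < ‖h‖ := norm_pos_iff.mpr h0
  have key : ∀ y : ℂ, ‖y‖ ≤ ‖h‖ → |Qd (u (x + h) - Qd (u x) (P x) (τ x) (μ x) h)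
      (P (x + h) - (P x + ((τ x / 2 : ℝ) * h + (1 / 2 : ℝ) * (μ x * starRingEnd ℂ h)))) (τ (x + h) - τ x) (μ (x + h) - μ x) y| ≤
      9 * D * ‖h‖ ^ (2 + α) := by
    intro y hy
    rw [← Qd_sub, ← Qd_shift]
    have h1 := H (x + h) hxh y (by linarith)
    have h2 := H x hx (h + y) ((norm_add_le _ _).trans (by linarith))
    rw [← add_assoc] at h2
    have e1 : ‖y‖ ^ (2 + α) ≤ ‖h‖ ^ (2 + α) := rpow_le_rpow (norm_nonneg _) hy (by positivity)
    have e2 : ‖h + y‖ ^ (2 + α) ≤ 8 * ‖h‖ ^ (2 + α) := by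
      calc ‖h + y‖ ^ (2 + α) ≤ (2 * ‖h‖) ^ (2 + α) := rpow_le_rpow (norm_nonneg _) ((norm_add_le _ _).trans (by linarith)) (by positivity)
        _ = 2 ^ (2 + α) * ‖h‖ ^ (2 + α) := mul_rpow (by norm_num) hn.le
        _ ≤ 8 * ‖h‖ ^ (2 + α) := by
          gcongr
          calc (2:ℝ) ^ (2 + α) ≤ 2 ^ (3:ℝ) := rpow_le_rpow_of_exponent_le (by norm_num) (by linarith)
            _ = 8 := by norm_num
    have f1 := mul_le_mul_of_nonneg_left e1 hD
    have f2 := mul_le_mul_of_nonneg_left e2 hD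
    rw [abs_le] at h1 h2 ⊢
    constructor <;> linarith [h1.1, h1.2, h2.1, h2.2]
  obtain ⟨-, c1, c2, c3⟩ := Qd_coef hn key
  have p1 : ‖h‖ ^ (2 + α) = ‖h‖ ^ 2 * ‖h‖ ^ α := by rw [rpow_add hn]; norm_cast
  have p2 : ‖h‖ ^ (1 + α) = ‖h‖ * ‖h‖ ^ α := by rw [rpow_add hn, rpow_one]
  rw [p1] at c1 c2 c3
  rw [p2, sub_sub]
  refine ⟨c1.trans (le_of_eq ?_), c2.trans (le_of_eq ?_), c3.trans (le_of_eq ?_)⟩ <;> field_simp <;> ring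

lemma hasFD_of {E G : Type*} [NormedAddCommGroup E] [NormedSpace ℝ E] [NormedAddCommGroup G] [NormedSpace ℝ G]
    {f : E → G} {A : E →L[ℝ] G} {x : E} {D r a : ℝ} (ha : 0 < a) (hr : 0 < r)
    (H : ∀ h : E, ‖h‖ ≤ r → ‖f (x + h) - f x - A h‖ ≤ D * ‖h‖ ^ (1 + a)) : HasFDerivAt f A x := by
  rw [hasFDerivAt_iff_isLittleO_nhds_zero]
  have h1 : (fun h : E => f (x + h) - f x - A h) =O[nhds 0] (fun h => ‖h‖ ^ (1 + a)) := by
    apply Asymptotics.IsBigO.of_bound D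
    filter_upwards [closedBall_mem_nhds (0:E) hr] with h hh
    have := H h (by simpa using hh)
    rwa [Real.norm_of_nonneg (by positivity)]
  refine h1.trans_isLittleO ?_
  rw [Asymptotics.isLittleO_iff]
  intro c hc
  have ht : Filter.Tendsto (fun h : E => ‖h‖ ^ a) (nhds 0) (nhds 0) := by
    have : ContinuousAt (fun h : E => ‖h‖ ^ a) 0 := continuous_norm.continuousAt.rpow_const (Or.inr ha.le)
    simpa [ContinuousAt, zero_rpow ha.ne'] using this
  filter_upwards [ht.eventually (ge_mem_nhds hc)] with h hh
  rw [Real.norm_of_nonneg (by positivity)]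
  by_cases h0 : h = 0
  · subst h0; simp [zero_rpow (by positivity : (1 + a) ≠ 0)]
  rw [rpow_add (norm_pos_iff.mpr h0), rpow_one, mul_comm]
  gcongr

lemma contAt_of {E G : Type*} [NormedAddCommGroup E] [NormedAddCommGroup G]
    {f : E → G} {x : E} {D r a : ℝ} (ha : 0 < a) (hr : 0 < r)
    (H : ∀ h : E, ‖h‖ ≤ r → ‖f (x + h) - f x‖ ≤ D * ‖h‖ ^ a) : ContinuousAt f x := by
  have ht : Filter.Tendsto (fun y : E => D * ‖y - x‖ ^ a) (nhds x) (nhds 0) := by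
    have : ContinuousAt (fun y : E => D * ‖y - x‖ ^ a) x :=
      continuousAt_const.mul ((continuousAt_id.sub continuousAt_const).norm.rpow_const (Or.inr ha.le))
    simpa [ContinuousAt, zero_rpow ha.ne'] using this
  rw [ContinuousAt, tendsto_iff_norm_sub_tendsto_zero]
  refine squeeze_zero' (Filter.Eventually.of_forall fun _ => norm_nonneg _) ?_ ht
  filter_upwards [closedBall_mem_nhds x hr] with y hy
  have := H (y - x) (by simpa [dist_eq_norm] using hy)
  simpa using this

/-- second derivative map -/
def A2 (τ : ℝ) (μ : ℂ) : ℂ →L[ℝ] ℂ :=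
  (τ / 2) • ContinuousLinearMap.id ℝ ℂ + (1 / 2 : ℝ) • (ContinuousLinearMap.mul ℝ ℂ μ).comp (Complex.conjCLE : ℂ →L[ℝ] ℂ)

lemma A2_apply (τ : ℝ) (μ h : ℂ) : A2 τ μ h = (τ / 2 : ℝ) * h + (1 / 2 : ℝ) * (μ * starRingEnd ℂ h) := by
  simp [A2]

lemma inner_C (P v : ℂ) : innerSL ℝ P v = P.re * v.re + P.im * v.im := by
  rw [innerSL_apply_apply, Complex.inner]; simp; ring

lemma Qd_le (τ : ℝ) (μ y : ℂ) : |Qd 0 0 τ μ y| ≤ (|τ| + ‖μ‖) * ‖y‖ ^ 2 := by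
  have e : Qd 0 0 τ μ y = τ / 4 * ‖y‖ ^ 2 + (μ.re * (y ^ 2).re + μ.im * (y ^ 2).im) / 4 := by
    rw [Complex.sq_norm, Complex.normSq_apply, sq y, Complex.mul_re, Complex.mul_im]; simp [Qd]; ring
  have h1 := dot_le μ (y ^ 2)
  rw [norm_pow] at h1
  rw [e]
  refine (abs_add_le _ _).trans ?_
  rw [abs_mul, abs_div, abs_div, abs_of_nonneg (sq_nonneg ‖y‖), abs_of_pos (by norm_num : (0:ℝ) < 4)]
  have := mul_nonneg (abs_nonneg τ) (sq_nonneg ‖y‖)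
  have := mul_nonneg (norm_nonneg μ) (sq_nonneg ‖y‖)
  linarith

section B
variable {u : ℂ → ℝ} {P : ℂ → ℂ} {τ : ℂ → ℝ} {μ : ℂ → ℂ} {D r α R : ℝ} (hα0 : 0 < α) (hα1 : α ≤ 1)
    (hD : 0 ≤ D) (hr : 0 < r)
    (H : ∀ x : ℂ, ‖x‖ ≤ R → ∀ y : ℂ, ‖y‖ ≤ r → |u (x + y) - Qd (u x) (P x) (τ x) (μ x) y| ≤ D * ‖y‖ ^ (2 + α))
include hα0 hα1 hD hr H

lemma B_du {x : ℂ} (hx : ‖x‖ ≤ R) : HasFDerivAt u (innerSL ℝ (P x)) x := by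
  refine hasFD_of (a := 1) (D := D + (|τ x| + ‖μ x‖)) (r := min r 1) one_pos (by positivity) ?_
  intro h hh
  have h1 := H x hx h (hh.trans (min_le_left _ _))
  have hh1 := hh.trans (min_le_right _ _)
  have e : u (x + h) - u x - innerSL ℝ (P x) h = (u (x + h) - Qd (u x) (P x) (τ x) (μ x) h) + Qd 0 0 (τ x) (μ x) h := by
    rw [inner_C]; simp [Qd]; ring
  have h2 : ‖h‖ ^ (2 + α) ≤ ‖h‖ ^ (2:ℝ) := by
    by_cases h0 : h = 0
    · subst h0; simp [zero_rpow (by positivity : (2 + α) ≠ 0)]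
    exact rpow_le_rpow_of_exponent_ge (norm_pos_iff.mpr h0) hh1 (by linarith)
  have h3 := Qd_le (τ x) (μ x) h
  rw [rpow_two] at h2
  rw [e, show (1:ℝ) + 1 = 2 by norm_num, rpow_two, Real.norm_eq_abs]
  refine (abs_add_le _ _).trans ?_
  have := mul_le_mul_of_nonneg_left h2 hD
  linarith

lemma B_small {x : ℂ} (hx : ‖x‖ < R) {h : ℂ} (hh : ‖h‖ ≤ min (r / 2) (R - ‖x‖)) : ‖x + h‖ ≤ R ∧ 2 * ‖h‖ ≤ r := by
  have := norm_add_le x h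
  have h1 := hh.trans (min_le_left _ _)
  have h2 := hh.trans (min_le_right _ _)
  constructor <;> linarith

lemma B_dP {x : ℂ} (hx : ‖x‖ < R) : HasFDerivAt P (A2 (τ x) (μ x)) x := by
  refine hasFD_of (a := α) (D := 18 * D) (r := min (r / 2) (R - ‖x‖)) hα0 (lt_min (by positivity) (by linarith)) ?_
  intro h hh
  obtain ⟨h1, h2⟩ := B_small hα0 hα1 hD hr H hx hh
  rw [A2_apply]
  exact (coef_hol hα0 hα1 hD H hx.le h1 h2).1

lemma B_cont {x : ℂ} (hx : ‖x‖ < R) : ContinuousAt τ x ∧ ContinuousAt μ x := by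
  have h0 : 0 < min (r / 2) (R - ‖x‖) := lt_min (by positivity) (by linarith)
  constructor
  · refine contAt_of (a := α) (D := 72 * D) hα0 h0 ?_
    intro h hh
    obtain ⟨h1, h2⟩ := B_small hα0 hα1 hD hr H hx hh
    exact (coef_hol hα0 hα1 hD H hx.le h1 h2).2.1
  · refine contAt_of (a := α) (D := 108 * D) hα0 h0 ?_
    intro h hh
    obtain ⟨h1, h2⟩ := B_small hα0 hα1 hD hr H hx hh
    exact (coef_hol hα0 hα1 hD H hx.le h1 h2).2.2

lemma B_C2 {x : ℂ} (hx : ‖x‖ < R) : ContDiffAt ℝ 2 u x := by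
  have hb : ball (0:ℂ) R ∈ nhds x := isOpen_ball.mem_nhds (by simpa using hx)
  have hP : ContDiffAt ℝ 1 P x := by
    rw [contDiffAt_one_iff]
    refine ⟨fun z => A2 (τ z) (μ z), ball 0 R, hb, ?_, ?_⟩
    · intro z hz
      have hz' : ‖z‖ < R := by simpa using hz
      obtain ⟨h1, h2⟩ := B_cont hα0 hα1 hD hr H hz'
      refine ContinuousAt.continuousWithinAt ?_
      unfold A2
      fun_prop
    · intro z hz
      exact B_dP hα0 hα1 hD hr H (by simpa using hz)
  have := (contDiffAt_succ_iff_hasFDerivAt (𝕜 := ℝ) (n := 1) (f := u) (x := x)).mpr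
    ⟨fun z => innerSL ℝ (P z), ⟨ball 0 R, hb, fun z hz => B_du hα0 hα1 hD hr H (le_of_lt (by simpa using hz))⟩,
      (innerSL ℝ).contDiff.contDiffAt.comp x hP⟩
  have e : ((1:ℕ) : WithTop ℕ∞) + 1 = 2 := by norm_num
  rwa [e] at this

lemma B_hol (h1D : ∀ x, ‖x‖ ≤ R → |τ x| ≤ D ∧ ‖μ x‖ ≤ D) {x y : ℂ} (hx : ‖x‖ ≤ R) (hy : ‖y‖ ≤ R) :
    |τ x - τ y| ≤ (108 + 2 * (2 / r) ^ α) * D * ‖x - y‖ ^ α ∧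
    ‖μ x - μ y‖ ≤ (108 + 2 * (2 / r) ^ α) * D * ‖x - y‖ ^ α := by
  have hq : 0 ≤ D * ‖x - y‖ ^ α := by positivity
  have hq2 : 0 ≤ (2 / r) ^ α * (D * ‖x - y‖ ^ α) := by positivity
  by_cases hh : 2 * ‖x - y‖ ≤ r
  · have := coef_hol hα0 hα1 hD H (x := y) (h := x - y) hy (by simpa using hx) hh
    simp only [add_sub_cancel] at this
    obtain ⟨-, h2, h3⟩ := this
    constructor <;> linarith
  · push Not at hh
    have h1 : 1 ≤ (2 / r) ^ α * ‖x - y‖ ^ α := by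
      rw [← mul_rpow (by positivity) (by positivity)]
      apply one_le_rpow _ hα0.le
      rw [div_mul_eq_mul_div, le_div_iff₀ hr]; linarith
    have h2 := mul_le_mul_of_nonneg_left h1 hD
    obtain ⟨a1, a2⟩ := h1D x hx
    obtain ⟨b1, b2⟩ := h1D y hy
    have c1 := norm_sub_le (τ x) (τ y)
    have c2 := norm_sub_le (μ x) (μ y)
    simp only [Real.norm_eq_abs] at c1
    constructor <;> linarith
end B

/-- matrix with trace `t` and deviator `m` -/
def Mt (t : ℝ) (m : ℂ) : Mat2 := !![(t + m.re) / 2, m.im / 2; m.im / 2, (t - m.re) / 2]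

lemma Mt_herm (t : ℝ) (m : ℂ) : (Mt t m).IsHermitian := by
  ext i j
  fin_cases i <;> fin_cases j <;> simp [Mt]

lemma Mt_sub (t t' : ℝ) (m m' : ℂ) : Mt t m - Mt t' m' = Mt (t - t') (m - m') := by
  ext i j
  fin_cases i <;> fin_cases j <;> simp [Mt] <;> ring

lemma Mt_zero : Mt 0 0 = 0 := by
  ext i j
  fin_cases i <;> fin_cases j <;> simp [Mt]

lemma Mt_norm (t : ℝ) (m : ℂ) : matNorm (Mt t m) ≤ |t| + 2 * ‖m‖ := by
  have h1 := Complex.abs_re_le_norm m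
  have h2 := Complex.abs_im_le_norm m
  have h3 := abs_add_le t m.re
  have h4 := abs_sub t m.re
  simp only [matNorm, Fin.sum_univ_two, Mt]
  simp only [Matrix.of_apply, Matrix.cons_val', Matrix.cons_val_zero, Matrix.cons_val_one, Matrix.cons_val_fin_one, abs_div, abs_two]
  linarith

lemma Mt_eig (t : ℝ) (m : ℂ) : ∃ a b : ℝ, a + b = t ∧ a - b = ‖m‖ ∧
    posNorm (Mt t m) = max a 0 + max b 0 ∧ negNorm (Mt t m) = max (-a) 0 + max (-b) 0 := by
  have h := Mt_herm t m
  have h1 := h.trace_eq_sum_eigenvalues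
  have h2 := h.det_eq_prod_eigenvalues
  simp only [Fin.sum_univ_two, Fin.prod_univ_two, Matrix.trace_fin_two, Matrix.det_fin_two] at h1 h2
  have e1 : h.eigenvalues 0 + h.eigenvalues 1 = t := by
    have : (Mt t m 0 0 + Mt t m 1 1) = t := by simp [Mt]; ring
    rw [this] at h1; simpa using h1.symm
  have e2 : (h.eigenvalues 0 - h.eigenvalues 1) ^ 2 = ‖m‖ ^ 2 := by
    have : (Mt t m 0 0 * Mt t m 1 1 - Mt t m 0 1 * Mt t m 1 0) = (t ^ 2 - ‖m‖ ^ 2) / 4 := by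
      rw [Complex.sq_norm, Complex.normSq_apply]; simp [Mt]; ring
    rw [this] at h2
    have h3 : (t ^ 2 - ‖m‖ ^ 2) / 4 = h.eigenvalues 0 * h.eigenvalues 1 := by simpa using h2
    linear_combination (h.eigenvalues 0 + h.eigenvalues 1 + t) * e1 + 4 * h3
  have p1 : posNorm (Mt t m) = max (h.eigenvalues 0) 0 + max (h.eigenvalues 1) 0 := by
    rw [posNorm, dif_pos h, Fin.sum_univ_two]
  have p2 : negNorm (Mt t m) = max (-h.eigenvalues 0) 0 + max (-h.eigenvalues 1) 0 := by
    rw [negNorm, dif_pos h, Fin.sum_univ_two]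
  rcases sq_eq_sq_iff_eq_or_eq_neg.mp e2 with e | e
  · exact ⟨_, _, e1, e, p1, p2⟩
  · exact ⟨h.eigenvalues 1, h.eigenvalues 0, by linarith, by linarith, by rw [p1]; ring, by rw [p2]; ring⟩

lemma pucci {lam Lam : ℝ} (hlam : 0 < lam) (hLam : lam ≤ Lam) {t : ℝ} {m : ℂ}
    (h : t + (Lam - lam) / (Lam + lam) * ‖m‖ ≤ 0) :
    Lam * posNorm (Mt t m) - lam * negNorm (Mt t m) ≤ lam * (t + (Lam - lam) / (Lam + lam) * ‖m‖) := by
  obtain ⟨a, b, h1, h2, h3, h4⟩ := Mt_eig t m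
  have hm := norm_nonneg m
  have hs : 0 < Lam + lam := by linarith
  set k := (Lam - lam) / (Lam + lam) with hk
  have hk0 : 0 ≤ k := div_nonneg (by linarith) hs.le
  have hkm : 0 ≤ k * ‖m‖ := by positivity
  have hke : k * (Lam + lam) = Lam - lam := by rw [hk]; field_simp
  rw [h3, h4]
  have hb : b ≤ 0 := by linarith
  rw [max_eq_right hb, max_eq_left (by linarith : 0 ≤ -b)]
  rcases le_total a 0 with ha | ha
  · rw [max_eq_right ha, max_eq_left (by linarith : 0 ≤ -a)]
    have := mul_nonneg hlam.le hkm
    have : lam * t = lam * a + lam * b := by rw [← h1]; ring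
    linarith
  · rw [max_eq_left ha, max_eq_right (by linarith : -a ≤ 0)]
    have h5 : 2 * a ≤ (1 - k) * ‖m‖ := by linarith
    have h6 := mul_le_mul_of_nonneg_left h5 (by linarith : 0 ≤ Lam - lam)
    have h7 : (Lam - lam) * ((1 - k) * ‖m‖) = 2 * (lam * (k * ‖m‖)) := by
      rw [← hke]
      have : k * (Lam + lam) * k = k * (Lam - lam) := by rw [← hke]; ring
      linear_combination (-‖m‖) * this
    have : lam * t = lam * a + lam * b := by rw [← h1]; ring
    linarith

lemma pucci' {lam Lam : ℝ} {t : ℝ} (ht : 0 ≤ t) :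
    Lam * posNorm (Mt t 0) - lam * negNorm (Mt t 0) ≤ Lam * t := by
  obtain ⟨a, b, h1, h2, h3, h4⟩ := Mt_eig t 0
  rw [norm_zero] at h2
  rw [h3, h4, max_eq_left (by linarith : 0 ≤ a), max_eq_left (by linarith : 0 ≤ b), max_eq_right (by linarith : -a ≤ 0),
    max_eq_right (by linarith : -b ≤ 0), h1]
  linarith

section F
variable {lam Lam b c : ℝ} {F : Mat2 → E2 → ℝ → E2 → ℝ} (hlam : 0 < lam) (hLam : lam ≤ Lam) (hb : 0 ≤ b) (hc : 0 ≤ c)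
  (hF : UniformlyEllipticGen lam Lam b c F)
include hlam hLam hb hc hF

lemma cmpF {x : E2} (hx : x ∈ ball (0 : E2) 1) {t t' : ℝ} {m m' : ℂ} {p p' : E2} {s s' e : ℝ} (he : 0 ≤ e)
    (h : F (Mt t m) p s x ≤ F (Mt t' m') p' s' x + e) :
    t - t' ≤ (Lam - lam) / (Lam + lam) * ‖m - m'‖ + (b + c) / lam * (‖p - p'‖ + |s - s'|) + e / lam := by
  have hk0 : 0 ≤ (Lam - lam) / (Lam + lam) := div_nonneg (by linarith) (by linarith)
  have h1 := hF (Mt t' m') (Mt t m) p' p s' s x (Mt_herm _ _) (Mt_herm _ _) hx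
  rw [Mt_sub, norm_sub_rev p', abs_sub_comm s'] at h1
  have hp := norm_nonneg (p - p')
  have hs := abs_nonneg (s - s')
  have hbc : 0 ≤ (b + c) / lam * (‖p - p'‖ + |s - s'|) := by positivity
  have hel : 0 ≤ e / lam := by positivity
  rcases le_total ((t' - t) + (Lam - lam) / (Lam + lam) * ‖m' - m‖) 0 with h2 | h2
  · have h3 := pucci hlam hLam h2
    rw [norm_sub_rev m'] at h3
    have e1 : lam * ((b + c) / lam * (‖p - p'‖ + |s - s'|)) = (b + c) * (‖p - p'‖ + |s - s'|) := by field_simp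
    have e2 : lam * (e / lam) = e := by field_simp
    refine le_of_mul_le_mul_left ?_ hlam
    have := mul_nonneg hb hs
    have := mul_nonneg hc hp
    linarith
  · rw [norm_sub_rev m'] at h2
    linarith

lemma exF {x : E2} (hx : x ∈ ball (0 : E2) 1) (m : ℂ) (p : E2) (s v : ℝ) : ∃ t, F (Mt t m) p s x = v := by
  have key1 : ∀ t t' : ℝ, t' ≤ t → lam * (t - t') ≤ F (Mt t m) p s x - F (Mt t' m) p s x := by
    intro t t' h
    have h1 := hF (Mt t' m) (Mt t m) p p s s x (Mt_herm _ _) (Mt_herm _ _) hx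
    rw [Mt_sub, sub_self] at h1
    have h2 := pucci hlam hLam (t := t' - t) (m := 0) (by simpa using h)
    simp at h1 h2
    linarith
  have key2 : ∀ t t' : ℝ, t' ≤ t → F (Mt t m) p s x - F (Mt t' m) p s x ≤ Lam * (t - t') := by
    intro t t' h
    have h1 := hF (Mt t m) (Mt t' m) p p s s x (Mt_herm _ _) (Mt_herm _ _) hx
    rw [Mt_sub, sub_self] at h1
    have h2 := pucci' (lam := lam) (Lam := Lam) (t := t - t') (by linarith)
    simp at h1 h2
    linarith
  have hcont : Continuous (fun t => F (Mt t m) p s x) := by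
    have : LipschitzWith (Real.toNNReal Lam) (fun t => F (Mt t m) p s x) := by
      apply LipschitzWith.of_le_add_mul
      intro t t'
      rw [Real.coe_toNNReal _ (by linarith), Real.dist_eq]
      rcases le_total t t' with h | h
      · have := key1 t' t h
        have h2 : 0 ≤ Lam * |t - t'| := mul_nonneg (by linarith) (abs_nonneg _)
        have h3 : 0 ≤ lam * (t' - t) := mul_nonneg hlam.le (by linarith)
        linarith
      · rw [abs_of_nonneg (by linarith)]
        linarith [key2 t t' h]
    exact this.continuous
  set d := |v - F (Mt 0 m) p s x| / lam with hd
  have hd0 : 0 ≤ d := by positivity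
  have hld : lam * d = |v - F (Mt 0 m) p s x| := by rw [hd]; field_simp
  have h1 := key1 d 0 hd0
  have h2 := key1 0 (-d) (by linarith)
  have a1 := le_abs_self (v - F (Mt 0 m) p s x)
  have a2 := neg_abs_le (v - F (Mt 0 m) p s x)
  have := mem_range_of_exists_le_of_exists_ge hcont ⟨-d, (by linarith : F (Mt (-d) m) p s x ≤ v)⟩ ⟨d, (by linarith : v ≤ F (Mt d m) p s x)⟩
  exact this
end F

/-- coordinatewise clamp -/
def cl (z : ℂ) : ℂ := ⟨max (-(3 / 5)) (min z.re (3 / 5)), max (-(3 / 5)) (min z.im (3 / 5))⟩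

lemma cl_eq {z : ℂ} (hz : ‖z‖ ≤ 3 / 5) : cl z = z := by
  have h1 := abs_le.mp ((Complex.abs_re_le_norm z).trans hz)
  have h2 := abs_le.mp ((Complex.abs_im_le_norm z).trans hz)
  apply Complex.ext
  · simp only [cl]; rw [min_eq_left h1.2, max_eq_right h1.1]
  · simp only [cl]; rw [min_eq_left h2.2, max_eq_right h2.1]

lemma sq_norm_C (z : ℂ) : ‖z‖ ^ 2 = z.re ^ 2 + z.im ^ 2 := by
  rw [Complex.sq_norm, Complex.normSq_apply]; ring

lemma cl_lt (z : ℂ) : ‖cl z‖ < 1 := by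
  have key : ∀ a : ℝ, (max (-(3 / 5)) (min a (3 / 5))) ^ 2 ≤ 9 / 25 := by
    intro a
    have h1 : -(3 / 5) ≤ max (-(3 / 5)) (min a (3 / 5)) := le_max_left _ _
    have h2 : max (-(3 / 5)) (min a (3 / 5)) ≤ 3 / 5 := max_le (by norm_num) (min_le_right _ _)
    nlinarith
  have := sq_norm_C (cl z)
  have h1 := key z.re
  have h2 := key z.im
  simp only [cl] at this
  have : ‖cl z‖ ^ 2 < 1 ^ 2 := by simp only [cl]; linarith
  exact lt_of_pow_lt_pow_left₀ 2 (by norm_num) this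

lemma clamp_lip (a b : ℝ) : |max (-(3 / 5)) (min a (3 / 5)) - max (-(3 / 5)) (min b (3 / 5))| ≤ |a - b| := by
  have h1 := abs_max_sub_max_le_max (-(3/5)) (min a (3/5)) (-(3/5)) (min b (3/5))
  have h2 := abs_min_sub_min_le_max a (3/5) b (3/5)
  simp at h1 h2
  exact h1.trans h2

lemma cl_lip (z z' : ℂ) : ‖cl z - cl z'‖ ≤ ‖z - z'‖ := by
  refine (pow_le_pow_iff_left₀ (norm_nonneg _) (norm_nonneg _) two_ne_zero).mp ?_
  rw [sq_norm_C, sq_norm_C]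
  have h1 := sq_le_sq.mpr (clamp_lip z.re z'.re)
  have h2 := sq_le_sq.mpr (clamp_lip z.im z'.im)
  simp only [cl, Complex.sub_re, Complex.sub_im]
  linarith

/-- the isometry between `ℂ` and the plane -/
def eC : ℂ ≃ₗᵢ[ℝ] E2 := Complex.orthonormalBasisOneI.repr

lemma eC_apply (z : ℂ) (i : Fin 2) : eC z i = ![z.re, z.im] i := by
  simp [eC, Complex.orthonormalBasisOneI_repr_apply]

lemma eC_symm_s0 : eC.symm (EuclideanSpace.single 0 1) = 1 := by
  rw [LinearIsometryEquiv.symm_apply_eq]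
  ext i; rw [eC_apply]; fin_cases i <;> simp

lemma eC_symm_s1 : eC.symm (EuclideanSpace.single 1 1) = Complex.I := by
  rw [LinearIsometryEquiv.symm_apply_eq]
  ext i; rw [eC_apply]; fin_cases i <;> simp

/-- if `v` is differentiable near `z0` with gradient `P`, itself differentiable, we know the derivatives of `v ∘ e⁻¹` -/
lemma transfer {v : ℂ → ℝ} {P : ℂ → ℂ} {τ : ℝ} {μ : ℂ} {x : E2}
    (h1 : ∀ᶠ z in nhds (eC.symm x), HasFDerivAt v (innerSL ℝ (P z)) z)
    (h2 : HasFDerivAt P (A2 τ μ) (eC.symm x)) :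
    HasFDerivAt (fun y => v (eC.symm y)) (innerSL ℝ (eC (P (eC.symm x)))) x ∧
    hess (fun y => v (eC.symm y)) x = Mt τ μ := by
  have hd : ∀ y, HasFDerivAt (fun y => eC.symm y) (eC.symm.toContinuousLinearEquiv : E2 →L[ℝ] ℂ) y :=
    fun y => (eC.symm.toContinuousLinearEquiv : E2 →L[ℝ] ℂ).hasFDerivAt
  have hev : ∀ᶠ y in nhds x, HasFDerivAt (fun y => v (eC.symm y))
      ((innerSL ℝ (P (eC.symm y))).comp (eC.symm.toContinuousLinearEquiv : E2 →L[ℝ] ℂ)) y := by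
    filter_upwards [eC.symm.continuous.continuousAt.eventually h1] with y hy
    exact hy.comp y (hd y)
  constructor
  · have := hev.self_of_nhds
    have e : innerSL ℝ (eC (P (eC.symm x))) = (innerSL ℝ (P (eC.symm x))).comp (eC.symm.toContinuousLinearEquiv : E2 →L[ℝ] ℂ) := by
      refine ContinuousLinearMap.ext fun w => ?_
      rw [ContinuousLinearMap.comp_apply, innerSL_apply_apply, innerSL_apply_apply, ← eC.symm.inner_map_map, eC.symm_apply_apply]
      rfl
    rw [e]; exact this
  · have hP : HasFDerivAt (fun y => P (eC.symm y)) ((A2 τ μ).comp (eC.symm.toContinuousLinearEquiv : E2 →L[ℝ] ℂ)) x :=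
      h2.comp x (hd x)
    have key : ∀ w : E2, HasFDerivAt (fun y => fderiv ℝ (fun y => v (eC.symm y)) y w)
        ((innerSL ℝ (eC.symm w)).comp ((A2 τ μ).comp (eC.symm.toContinuousLinearEquiv : E2 →L[ℝ] ℂ))) x := by
      intro w
      have h3 := (innerSL ℝ (eC.symm w)).hasFDerivAt.comp x hP
      refine h3.congr_of_eventuallyEq ?_
      filter_upwards [hev] with y hy
      rw [hy.fderiv]
      simp; ring
    ext i j
    simp only [hess, Matrix.of_apply]
    rw [(key _).fderiv]
    have hc : ∀ w : E2, (eC.symm.toContinuousLinearEquiv : E2 →L[ℝ] ℂ) w = eC.symm w := fun _ => rfl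
    simp only [ContinuousLinearMap.comp_apply, hc, inner_C, A2_apply]
    fin_cases i <;> fin_cases j <;> simp [eC_symm_s0, eC_symm_s1, Mt] <;> ring

lemma Qd_deriv (P : ℂ) (τ : ℝ) (μ z0 z : ℂ) :
    HasFDerivAt (fun z => Qd 0 P τ μ (z - z0)) (innerSL ℝ (P + A2 τ μ (z - z0))) z := by
  refine hasFD_of (a := 1) (D := |τ| + ‖μ‖) (r := 1) one_pos one_pos ?_
  intro h _
  have e : Qd 0 P τ μ (z + h - z0) - Qd 0 P τ μ (z - z0) - innerSL ℝ (P + A2 τ μ (z - z0)) h = Qd 0 0 τ μ h := by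
    rw [show z + h - z0 = (z - z0) + h by ring, Qd_shift, inner_C, A2_apply]
    simp only [Qd]; simp; ring
  rw [e, show (1:ℝ) + 1 = 2 by norm_num, rpow_two]
  exact Qd_le τ μ h

lemma test_fn (P : ℂ) (τ : ℝ) (μ z0 : ℂ) :
    ContDiff ℝ 2 (fun x : E2 => Qd 0 P τ μ (eC.symm x - z0)) ∧
    gradient (fun x : E2 => Qd 0 P τ μ (eC.symm x - z0)) (eC z0) = eC P ∧
    hess (fun x : E2 => Qd 0 P τ μ (eC.symm x - z0)) (eC z0) = Mt τ μ := by
  have h2 : HasFDerivAt (fun z => P + A2 τ μ (z - z0)) (A2 τ μ) (eC.symm (eC z0)) := by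
    have := ((A2 τ μ).hasFDerivAt.comp (eC.symm (eC z0)) ((hasFDerivAt_id (eC.symm (eC z0))).sub_const z0)).const_add P
    exact this
  obtain ⟨t1, t2⟩ := transfer (v := fun z => Qd 0 P τ μ (z - z0)) (x := eC z0)
    (Filter.Eventually.of_forall fun z => Qd_deriv P τ μ z0 z) h2
  refine ⟨?_, ?_, t2⟩
  · have h : ContDiff ℝ 2 (Qd 0 P τ μ) := by
      unfold Qd
      have hr : ContDiff ℝ 2 (fun z : ℂ => z.re) := Complex.reCLM.contDiff
      have hi : ContDiff ℝ 2 (fun z : ℂ => z.im) := Complex.imCLM.contDiff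
      fun_prop
    exact h.comp ((eC.symm.toContinuousLinearEquiv : E2 →L[ℝ] ℂ).contDiff.sub contDiff_const)
  · have : HasGradientAt (fun x : E2 => Qd 0 P τ μ (eC.symm x - z0)) (eC P) (eC z0) := by
      rw [hasGradientAt_iff_hasFDerivAt]
      have e : InnerProductSpace.toDual ℝ E2 (eC P) = innerSL ℝ (eC (P + (A2 τ μ) (eC.symm (eC z0) - z0))) := by
        refine ContinuousLinearMap.ext fun w => ?_
        rw [InnerProductSpace.toDual_apply_apply, innerSL_apply_apply, eC.symm_apply_apply, sub_self, map_zero, add_zero]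
      rw [e]; exact t1
    exact this.gradient

lemma build_g {lam Lam b c K₁ α : ℝ} (hlam : 0 < lam) (hLam : lam ≤ Lam) (hb : 0 ≤ b) (hc : 0 ≤ c) (hK1 : 0 ≤ K₁)
    (hα0 : 0 < α) {F : Mat2 → E2 → ℝ → E2 → ℝ} {f u : E2 → ℝ} {K₂ A : ℝ}
    (hF : UniformlyEllipticGen lam Lam b c F)
    (hH : ∀ (M : Mat2) (p : E2) (s : ℝ), M.IsHermitian →
              ∀ x ∈ ball (0 : E2) 1, ∀ y ∈ ball (0 : E2) 1,
                |F M p s x - F M p s y| ≤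
                  K₁ * ‖x - y‖ ^ α * (matNorm M + ‖p‖ + |s|) + K₂ * ‖x - y‖ ^ α)
    (hK20 : 0 ≤ K₂) (hK2 : K₂ ≤ A) (hF0 : |F 0 0 0 0| ≤ A) (hf : ∀ x ∈ ball (0 : E2) 1, |f x| ≤ A)
    (hfh : ∀ x ∈ ball (0 : E2) 1, ∀ y ∈ ball (0 : E2) 1, |f x - f y| ≤ A * ‖x - y‖ ^ α)
    (hv : IsViscositySolGen F f u (ball (0 : E2) 1)) :
    ∃ g : ℂ → ℝ → ℂ → ℂ → ℝ, Gok ((Lam - lam) / (Lam + lam)) ((b + c) / lam) (K₁ * (3 + (b + c) / lam) / lam)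
        ((2 + 3 * K₁ / lam) / lam * A) α g ∧ |g 0 0 0 0| ≤ 3 / lam * A ∧
      ∀ z : ℂ, ‖z‖ ≤ 3 / 5 → Vsub g (fun z => u (eC z)) z ∧ Vsup g (fun z => u (eC z)) z := by
  have hA : 0 ≤ A := hK20.trans hK2
  set k := (Lam - lam) / (Lam + lam) with hk
  set β := (b + c) / lam with hβ
  have hβ0 : 0 ≤ β := by positivity
  have hk0 : 0 ≤ k := div_nonneg (by linarith) (by linarith)
  have hk1 : k ≤ 1 := by rw [hk, div_le_one (by linarith)]; linarith
  have hin : ∀ z : ℂ, eC (cl z) ∈ ball (0 : E2) 1 := fun z => by simpa using cl_lt z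
  choose g hg using fun (z : ℂ) (s : ℝ) (p m : ℂ) => exF hlam hLam hb hc hF (hin z) m (eC p) s (f (eC (cl z)))
  have hF0x : ∀ x ∈ ball (0 : E2) 1, |F 0 0 0 x| ≤ 2 * A := by
    intro x hx
    have h0 := hH 0 0 0 (by simp) x hx 0 (by simp)
    have hx1 : ‖x‖ ≤ 1 := by have := mem_ball_zero_iff.mp hx; exact this.le
    have h1 : ‖x‖ ^ α ≤ 1 := rpow_le_one (norm_nonneg _) hx1 hα0.le
    simp [matNorm] at h0
    have h2 := mul_le_mul_of_nonneg_left h1 hK20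
    have := abs_sub_abs_le_abs_sub (F 0 0 0 x) (F 0 0 0 0)
    linarith
  have lip1 : ∀ z s s' p p' m m', g z s p m - g z s' p' m' ≤ k * ‖m - m'‖ + β * (‖p - p'‖ + |s - s'|) := by
    intro z s s' p p' m m'
    have := cmpF hlam hLam hb hc hF (hin z) (t := g z s p m) (t' := g z s' p' m') (m := m) (m' := m') (p := eC p) (p' := eC p')
      (s := s) (s' := s') le_rfl (by rw [hg, hg, add_zero])
    rw [← map_sub, LinearIsometryEquiv.norm_map] at this
    simpa using this
  have lip : ∀ z s s' p p' m m', |g z s p m - g z s' p' m'| ≤ k * ‖m - m'‖ + β * (‖p - p'‖ + |s - s'|) := by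
    intro z s s' p p' m m'
    rw [abs_le]
    have h1 := lip1 z s s' p p' m m'
    have h2 := lip1 z s' s p' p m' m
    rw [norm_sub_rev m', norm_sub_rev p', abs_sub_comm s'] at h2
    constructor <;> linarith
  have g0 : ∀ z, |g z 0 0 0| ≤ 3 / lam * A := by
    intro z
    have e0 := hg z 0 0 0
    have b1 := abs_le.mp (hf _ (hin z))
    have b2 := abs_le.mp (hF0x _ (hin z))
    have h1 := cmpF hlam hLam hb hc hF (hin z) (t := g z 0 0 0) (t' := 0) (m := 0) (m' := 0) (p := 0) (p' := 0)
      (s := 0) (s' := 0) (e := 3 * A) (by positivity) (by rw [map_zero] at e0; rw [e0, Mt_zero]; linarith)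
    have h2 := cmpF hlam hLam hb hc hF (hin z) (t := 0) (t' := g z 0 0 0) (m := 0) (m' := 0) (p := 0) (p' := 0)
      (s := 0) (s' := 0) (e := 3 * A) (by positivity) (by rw [map_zero] at e0; rw [e0, Mt_zero]; linarith)
    simp at h1 h2
    rw [abs_le, div_mul_eq_mul_div]
    constructor <;> linarith
  have gb : ∀ z s p m, |g z s p m| ≤ 3 / lam * A + ‖m‖ + β * (‖p‖ + |s|) := by
    intro z s p m
    have h1 := lip z s 0 p 0 m 0
    simp only [sub_zero] at h1
    have h2 := abs_sub_abs_le_abs_sub (g z s p m) (g z 0 0 0)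
    have h3 := g0 z
    have h4 := mul_le_mul_of_nonneg_right hk1 (norm_nonneg m)
    linarith
  have hol1 : ∀ z z' s p m, g z s p m - g z' s p m ≤
      (K₁ * (3 + β) / lam * (‖m‖ + ‖p‖ + |s|) + (2 + 3 * K₁ / lam) / lam * A) * ‖z - z'‖ ^ α := by
    intro z z' s p m
    have hd : ‖eC (cl z) - eC (cl z')‖ ^ α ≤ ‖z - z'‖ ^ α := by
      rw [← map_sub, LinearIsometryEquiv.norm_map]
      exact rpow_le_rpow (norm_nonneg _) (cl_lip z z') hα0.le
    have hd0 : 0 ≤ ‖eC (cl z) - eC (cl z')‖ ^ α := by positivity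
    have e1 := hg z s p m
    have e2 := hg z' s p m
    have e3 := hH (Mt (g z' s p m) m) (eC p) s (Mt_herm _ _) _ (hin z) _ (hin z')
    have e4 := hfh _ (hin z) _ (hin z')
    rw [LinearIsometryEquiv.norm_map] at e3
    set d := ‖eC (cl z) - eC (cl z')‖ ^ α
    have m1 : matNorm (Mt (g z' s p m) m) + ‖p‖ + |s| ≤ 3 / lam * A + (3 + β) * (‖m‖ + ‖p‖ + |s|) := by
      have a1 := Mt_norm (g z' s p m) m
      have a2 := gb z' s p m
      have a3 := mul_nonneg hβ0 (norm_nonneg m)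
      have a4 := norm_nonneg p
      have a5 := abs_nonneg s
      linarith
    have hS : 0 ≤ ‖m‖ + ‖p‖ + |s| := by positivity
    set e := (2 * A + K₁ * (3 / lam * A + (3 + β) * (‖m‖ + ‖p‖ + |s|))) * ‖z - z'‖ ^ α with he
    have he0 : 0 ≤ e := by positivity
    have hee : (2 * A + K₁ * (3 / lam * A + (3 + β) * (‖m‖ + ‖p‖ + |s|))) * d ≤ e := by
      rw [he]; gcongr
    have m2 := mul_le_mul_of_nonneg_left m1 (mul_nonneg hK1 hd0)
    have m3 := mul_le_mul_of_nonneg_right hK2 hd0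
    have m4 := abs_le.mp e3
    have m5 := abs_le.mp e4
    have := cmpF hlam hLam hb hc hF (hin z) (t := g z s p m) (t' := g z' s p m) (m := m) (m' := m) (p := eC p) (p' := eC p)
      (s := s) (s' := s) he0 (by rw [hg]; linarith)
    simp only [sub_self, norm_zero, abs_zero, mul_zero, add_zero, zero_add] at this
    refine this.trans (le_of_eq ?_)
    rw [he]; field_simp; ring
  refine ⟨g, ⟨lip, ?_⟩, g0 0, ?_⟩
  · intro z z' s p m
    rw [abs_le]
    have h1 := hol1 z z' s p m
    have h2 := hol1 z' z s p m
    rw [norm_sub_rev z'] at h2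
    constructor <;> linarith
  · intro z hz
    have hzin : eC z ∈ ball (0 : E2) 1 := by
      rw [mem_ball_zero_iff, LinearIsometryEquiv.norm_map]; linarith
    have tr : ∀ (P : ℂ) (τ : ℝ) (μ : ℂ), (fun x : E2 => u x - Qd 0 P τ μ (eC.symm x - z)) =
        (fun z' : ℂ => u (eC z') - Qd 0 P τ μ (z' - z)) ∘ eC.symm := by
      intro P τ μ; funext x; simp
    have hev : Filter.Tendsto eC.symm (nhds (eC z)) (nhds z) := by
      have := eC.symm.continuous.tendsto (eC z)
      simpa using this
    constructor
    · intro P τ μ hm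
      obtain ⟨t1, t2, t3⟩ := test_fn P τ μ z
      have h1 := (hv _ t1 (eC z) hzin).1 (by
        rw [tr]
        have := hev.eventually hm
        simpa [IsLocalMax, IsMaxFilter] using this)
      rw [t2, t3] at h1
      have e1 := hg z (u (eC z)) P μ
      have hc' := hin z
      rw [cl_eq hz] at e1 hc'
      have := cmpF hlam hLam hb hc hF hc' (t := g z (u (eC z)) P μ) (t' := τ) (m := μ) (m' := μ) (p := eC P) (p' := eC P)
        (s := u (eC z)) (s' := u (eC z)) le_rfl (by rw [e1]; linarith)
      simp at this
      linarith
    · intro P τ μ hm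
      obtain ⟨t1, t2, t3⟩ := test_fn P τ μ z
      have h1 := (hv _ t1 (eC z) hzin).2 (by
        rw [tr]
        have := hev.eventually hm
        simpa [IsLocalMin, IsMinFilter] using this)
      rw [t2, t3] at h1
      have e1 := hg z (u (eC z)) P μ
      have hc' := hin z
      rw [cl_eq hz] at e1 hc'
      have := cmpF hlam hLam hb hc hF hc' (t := τ) (t' := g z (u (eC z)) P μ) (m := μ) (m' := μ) (p := eC P) (p' := eC P)
        (s := u (eC z)) (s' := u (eC z)) le_rfl (by rw [e1]; linarith)
      simp at this
      linarith

lemma lim_eta {X C T d : ℝ} (h : ∀ η : ℝ, 0 < η → X ≤ C * (T + η) * d) : X ≤ C * T * d := by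
  have h1 : Continuous (fun η : ℝ => C * (T + η) * d) := by fun_prop
  have h2 : Filter.Tendsto (fun η : ℝ => C * (T + η) * d) (nhdsWithin 0 (Ioi 0)) (nhds (C * (T + 0) * d)) :=
    (h1.tendsto 0).mono_left nhdsWithin_le_nhds
  rw [add_zero] at h2
  refine ge_of_tendsto h2 ?_
  filter_upwards [self_mem_nhdsWithin] with η hη
  exact h η hη

lemma supAbs_nonneg (u : E2 → ℝ) (s : Set E2) : 0 ≤ supAbs u s :=
  Real.iSup_nonneg fun _ => Real.iSup_nonneg fun _ => abs_nonneg _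

lemma le_supAbs {u : E2 → ℝ} {s : Set E2} {B : ℝ} (hB : 0 ≤ B) (h : ∀ x ∈ s, |u x| ≤ B) {x : E2} (hx : x ∈ s) :
    |u x| ≤ supAbs u s := by
  have hb : BddAbove (range fun x => ⨆ (_ : x ∈ s), |u x|) := by
    refine ⟨B, ?_⟩
    rintro _ ⟨y, rfl⟩
    by_cases hy : y ∈ s
    · simpa [hy] using h y hy
    · simpa [hy] using hB
  have := le_ciSup hb x
  simpa [supAbs, hx] using this

lemma bdd_closed {u : E2 → ℝ} (hu : ContinuousOn u (closedBall 0 1)) : ∃ B : ℝ, 0 ≤ B ∧ ∀ x ∈ closedBall (0 : E2) 1, |u x| ≤ B := by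
  obtain ⟨B, hB⟩ := (isCompact_closedBall (0 : E2) 1).exists_bound_of_continuousOn hu
  exact ⟨B, (norm_nonneg _).trans (hB 0 (by simp)), hB⟩

lemma holder_le {f : E2 → ℝ} {α : ℝ} (hf : ContinuousOn f (closedBall 0 1))
    (hH : ∃ H : ℝ, ∀ x ∈ closedBall (0 : E2) 1, ∀ y ∈ closedBall (0 : E2) 1, |f x - f y| ≤ H * ‖x - y‖ ^ α) :
    0 ≤ holderNormBall α f ∧ (∀ x ∈ closedBall (0 : E2) 1, |f x| ≤ holderNormBall α f) ∧
    ∀ x ∈ closedBall (0 : E2) 1, ∀ y ∈ closedBall (0 : E2) 1, |f x - f y| ≤ holderNormBall α f * ‖x - y‖ ^ α := by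
  obtain ⟨B, hB0, hB⟩ := bdd_closed hf
  obtain ⟨H, hH⟩ := hH
  have h1 := supAbs_nonneg f (closedBall 0 1)
  set S := ⨆ p : E2 × E2,
      if p.1 ∈ closedBall (0 : E2) 1 ∧ p.2 ∈ closedBall (0 : E2) 1 ∧ p.1 ≠ p.2 then
        |f p.1 - f p.2| / ‖p.1 - p.2‖ ^ α
      else 0 with hS
  have e : holderNormBall α f = supAbs f (closedBall 0 1) + S := rfl
  have h2 : 0 ≤ S := Real.iSup_nonneg fun p => by split_ifs <;> positivity
  have hb : BddAbove (range fun p : E2 × E2 => if p.1 ∈ closedBall (0 : E2) 1 ∧ p.2 ∈ closedBall (0 : E2) 1 ∧ p.1 ≠ p.2 then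
        |f p.1 - f p.2| / ‖p.1 - p.2‖ ^ α
      else 0) := by
    refine ⟨max H 0, ?_⟩
    rintro _ ⟨p, rfl⟩
    dsimp only
    split_ifs with hp
    · have hpos : 0 < ‖p.1 - p.2‖ ^ α := rpow_pos_of_pos (norm_pos_iff.mpr (sub_ne_zero.mpr hp.2.2)) _
      rw [div_le_iff₀ hpos]
      exact (hH _ hp.1 _ hp.2.1).trans (mul_le_mul_of_nonneg_right (le_max_left _ _) hpos.le)
    · exact le_max_right _ _
  refine ⟨by rw [e]; positivity, ?_, ?_⟩
  · intro x hx
    rw [e]; linarith [le_supAbs hB0 hB hx]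
  · intro x hx y hy
    by_cases hxy : x = y
    · subst hxy
      rw [sub_self, abs_zero, e]; positivity
    have hpos : 0 < ‖x - y‖ ^ α := rpow_pos_of_pos (norm_pos_iff.mpr (sub_ne_zero.mpr hxy)) _
    have h3 := le_ciSup hb (x, y)
    rw [← hS] at h3
    dsimp only at h3
    rw [if_pos ⟨hx, hy, hxy⟩, div_le_iff₀ hpos] at h3
    refine h3.trans (mul_le_mul_of_nonneg_right ?_ hpos.le)
    rw [e]; linarith

lemma main_A {lam Lam b c K₁ α : ℝ} (hlam : 0 < lam) (hLam : lam ≤ Lam) (hb : 0 ≤ b) (hc : 0 ≤ c) (hK1 : 0 ≤ K₁)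
    (hα0 : 0 < α) (hα1 : α ≤ 1) (hα : 2 * α < mor ((Lam - lam) / (Lam + lam))) :
    ∃ C : ℝ, 0 < C ∧ ∀ (F : Mat2 → E2 → ℝ → E2 → ℝ) (f u : E2 → ℝ) (K₂ A : ℝ), 0 < A →
    UniformlyEllipticGen lam Lam b c F →
    (∀ (M : Mat2) (p : E2) (s : ℝ), M.IsHermitian →
              ∀ x ∈ ball (0 : E2) 1, ∀ y ∈ ball (0 : E2) 1,
                |F M p s x - F M p s y| ≤
                  K₁ * ‖x - y‖ ^ α * (matNorm M + ‖p‖ + |s|) + K₂ * ‖x - y‖ ^ α) →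
    0 ≤ K₂ → K₂ ≤ A → |F 0 0 0 0| ≤ A → (∀ x ∈ ball (0 : E2) 1, |f x| ≤ A) →
    (∀ x ∈ ball (0 : E2) 1, ∀ y ∈ ball (0 : E2) 1, |f x - f y| ≤ A * ‖x - y‖ ^ α) →
    (∀ x ∈ ball (0 : E2) 1, |u x| ≤ A) → ContinuousOn u (closedBall (0 : E2) 1) →
    IsViscositySolGen F f u (ball (0 : E2) 1) →
    (∀ x ∈ closedBall (0 : E2) (1 / 2), ContDiffAt ℝ 2 u x ∧ |u x| ≤ C * A ∧ ‖fderiv ℝ u x‖ ≤ C * A ∧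
      matNorm (hess u x) ≤ C * A) ∧
    (∀ x ∈ closedBall (0 : E2) (1 / 2), ∀ y ∈ closedBall (0 : E2) (1 / 2),
              matNorm (hess u x - hess u y) ≤ C * A * ‖x - y‖ ^ α) := by
  have hk0 : 0 ≤ (Lam - lam) / (Lam + lam) := div_nonneg (by linarith) (by linarith)
  have hk1 : (Lam - lam) / (Lam + lam) < 1 := by rw [div_lt_one (by linarith)]; linarith
  have hβ0 : 0 ≤ (b + c) / lam := by positivity
  have hK0 : 0 ≤ K₁ * (3 + (b + c) / lam) / lam := by positivity
  obtain ⟨C, r, hC, hr, HC⟩ := main_C hk0 hk1 hα0 hα1 hα hβ0 hK0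
  set κ := 1 + 3 / lam + (2 + 3 * K₁ / lam) / lam with hκ
  have p1 : 0 ≤ 3 / lam := by positivity
  have p2 : 0 ≤ (2 + 3 * K₁ / lam) / lam := by positivity
  have hκ0 : 0 < κ := by linarith
  set q := 108 + 2 * (2 / r) ^ α with hq
  have hq1 : 1 ≤ q := by
    have : 0 ≤ (2 / r) ^ α := by positivity
    linarith
  refine ⟨1 + 3 * q * (C * κ), by positivity, ?_⟩
  intro F f u K₂ A hA hF hH hK20 hK2 hF0 hf hfh hu huc hv
  obtain ⟨g, hg, hg0, hvg⟩ := build_g hlam hLam hb hc hK1 hα0 hF hH hK20 hK2 hF0 hf hfh hv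
  have q1 : 0 ≤ 3 / lam * A := by positivity
  have q2 : 0 ≤ (2 + 3 * K₁ / lam) / lam * A := by positivity
  have qs : κ * A = A + 3 / lam * A + (2 + 3 * K₁ / lam) / lam * A := by rw [hκ]; ring
  have hg' : Gok ((Lam - lam) / (Lam + lam)) ((b + c) / lam) (K₁ * (3 + (b + c) / lam) / lam) (κ * A) α g := by
    refine ⟨hg.lip, fun z z' s p m => (hg.hol z z' s p m).trans ?_⟩
    refine mul_le_mul_of_nonneg_right ?_ (by positivity)
    linarith
  have hsub : ∀ z : ℂ, ‖z‖ ≤ 3 / 5 → eC z ∈ ball (0 : E2) 1 := by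
    intro z hz
    rw [mem_ball_zero_iff, LinearIsometryEquiv.norm_map]; linarith
  have hvc : ContinuousOn (fun z => u (eC z)) (closedBall 0 (3 / 5)) := by
    refine huc.comp eC.continuous.continuousOn ?_
    intro z hz
    exact ball_subset_closedBall (hsub z (by simpa using hz))
  have Hx := HC g (fun z => u (eC z)) (κ * A) (by positivity) hg' (by linarith)
    (fun z hz => (hu _ (hsub z hz)).trans (by linarith)) hvc hvg
  choose! P τ μ hP hτ hμ HQ using Hx
  set D := C * (κ * A) with hD
  have hD0 : 0 ≤ D := by positivity
  have hxx : ∀ x ∈ closedBall (0 : E2) (1 / 2), ‖eC.symm x‖ < 11 / 20 := by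
    intro x hx
    rw [LinearIsometryEquiv.norm_map]
    have := mem_closedBall_zero_iff.mp hx
    linarith
  have hue : (fun y => u (eC (eC.symm y))) = u := by funext y; simp
  have T : ∀ x ∈ closedBall (0 : E2) (1 / 2), HasFDerivAt u (innerSL ℝ (eC (P (eC.symm x)))) x ∧
      hess u x = Mt (τ (eC.symm x)) (μ (eC.symm x)) := by
    intro x hx
    have hx' := hxx x hx
    have := transfer (v := fun z => u (eC z)) (P := P) (x := x) (by
      filter_upwards [isOpen_ball.mem_nhds (show eC.symm x ∈ ball (0:ℂ) (11 / 20) by simpa using hx')] with z hz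
      exact B_du (u := fun z => u (eC z)) hα0 hα1 hD0 hr HQ (le_of_lt (by simpa using hz)))
      (B_dP (u := fun z => u (eC z)) hα0 hα1 hD0 hr HQ hx')
    rwa [hue] at this
  have hDq : D ≤ q * D := by
    have := mul_le_mul_of_nonneg_right hq1 hD0
    linarith
  have hCA : (1 + 3 * q * (C * κ)) * A = A + 3 * (q * D) := by rw [hD]; ring
  rw [hCA]
  refine ⟨?_, ?_⟩
  · intro x hx
    have hx' := hxx x hx
    obtain ⟨t1, t2⟩ := T x hx
    refine ⟨?_, ?_, ?_, ?_⟩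
    · have := B_C2 (u := fun z => u (eC z)) hα0 hα1 hD0 hr HQ hx'
      have h2 := this.comp x (eC.symm.toContinuousLinearEquiv : E2 →L[ℝ] ℂ).contDiff.contDiffAt
      have e : ((fun z => u (eC z)) ∘ (eC.symm.toContinuousLinearEquiv : E2 →L[ℝ] ℂ)) = u := hue
      rw [← e]; exact h2
    · have := hu x (by
        have := mem_closedBall_zero_iff.mp hx
        rw [mem_ball_zero_iff]; linarith)
      linarith
    · rw [t1.fderiv, innerSL_apply_norm, LinearIsometryEquiv.norm_map]
      linarith [hP _ hx'.le]
    · rw [t2]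
      refine (Mt_norm _ _).trans ?_
      linarith [hτ _ hx'.le, hμ _ hx'.le]
  · intro x hx y hy
    have hx' := hxx x hx
    have hy' := hxx y hy
    rw [(T x hx).2, (T y hy).2, Mt_sub]
    obtain ⟨h1, h2⟩ := B_hol (u := fun z => u (eC z)) hα0 hα1 hD0 hr HQ (fun z hz => ⟨hτ z hz, hμ z hz⟩) hx'.le hy'.le
    rw [← map_sub, LinearIsometryEquiv.norm_map, ← hq] at h1 h2
    refine (Mt_norm _ _).trans ?_
    have := mul_nonneg hA.le (rpow_nonneg (norm_nonneg (x - y)) α)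
    linarith

/-- Interior `C^{2,α}` regularity for general fully nonlinear equations
`F(D²u, Du, u, x) = f` in `B₁ ⊂ ℝ²`: with `ᾱ ∈ (0,1)` the universal exponent (depending
only on `lam, Lam`) and `0 < α < ᾱ`, if `F` is continuous, uniformly elliptic with
constants `lam, Lam, b, c`, Hölder in `x` with constants `K₁, K₂`, `f ∈ C^α(B̄₁)` and `u`
is a continuous viscosity solution, then `u ∈ C^{2,α}(B̄_{1/2})` with
`‖u‖_{C^{2,α}(B̄_{1/2})} ≤ C(‖u‖_{L^∞(B₁)} + ‖f‖_{C^α(B̄₁)} + |F(0,0,0,0)| + K₂)`,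
where `C` depends only on `lam, Lam, b, c, K₁, α`. -/
theorem interior_C2alpha_general (lam Lam : ℝ) (hlam : 0 < lam) (hLam : lam ≤ Lam) :
    ∃ abar : ℝ, abar ∈ Set.Ioo (0 : ℝ) 1 ∧
      ∀ b c K₁ α : ℝ, 0 ≤ b → 0 ≤ c → 0 ≤ K₁ → 0 < α → α < abar →
        ∃ C : ℝ, 0 < C ∧
          ∀ (F : Mat2 → E2 → ℝ → E2 → ℝ) (f u : E2 → ℝ) (K₂ : ℝ), 0 ≤ K₂ →
            ContinuousOn
              (fun z : (Fin 2 → Fin 2 → ℝ) × E2 × ℝ × E2 =>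
                F (Matrix.of z.1) z.2.1 z.2.2.1 z.2.2.2)
              {z | z.2.2.2 ∈ ball (0 : E2) 1} →
            UniformlyEllipticGen lam Lam b c F →
            (∀ (M : Mat2) (p : E2) (s : ℝ), M.IsHermitian →
              ∀ x ∈ ball (0 : E2) 1, ∀ y ∈ ball (0 : E2) 1,
                |F M p s x - F M p s y| ≤
                  K₁ * ‖x - y‖ ^ α * (matNorm M + ‖p‖ + |s|) + K₂ * ‖x - y‖ ^ α) →
            ContinuousOn f (closedBall (0 : E2) 1) →
            (∃ H : ℝ, ∀ x ∈ closedBall (0 : E2) 1, ∀ y ∈ closedBall (0 : E2) 1,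
              |f x - f y| ≤ H * ‖x - y‖ ^ α) →
            ContinuousOn u (closedBall (0 : E2) 1) →
            IsViscositySolGen F f u (ball (0 : E2) 1) →
            (∀ x ∈ closedBall (0 : E2) (1 / 2), ContDiffAt ℝ 2 u x) ∧
            (∀ x ∈ closedBall (0 : E2) (1 / 2),
              |u x| ≤ C * (supAbs u (ball 0 1) + holderNormBall α f + |F 0 0 0 0| + K₂) ∧
              ‖fderiv ℝ u x‖ ≤
                C * (supAbs u (ball 0 1) + holderNormBall α f + |F 0 0 0 0| + K₂) ∧
              matNorm (hess u x) ≤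
                C * (supAbs u (ball 0 1) + holderNormBall α f + |F 0 0 0 0| + K₂)) ∧
            (∀ x ∈ closedBall (0 : E2) (1 / 2), ∀ y ∈ closedBall (0 : E2) (1 / 2),
              matNorm (hess u x - hess u y) ≤
                C * (supAbs u (ball 0 1) + holderNormBall α f + |F 0 0 0 0| + K₂) *
                  ‖x - y‖ ^ α) := by
  have hk0 : 0 ≤ (Lam - lam) / (Lam + lam) := div_nonneg (by linarith) (by linarith)
  have hk1 : (Lam - lam) / (Lam + lam) < 1 := by rw [div_lt_one (by linarith)]; linarith
  have hm := mor_pos hk1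
  have hm1 : mor ((Lam - lam) / (Lam + lam)) ≤ 1 := by
    unfold mor
    rw [div_le_one (by positivity)]
    linarith [Real.pi_gt_three]
  refine ⟨mor ((Lam - lam) / (Lam + lam)) / 2, ⟨by linarith, by linarith⟩, ?_⟩
  intro b c K₁ α hb hc hK1 hα0 hα
  obtain ⟨C, hC, H⟩ := main_A hlam hLam hb hc hK1 hα0 (by linarith) (by linarith : 2 * α < mor ((Lam - lam) / (Lam + lam)))
  refine ⟨C, hC, ?_⟩
  intro F f u K₂ hK2 _ hF hH hf hfH hu hv
  obtain ⟨h0, h1, h2⟩ := holder_le hf hfH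
  obtain ⟨B, hB0, hB⟩ := bdd_closed hu
  have hs := supAbs_nonneg u (ball 0 1)
  have hF0 := abs_nonneg (F 0 0 0 0)
  have hus : ∀ x ∈ ball (0 : E2) 1, |u x| ≤ supAbs u (ball 0 1) := fun x hx =>
    le_supAbs hB0 (fun y hy => hB y (ball_subset_closedBall hy)) hx
  set T := supAbs u (ball 0 1) + holderNormBall α f + |F 0 0 0 0| + K₂ with hT
  have R := fun (η : ℝ) (hη : 0 < η) => H F f u K₂ (T + η) (by linarith) hF hH hK2 (by linarith) (by linarith)
    (fun x hx => (h1 x (ball_subset_closedBall hx)).trans (by linarith))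
    (fun x hx y hy => (h2 x (ball_subset_closedBall hx) y (ball_subset_closedBall hy)).trans
      (mul_le_mul_of_nonneg_right (by linarith) (by positivity)))
    (fun x hx => (hus x hx).trans (by linarith)) hu hv
  have lim1 : ∀ X : ℝ, (∀ η : ℝ, 0 < η → X ≤ C * (T + η)) → X ≤ C * T := by
    intro X hX
    have := lim_eta (X := X) (C := C) (T := T) (d := 1) (fun η hη => by rw [mul_one]; exact hX η hη)
    rwa [mul_one] at this
  refine ⟨fun x hx => ((R 1 one_pos).1 x hx).1, fun x hx => ⟨?_, ?_, ?_⟩, fun x hx y hy => ?_⟩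
  · exact lim1 _ fun η hη => ((R η hη).1 x hx).2.1
  · exact lim1 _ fun η hη => ((R η hη).1 x hx).2.2.1
  · exact lim1 _ fun η hη => ((R η hη).1 x hx).2.2.2
  · exact lim_eta fun η hη => (R η hη).2 x hx y hy
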